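/- Let S be a finite alphabet with complementation, let d ∈ {5, 6}, and let V, W ⊆ S^d be disjoint equivalent polybox codes without twin pairs with |V| ∈ {13,...,16} such that V is not flat. Then the codes V and W can be written down in a four-letter alphabet: for every i ∈ [d] there exist letters l, s ∈ S such that every letter occurring at position i in a word of V ∪ W belongs to {l, l', s, s'}; equivalently, V and W are simultaneously isomorphic (via per-coordinate letter bijections commuting with complementation) to codes over the alphabet {a, a', b, b'}. -/

import Mathlib

/-- Two words `u, v ∈ S^d` are dichotomous if `v j = (u j)'` for some coordinate `j`. -/
def Dichotomous {S : Type*} (c : S → S) {d : ℕ} (u v : Fin d → S) : Prop :=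
  ∃ j, v j = c (u j)

/-- Two words form a twin pair if they differ by complementation at exactly one
coordinate and agree elsewhere. -/
def TwinPair {S : Type*} (c : S → S) {d : ℕ} (u v : Fin d → S) : Prop :=
  ∃ j, v j = c (u j) ∧ ∀ i, i ≠ j → u i = v i

/-- A polybox code: a set of pairwise dichotomous words. -/
def PolyboxCode {S : Type*} (c : S → S) {d : ℕ} (V : Finset (Fin d → S)) : Prop :=
  ∀ u ∈ V, ∀ v ∈ V, u ≠ v → Dichotomous c u v

/-- A code without twin pairs. -/
def TwinPairFree {S : Type*} (c : S → S) {d : ℕ} (V : Finset (Fin d → S)) : Prop :=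
  ∀ u ∈ V, ∀ v ∈ V, ¬ TwinPair c u v

/-- `ES`: the collection of all `B ⊆ S` containing exactly one letter from each
complementary pair `{s, s'}`. -/
def ESet {S : Type*} (c : S → S) : Set (Set S) :=
  {B | ∀ s : S, Xor' (s ∈ B) (c s ∈ B)}

/-- The equicomplementary realization `v̆ = Ev₁ × ⋯ × Ev_d` of a word `v`,
where `Es = {B ∈ ES : s ∈ B}`. -/
def WordBox {S : Type*} (c : S → S) {d : ℕ} (v : Fin d → S) : Set (Fin d → Set S) :=
  {x | ∀ i, x i ∈ ESet c ∧ v i ∈ x i}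

/-- `⋃ E(V)`, the union of the equicomplementary realizations of the words of `V`. -/
def CodeReal {S : Type*} (c : S → S) {d : ℕ} (V : Finset (Fin d → S)) :
    Set (Fin d → Set S) :=
  ⋃ v ∈ V, WordBox c v

/-- The word `w` is covered by the code `V`, i.e. `w̆ ⊆ ⋃ E(V)`. -/
def Covered {S : Type*} (c : S → S) {d : ℕ} (w : Fin d → S)
    (V : Finset (Fin d → S)) : Prop :=
  WordBox c w ⊆ CodeReal c V

/-- Codes `V` and `W` are equivalent: `⋃ E(V) = ⋃ E(W)`. -/
def EquivalentCodes {S : Type*} (c : S → S) {d : ℕ} (V W : Finset (Fin d → S)) : Prop :=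
  CodeReal c V = CodeReal c W

/-- A code is flat if all its words share the same fixed letter at some fixed
coordinate, i.e. `V = V^{i,l}` for some `i ∈ [d]` and `l ∈ S`. -/
def IsFlat {S : Type*} (c : S → S) {d : ℕ} (V : Finset (Fin d → S)) : Prop :=
  ∃ i : Fin d, ∃ l : S, ∀ v ∈ V, v i = l

namespace PB
set_option linter.all false
set_option linter.unusedSectionVars false
set_option linter.unusedVariables false
set_option linter.style.longLine false
open Finset Function

structure CI {S : Type*} (c : S → S) : Prop where
  inv : ∀ s, c (c s) = s
  nf : ∀ s, c s ≠ s

def HU {S : Type*} (c : S → S) (u : S → ℚ) : Prop :=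
  ∀ s, u (c s) = 1 - u s ∧ (u s = 0 ∨ u s = 1/2 ∨ u s = 1)
def HP {ι S : Type*} (c : S → S) (x : ι → S → ℚ) : Prop := ∀ j, HU c (x j)
def val {ι S : Type*} (T : Finset ι) (e : ι → S) (x : ι → S → ℚ) : ℚ := ∏ j ∈ T, x j (e j)
def sm {ι S : Type*} (T : Finset ι) (E : Finset (ι → S)) (x : ι → S → ℚ) : ℚ :=
  ∑ e ∈ E, val T e x
def InB {ι S : Type*} (T : Finset ι) (y : ι → S) (x : ι → S → ℚ) : Prop := ∀ j ∈ T, x j (y j) = 1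
def DT {ι S : Type*} (c : S → S) (T : Finset ι) (u v : ι → S) : Prop := ∃ j ∈ T, v j = c (u j)
def EqT {ι S : Type*} (T : Finset ι) (u v : ι → S) : Prop := ∀ j ∈ T, u j = v j
def Code {ι S : Type*} (c : S → S) (T : Finset ι) (E : Finset (ι → S)) : Prop :=
  ∀ u ∈ E, ∀ v ∈ E, u ≠ v → DT c T u v
def TF {ι S : Type*} [DecidableEq ι] (c : S → S) (T : Finset ι) (E : Finset (ι → S)) : Prop :=
  ∀ u ∈ E, ∀ v ∈ E, ∀ j ∈ T, v j = c (u j) → ¬ EqT (T.erase j) u v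
def Apart {ι S : Type*} (T : Finset ι) (E F : Finset (ι → S)) : Prop :=
  ∀ e ∈ E, ∀ f ∈ F, ¬ EqT T e f
def fl {ι S : Type*} [DecidableEq S] (E : Finset (ι → S)) (j : ι) (l : S) : Finset (ι → S) :=
  E.filter (fun e => e j = l)
def mk {S : Type*} [DecidableEq S] (c : S → S) (L : List S) (s : S) : ℚ :=
  if s ∈ L then 1 else if c s ∈ L then 0 else 1/2

variable {ι S : Type*} [Fintype ι] [DecidableEq ι] [DecidableEq S] {c : S → S}
  {T U : Finset ι} {E F A B C D M N : Finset (ι → S)} {x : ι → S → ℚ} {j k : ι} {e f g y t a : ι → S}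
  {l s : S} {u : S → ℚ}

theorem CI.inj (hc : CI c) {a b : S} (h : c a = c b) : a = b := by
  rw [← hc.inv a, h, hc.inv]

theorem mk_HU (hc : CI c) {L : List S} (h : ∀ s ∈ L, c s ∉ L) : HU c (mk c L) := by
  intro s
  unfold mk
  rw [hc.inv]
  by_cases h1 : s ∈ L
  · have := h s h1
    simp [h1, this]
  · by_cases h2 : c s ∈ L <;> simp [h1, h2] <;> norm_num

theorem mk_one {L : List S} (h : s ∈ L) : mk c L s = 1 := by simp [mk, h]
theorem mk_zero (hc : CI c) {L : List S} (h : ∀ s ∈ L, c s ∉ L) (h' : c s ∈ L) : mk c L s = 0 := by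
  have : s ∉ L := fun h2 => h _ h2 h'
  simp [mk, h', this]
theorem mk_half {L : List S} (h : s ∉ L) (h' : c s ∉ L) : mk c L s = 1/2 := by simp [mk, h, h']

theorem mk_diff (hc : CI c) {L : List S} (h1 : l ∉ L) (h2 : c l ∉ L) (s : S) :
    mk c (l :: L) s - mk c (c l :: L) s = (if s = l then 1 else 0) - (if s = c l then 1 else 0) := by
  have nf := hc.nf l
  by_cases a1 : s = l
  · subst a1; simp [mk, h1, h2, nf.symm]
  · by_cases a2 : s = c l
    · subst a2; simp [mk, h1, h2, nf, hc.inv]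
    · have a3 : c s ≠ l := fun h => a2 (by rw [← h, hc.inv])
      have a4 : c s ≠ c l := fun h => a1 (hc.inj h)
      simp [mk, a1, a2, a3, a4]

theorem HU.le (h : HU c u) (s : S) : 0 ≤ u s ∧ u s ≤ 1 := by
  rcases (h s).2 with h | h | h <;> rw [h] <;> norm_num

theorem val_erase (hj : j ∈ T) : val T e x = x j (e j) * val (T.erase j) e x :=
  (Finset.mul_prod_erase T (fun j => x j (e j)) hj).symm
theorem val_upd : val (T.erase j) e (update x j u) = val (T.erase j) e x := by
  unfold val
  apply Finset.prod_congr rfl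
  intro i hi
  rw [update_of_ne (Finset.ne_of_mem_erase hi)]
theorem val_upd' (hj : j ∈ T) : val T e (update x j u) = u (e j) * val (T.erase j) e x := by
  rw [val_erase hj, val_upd]; simp
theorem sm_upd (hj : j ∈ T) : sm T E (update x j u) = ∑ e ∈ E, u (e j) * val (T.erase j) e x := by
  unfold sm; exact Finset.sum_congr rfl (fun e _ => val_upd' hj)
theorem sm_upd0 : sm (T.erase j) E (update x j u) = sm (T.erase j) E x := by
  unfold sm; exact Finset.sum_congr rfl (fun e _ => val_upd)
theorem HP_upd (hx : HP c x) (hu : HU c u) : HP c (update x j u) := by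
  intro i
  by_cases h : i = j
  · subst h; simpa using hu
  · rw [update_of_ne h]; exact hx i
theorem InB_upd (h : InB (T.erase j) y x) (hu : j ∈ T → u (y j) = 1) : InB T y (update x j u) := by
  intro i hi
  by_cases h' : i = j
  · subst h'; simpa using hu hi
  · rw [update_of_ne h']; exact h i (by simp [h', hi])

theorem val_nonneg (hx : HP c x) : 0 ≤ val T e x := Finset.prod_nonneg (fun j _ => ((hx j).le _).1)
theorem val_le (hx : HP c x) : val T e x ≤ 1 :=
  Finset.prod_le_one (fun j _ => ((hx j).le _).1) (fun j _ => ((hx j).le _).2)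
theorem val_one (h : InB T e x) : val T e x = 1 := Finset.prod_eq_one h
theorem val_zero (hx : HP c x) (h : InB T y x) (hd : DT c T y e) : val T e x = 0 := by
  obtain ⟨j, hj, h'⟩ := hd
  apply Finset.prod_eq_zero hj
  rw [h', (hx j _).1, h j hj]; norm_num
theorem val_eqT (h : EqT T e f) : val T e x = val T f x :=
  Finset.prod_congr rfl (fun j hj => by rw [h j hj])
theorem sm_nonneg (hx : HP c x) : 0 ≤ sm T E x := Finset.sum_nonneg (fun _ _ => val_nonneg hx)
theorem val_le_sm (hx : HP c x) (he : e ∈ E) : val T e x ≤ sm T E x :=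
  Finset.single_le_sum (f := fun e => val T e x) (fun _ _ => val_nonneg hx) he
theorem two_le_sm (hx : HP c x) (he : e ∈ E) (hf : f ∈ E) (h : e ≠ f) :
    val T e x + val T f x ≤ sm T E x := by
  have : ({e, f} : Finset (ι → S)) ⊆ E := by
    intro z hz; simp at hz; rcases hz with rfl | rfl <;> assumption
  have h2 := Finset.sum_le_sum_of_subset_of_nonneg (f := fun e => val T e x) this
    (fun _ _ _ => val_nonneg hx)
  rwa [Finset.sum_pair h] at h2
@[simp] theorem sm_empty : sm T (∅ : Finset (ι → S)) x = 0 := rfl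
@[simp] theorem sm_single : sm T {e} x = val T e x := by simp [sm]
theorem sm_pair (h : e ≠ f) : sm T {e, f} x = val T e x + val T f x := by
  simp [sm, Finset.sum_pair h]
theorem sm_union (h : Disjoint E F) : sm T (E ∪ F) x = sm T E x + sm T F x := Finset.sum_union h
theorem sm_erase (h : e ∈ E) : sm T E x = val T e x + sm T (E.erase e) x :=
  (Finset.add_sum_erase E (fun e => val T e x) h).symm
theorem sm_filter (p : (ι → S) → Prop) [DecidablePred p] :
    sm T E x = sm T (E.filter p) x + sm T (E.filter (fun e => ¬ p e)) x :=
  (Finset.sum_filter_add_sum_filter_not E p _).symm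

theorem DT.symm (hc : CI c) (h : DT c T e f) : DT c T f e := by
  obtain ⟨j, hj, h⟩ := h
  exact ⟨j, hj, by rw [h, hc.inv]⟩
theorem EqT.symm (h : EqT T e f) : EqT T f e := fun j hj => (h j hj).symm
theorem EqT.trans (h : EqT T e f) (h' : EqT T f g) : EqT T e g :=
  fun j hj => (h j hj).trans (h' j hj)
theorem EqT.mono (h : EqT T e f) (h' : U ⊆ T) : EqT U e f := fun j hj => h j (h' hj)
theorem EqT.ext (h : EqT (T.erase j) e f) (h' : e j = f j) : EqT T e f := by
  intro i hi
  by_cases hh : i = j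
  · rw [hh, h']
  · exact h i (by simp [hh, hi])
theorem notDT_self (hc : CI c) : ¬ DT c T e e := by
  rintro ⟨j, _, h⟩; exact hc.nf _ h.symm
theorem notDT_eq (hc : CI c) (h : EqT T e f) : ¬ DT c T e f := by
  rintro ⟨j, hj, h'⟩; exact hc.nf (e j) (by rw [← h', h j hj])
theorem DT.mono (h : DT c U e f) (h' : U ⊆ T) : DT c T e f := by
  obtain ⟨j, hj, h⟩ := h; exact ⟨j, h' hj, h⟩
theorem DT.congr (h : DT c T e f) (h1 : EqT T e g) : DT c T g f := by
  obtain ⟨j, hj, h⟩ := h; exact ⟨j, hj, by rw [← h1 j hj, h]⟩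

/-- a common point of two words -/
theorem meet_pt (hc : CI c) (h : ¬ DT c T y e) : ∃ x, HP c x ∧ InB T y x ∧ InB T e x := by
  refine ⟨fun j => mk c (if j ∈ T then [y j, e j] else []), ?_, ?_, ?_⟩
  · intro j
    apply mk_HU hc
    by_cases hj : j ∈ T
    · simp only [hj, if_true]
      have h1 : e j ≠ c (y j) := fun h' => h ⟨j, hj, h'⟩
      have h2 : y j ≠ c (e j) := fun h' => h1 (by rw [h', hc.inv])
      intro s hs
      simp at hs ⊢
      rcases hs with rfl | rfl
      · exact ⟨hc.nf _, h1.symm⟩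
      · exact ⟨h2.symm, hc.nf _⟩
    · simp [hj]
  · intro j hj; simp [hj, mk]
  · intro j hj; simp [hj, mk]

theorem fl_mem : e ∈ fl E j l ↔ e ∈ E ∧ e j = l := by simp [fl]
theorem fl_sub : fl E j l ⊆ E := Finset.filter_subset _ _
theorem Code.mono (h : Code c T E) (h' : F ⊆ E) : Code c T F :=
  fun u hu v hv => h u (h' hu) v (h' hv)
theorem TF.mono (h : TF c T E) (h' : F ⊆ E) : TF c T F :=
  fun u hu v hv => h u (h' hu) v (h' hv)
theorem Apart.mono (h : Apart T A B) (h1 : E ⊆ A) (h2 : F ⊆ B) : Apart T E F :=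
  fun u hu v hv => h u (h1 hu) v (h2 hv)
theorem Apart.symm (h : Apart T A B) : Apart T B A := fun u hu v hv h' => h v hv u hu h'.symm

theorem Code.er (hc : CI c) (h : Code c T E) (hl : ∀ e ∈ E, e j = l) : Code c (T.erase j) E := by
  intro u hu v hv huv
  obtain ⟨i, hi, h'⟩ := h u hu v hv huv
  refine ⟨i, ?_, h'⟩
  rw [Finset.mem_erase]
  refine ⟨?_, hi⟩
  rintro rfl
  rw [hl u hu, hl v hv] at h'
  exact hc.nf _ h'.symm
theorem TF.er (h : TF c T E) (hl : ∀ e ∈ E, e j = l) : TF c (T.erase j) E := by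
  intro u hu v hv i hi h' h2
  apply h u hu v hv i (Finset.mem_of_mem_erase hi) h'
  intro m hm
  by_cases hh : m = j
  · rw [hh, hl u hu, hl v hv]
  · apply h2; simp at hm ⊢; tauto
theorem TF.apart (h : TF c T E) (hj : j ∈ T) : Apart (T.erase j) (fl E j l) (fl E j (c l)) := by
  intro e he f hf
  rw [fl_mem] at he hf
  exact h e he.1 f hf.1 j hj (by rw [hf.2, he.2])
theorem Code.fl (hc : CI c) (h : Code c T E) : Code c (T.erase j) (fl E j l) :=
  (h.mono fl_sub).er hc (fun _ he => (fl_mem.1 he).2)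
theorem TF.fl (h : TF c T E) : TF c (T.erase j) (fl E j l) :=
  (h.mono fl_sub).er (fun _ he => (fl_mem.1 he).2)
theorem Apart.fl (h : Apart T E F) : Apart (T.erase j) (fl E j l) (fl F j l) := by
  intro e he f hf h'
  rw [fl_mem] at he hf
  exact h e he.1 f hf.1 (h'.ext (by rw [he.2, hf.2]))

theorem slice_gen (hc : CI c) {L : List S} (h1 : l ∉ L) (h2 : c l ∉ L) :
    ∑ e ∈ E, mk c (l :: L) (e j) * val U e x - ∑ e ∈ E, mk c (c l :: L) (e j) * val U e x
      = sm U (fl E j l) x - sm U (fl E j (c l)) x := by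
  rw [← Finset.sum_sub_distrib]
  unfold sm fl
  rw [Finset.sum_filter, Finset.sum_filter, ← Finset.sum_sub_distrib]
  apply Finset.sum_congr rfl
  intro e _
  rw [← sub_mul, mk_diff hc h1 h2]
  split_ifs <;> ring

/-- slicing on a box (T0 is the set of constrained coordinates) -/
theorem S1 (hc : CI c) {T0 : Finset ι} (hj : j ∈ T) (hl : j ∈ T0 → l ≠ y j ∧ l ≠ c (y j))
    (h : ∀ x, HP c x → InB T0 y x → sm T A x + sm T D x = sm T B x + sm T C x) :
    ∀ x, HP c x → InB (T0.erase j) y x →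
      sm (T.erase j) (fl A j l) x + sm (T.erase j) (fl D j l) x
        + sm (T.erase j) (fl B j (c l)) x + sm (T.erase j) (fl C j (c l)) x
      = sm (T.erase j) (fl B j l) x + sm (T.erase j) (fl C j l) x
        + sm (T.erase j) (fl A j (c l)) x + sm (T.erase j) (fl D j (c l)) x := by
  intro x hx hb
  obtain ⟨L, hL1, hL2, hL3⟩ : ∃ L : List S, (j ∈ T0 → y j ∈ L) ∧ (∀ s ∈ L, c s ∉ L) ∧ l ∉ L ∧ c l ∉ L := by
    by_cases h0 : j ∈ T0
    · refine ⟨[y j], by simp, by simpa using hc.nf _, ?_⟩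
      have := hl h0
      simp
      exact ⟨this.1, fun h' => this.2 (by rw [← h', hc.inv])⟩
    · exact ⟨[], by simp [h0], by simp, by simp, by simp⟩
  have ok1 : HU c (mk c (l :: L)) := by
    apply mk_HU hc
    intro s hs
    simp at hs ⊢
    rcases hs with rfl | hs
    · exact ⟨hc.nf _, hL3.2⟩
    · refine ⟨?_, hL2 s hs⟩
      rintro rfl
      rw [hc.inv] at hL3; exact hL3.2 hs
  have ok2 : HU c (mk c (c l :: L)) := by
    apply mk_HU hc
    intro s hs
    simp at hs ⊢
    rcases hs with rfl | hs
    · rw [hc.inv]; exact ⟨(hc.nf _).symm, hL3.1⟩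
    · refine ⟨?_, hL2 s hs⟩
      intro h'
      exact hL3.1 (hc.inj h' ▸ hs)
  have q1 := h _ (HP_upd (j := j) hx ok1) (InB_upd hb (fun h0 => mk_one (by simp [hL1 h0])))
  have q2 := h _ (HP_upd (j := j) hx ok2) (InB_upd hb (fun h0 => mk_one (by simp [hL1 h0])))
  rw [sm_upd hj, sm_upd hj, sm_upd hj, sm_upd hj] at q1 q2
  have r (E : Finset (ι → S)) := slice_gen (E := E) (j := j) (U := T.erase j) (x := x) hc hL3.1 hL3.2
  have := r A; have := r B; have := r C; have := r D
  linarith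

end PB

namespace PB
open Finset Function
set_option linter.all false
variable {ι S : Type*} [Fintype ι] [DecidableEq ι] [DecidableEq S] {c : S → S}
  {T U : Finset ι} {E F A B C D M N : Finset (ι → S)} {x : ι → S → ℚ} {j k : ι} {e f g y t a : ι → S}
  {l s : S} {u : S → ℚ}

def MA (f : (ι → S → ℚ) → ℚ) : Prop :=
  ∀ x j (u v w : S → ℚ), (∀ s, w s = (u s + v s) / 2) →
    f (update x j w) = (f (update x j u) + f (update x j v)) / 2
def ZO (c : S → S) (x : ι → S → ℚ) : Prop := ∀ j s, x j (c s) = 1 - x j s ∧ (x j s = 0 ∨ x j s = 1)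

theorem ZO.hp (h : ZO c x) : HP c x := fun j s => ⟨(h j s).1, by rcases (h j s).2 with h | h <;> simp [h]⟩

theorem MA_const (q : ℚ) : MA (fun _ : ι → S → ℚ => q) := by intro x j u v w h; ring
theorem MA_val : MA (fun x : ι → S → ℚ => val T e x) := by
  intro x j u v w h
  by_cases hj : j ∈ T
  · simp only [val_upd' hj, h]; ring
  · have : T = T.erase j := by simp [hj]
    rw [this]; simp only [val_upd]; ring
theorem MA.add {f g : (ι → S → ℚ) → ℚ} (h1 : MA f) (h2 : MA g) : MA (fun x => f x + g x) := by
  intro x j u v w h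
  simp only [h1 x j u v w h, h2 x j u v w h]; ring
theorem MA.sub {f g : (ι → S → ℚ) → ℚ} (h1 : MA f) (h2 : MA g) : MA (fun x => f x - g x) := by
  intro x j u v w h
  simp only [h1 x j u v w h, h2 x j u v w h]; ring
theorem MA_sm : MA (fun x : ι → S → ℚ => sm T E x) := by
  intro x j u v w h
  simp only [sm]
  rw [← Finset.sum_add_distrib, Finset.sum_div]
  exact Finset.sum_congr rfl (fun e _ => MA_val x j u v w h)

theorem base_zo (hc : CI c) : ∃ x0 : S → ℚ, ∀ s, x0 (c s) = 1 - x0 s ∧ (x0 s = 0 ∨ x0 s = 1) := by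
  classical
  refine ⟨fun s => if WellOrderingRel s (c s) then 1 else 0, ?_⟩
  intro s
  simp only [hc.inv]
  rcases trichotomous_of (WellOrderingRel (α := S)) s (c s) with h | h | h
  · have h2 : ¬ WellOrderingRel (c s) s := fun h2 => asymm_of WellOrderingRel h h2
    simp [h, h2]
  · exact absurd h.symm (hc.nf s)
  · have h2 : ¬ WellOrderingRel s (c s) := fun h2 => asymm_of WellOrderingRel h h2
    simp [h, h2]

theorem ext_aux (hc : CI c) {f : (ι → S → ℚ) → ℚ} (hf : MA f) (J : Finset ι) :
    ∀ g : ι → S → ℚ, HP c g → (∀ j ∉ J, ∀ s, g j s = 0 ∨ g j s = 1) →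
      (∀ x, ZO c x → (∀ j s, g j s = 1 → x j s = 1) → 0 ≤ f x) → 0 ≤ f g := by
  induction J using Finset.induction_on with
  | empty =>
    intro g hg h1 h2
    exact h2 g (fun j s => ⟨(hg j s).1, h1 j (by simp) s⟩) (fun _ _ h => h)
  | insert a J ha ih =>
    intro g hg h1 h2
    obtain ⟨x0, hx0⟩ := base_zo hc
    have key : ∀ z : S → ℚ, (∀ s, z (c s) = 1 - z s ∧ (z s = 0 ∨ z s = 1)) →
        0 ≤ f (update g a (fun s => if g a s = 1/2 then z s else g a s)) := by
      intro z hz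
      have hU : HU c (fun s => if g a s = 1/2 then z s else g a s) := by
        intro s
        have := hg a s
        by_cases h3 : g a s = 1/2
        · have h4 : g a (c s) = 1/2 := by rw [this.1, h3]; norm_num
          simp only [h3, h4, if_true]
          refine ⟨(hz s).1, by rcases (hz s).2 with h | h <;> simp [h]⟩
        · have h4 : g a (c s) ≠ 1/2 := by
            rw [this.1]; intro h; apply h3; linarith
          beta_reduce
          rw [if_neg h3, if_neg h4]
          exact this
      apply ih _ (HP_upd hg hU)
      · intro j hj s
        by_cases hja : j = a
        · subst hja
          simp only [update_self]
          by_cases h3 : g j s = 1/2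
          · simp only [h3, if_true]; exact (hz s).2
          · simp only [h3, if_false]; have := (hg j s).2; tauto
        · rw [update_of_ne hja]; exact h1 j (by simp [hja, hj]) s
      · intro x hx hxx
        apply h2 x hx
        intro j s hjs
        apply hxx
        by_cases hja : j = a
        · subst hja; simp [hjs]
        · rw [update_of_ne hja]; exact hjs
    have k1 := key x0 hx0
    have k2 := key (fun s => 1 - x0 s) (fun s => by
      rcases (hx0 s) with ⟨h, h' | h'⟩ <;> simp [h, h'])
    have := hf g a (fun s => if g a s = 1/2 then x0 s else g a s)
      (fun s => if g a s = 1/2 then 1 - x0 s else g a s) (g a) (by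
        intro s
        by_cases h3 : g a s = 1/2
        · simp only [h3, if_true]; ring
        · simp only [h3, if_false]; ring)
    rw [update_eq_self] at this
    rw [this]; linarith

theorem ext01 (hc : CI c) {f : (ι → S → ℚ) → ℚ} (hf : MA f) {g : ι → S → ℚ} (hg : HP c g)
    (h : ∀ x, ZO c x → (∀ j s, g j s = 1 → x j s = 1) → 0 ≤ f x) : 0 ≤ f g :=
  ext_aux hc hf Finset.univ g hg (by simp) h

theorem zo_val (h : ZO c x) : val T e x = 0 ∨ (val T e x = 1 ∧ InB T e x) := by
  by_cases h1 : ∃ j ∈ T, x j (e j) = 0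
  · obtain ⟨j, hj, h1⟩ := h1
    exact Or.inl (Finset.prod_eq_zero hj h1)
  · push Not at h1
    have : InB T e x := fun j hj => by
      rcases (h j (e j)).2 with h2 | h2
      · exact absurd h2 (h1 j hj)
      · exact h2
    exact Or.inr ⟨val_one this, this⟩

theorem code_box (hE : Code c T E) (he : e ∈ E) (hx : HP c x) (h : InB T e x) : sm T E x = 1 := by
  rw [sm_erase he, val_one h]
  have : sm T (E.erase e) x = 0 := by
    apply Finset.sum_eq_zero
    intro f hf
    rw [Finset.mem_erase] at hf
    exact val_zero hx h (hE e he f hf.2 (Ne.symm hf.1))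
  rw [this]; norm_num

theorem zo_code (hE : Code c T E) (h : ZO c x) :
    sm T E x = 0 ∨ (sm T E x = 1 ∧ ∃ e ∈ E, InB T e x) := by
  by_cases h1 : ∃ e ∈ E, InB T e x
  · obtain ⟨e, he, h1⟩ := h1
    exact Or.inr ⟨code_box hE he h.hp h1, e, he, h1⟩
  · left
    apply Finset.sum_eq_zero
    intro e he
    rcases zo_val (T := T) (e := e) h with h2 | h2
    · exact h2
    · exact absurd ⟨e, he, h2.2⟩ h1

theorem code_le (hc : CI c) (hE : Code c T E) (hx : HP c x) : sm T E x ≤ 1 := by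
  have := ext01 hc ((MA_const 1).sub (MA_sm (T := T) (E := E))) hx (by
    intro z hz _
    rcases zo_code hE hz with h | h
    · rw [h]; norm_num
    · rw [h.1]; norm_num)
  linarith

def hfp : ι → S → ℚ := fun _ _ => 1/2
theorem hfp_HP : HP c (hfp : ι → S → ℚ) := by
  intro j s; simp only [hfp]; norm_num
theorem hfp_sm : sm T E hfp = E.card * (1/2)^T.card := by
  simp [sm, val, hfp]
theorem card_of (h : ∀ x, HP c x → sm T A x + sm T D x = sm T B x + sm T C x) :
    A.card + D.card = B.card + C.card := by
  have := h _ hfp_HP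
  simp only [hfp_sm, ← add_mul] at this
  have h2 : ((1:ℚ)/2)^T.card ≠ 0 := by positivity
  have := mul_right_cancel₀ h2 this
  exact_mod_cast this
theorem card_of2 (h : ∀ x, HP c x → sm T A x = sm T B x) : A.card = B.card := by
  have := card_of (T := T) (c := c) (A := A) (B := B) (C := ∅) (D := ∅) (by simpa using h)
  simpa using this

/-! meeting points -/
def pt (c : S → S) (T : Finset ι) (y e : ι → S) : ι → S → ℚ :=
  fun j => mk c (if j ∈ T then [y j, e j] else [])
theorem pt_spec (hc : CI c) (h : ¬ DT c T y e) :
    HP c (pt c T y e) ∧ InB T y (pt c T y e) ∧ InB T e (pt c T y e) := by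
  refine ⟨?_, ?_, ?_⟩
  · intro j
    apply mk_HU hc
    by_cases hj : j ∈ T
    · simp only [hj, if_true]
      have h1 : e j ≠ c (y j) := fun h' => h ⟨j, hj, h'⟩
      have h2 : y j ≠ c (e j) := fun h' => h1 (by rw [h', hc.inv])
      intro s hs
      simp at hs ⊢
      rcases hs with rfl | rfl
      · exact ⟨hc.nf _, h1.symm⟩
      · exact ⟨h2.symm, hc.nf _⟩
    · simp [hj]
  · intro j hj; simp [pt, hj, mk]
  · intro j hj; simp [pt, hj, mk]
theorem mk_eq_one {L : List S} (h : mk c L s = 1) : s ∈ L := by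
  unfold mk at h; split_ifs at h <;> first | assumption | (norm_num at h)
theorem mk_eq_zero {L : List S} (h : mk c L s = 0) : c s ∈ L := by
  unfold mk at h; split_ifs at h <;> first | assumption | (norm_num at h)
theorem pt_one (hj : j ∈ T) (h : pt c T y e j s = 1) : s = y j ∨ s = e j := by
  have := mk_eq_one h; simpa [hj] using this
theorem pt_zero (hj : j ∈ T) (h : pt c T y e j s = 0) : c s = y j ∨ c s = e j := by
  have := mk_eq_zero h; simpa [hj] using this
theorem one_of_val (hx : HP c x) (h : 1 ≤ val T e x) : InB T e x := by
  intro j hj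
  rw [val_erase hj] at h
  have h1 := (hx j).le (e j)
  have h2 := val_le (T := T.erase j) (e := e) hx
  have h3 := val_nonneg (T := T.erase j) (e := e) hx
  nlinarith
theorem zero_of_val (h : val T e x = 0) : ∃ j ∈ T, x j (e j) = 0 := Finset.prod_eq_zero_iff.1 h

/-- L4 -/
theorem eqL (hc : CI c) (he : ¬ DT c T y e) (hf : ¬ DT c T y f)
    (h : ∀ x, HP c x → InB T y x → val T e x = val T f x) : EqT T e f := by
  intro j hj
  obtain ⟨a1, a2, a3⟩ := pt_spec hc he
  obtain ⟨b1, b2, b3⟩ := pt_spec hc hf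
  have h1 := h _ a1 a2
  have h2 := h _ b1 b2
  rw [val_one a3] at h1
  rw [val_one b3] at h2
  have h3 := pt_one hj (one_of_val a1 h1.le j hj)
  have h4 := pt_one hj (one_of_val b1 h2.ge j hj)
  rcases h4 with h4 | h4
  · rcases h3 with h3 | h3
    · rw [h3, h4]
    · exact h3.symm
  · exact h4

/-- L5 -/
theorem red1 (hc : CI c) (hE : ∀ e ∈ E, ¬ DT c T y e)
    (h : ∀ x, HP c x → InB T y x → sm T E x = val T a x) :
    ∀ e ∈ E, ∀ j ∈ T, a j ≠ y j → e j = a j := by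
  intro e he j hj hay
  obtain ⟨a1, a2, a3⟩ := pt_spec hc (hE e he)
  have h1 := val_le_sm (T := T) a1 he
  rw [h _ a1 a2, val_one a3] at h1
  rcases pt_one hj (one_of_val a1 h1 j hj) with h | h
  · exact absurd h hay
  · exact h.symm
theorem red2 (hc : CI c) (hE : ∀ e ∈ E, ¬ DT c T y e) (ha : ¬ DT c T y a)
    (h : ∀ x, HP c x → InB T y x → sm T E x = val T a x) :
    (∀ x, HP c x → InB T a x → sm T E x = 1) ∧ ∀ e ∈ E, ¬ DT c T a e := by
  have r := red1 hc hE h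
  constructor
  · intro x hx hxa
    obtain ⟨p1, p2, p3⟩ := pt_spec hc ha
    set x' : ι → S → ℚ := fun j => if a j = y j then x j else pt c T y a j with hx'
    have q1 : HP c x' := by
      intro j; by_cases h : a j = y j
      · simp only [hx', h, if_true]; exact hx j
      · simp only [hx', h, if_false]; exact p1 j
    have q2 : InB T y x' := by
      intro j hj; by_cases h : a j = y j
      · simp only [hx', h, if_true]; rw [← h]; exact hxa j hj
      · simp only [hx', h, if_false]; exact p2 j hj
    have q3 : InB T a x' := by
      intro j hj; by_cases h : a j = y j
      · simp only [hx', h, if_true]; rw [← h]; exact hxa j hj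
      · simp only [hx', h, if_false]; exact p3 j hj
    have := h x' q1 q2
    rw [val_one q3] at this
    rw [← this]
    apply Finset.sum_congr rfl
    intro e he
    apply Finset.prod_congr rfl
    intro j hj
    by_cases h : a j = y j
    · simp only [hx', h, if_true]
    · rw [r e he j hj h, hxa j hj, q3 j hj]
  · rintro e he ⟨j, hj, h'⟩
    by_cases h2 : a j = y j
    · exact hE e he ⟨j, hj, by rw [h', h2]⟩
    · have := r e he j hj h2
      rw [this] at h'
      exact hc.nf _ h'.symm

/-- if the box of t is covered and one word equals t then it is alone -/
theorem cover_eq (hc : CI c) (h : ∀ x, HP c x → InB T t x → sm T B x = 1) (hb : e ∈ B)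
    (he : EqT T e t) (hf : f ∈ B) (hm : ¬ DT c T t f) : f = e := by
  by_contra hne
  obtain ⟨a1, a2, a3⟩ := pt_spec hc hm
  have h1 := two_le_sm (T := T) a1 hf hb hne
  rw [h _ a1 a2, val_one a3, val_eqT he, val_one a2] at h1
  norm_num at h1

theorem coverA (hc : CI c) : ∀ n : ℕ, ∀ T : Finset ι, T.card = n → ∀ (B : Finset (ι → S)) (t : ι → S),
    Code c T B → TF c T B → (∀ b ∈ B, ¬ EqT T b t) → (∀ b ∈ B, ¬ DT c T t b) →
    (∀ x, HP c x → InB T t x → sm T B x = 1) → 5 ≤ B.card := by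
  intro n
  induction n with
  | zero =>
    intro T hT B t hB hTF hne hm h
    have : T = ∅ := Finset.card_eq_zero.1 hT
    subst this
    have hh := h _ (hfp_HP) (by simp [InB])
    have : B = ∅ := by
      apply Finset.eq_empty_of_forall_notMem
      intro b hb; exact hne b hb (by simp [EqT])
    simp [this] at hh
  | succ n ih =>
    intro T hT B t hB hTF hne hm h
    have hBne : B.Nonempty := by
      by_contra hh
      rw [Finset.not_nonempty_iff_eq_empty] at hh
      subst hh
      obtain ⟨a1, a2, a3⟩ := pt_spec hc (notDT_self (T := T) (e := t) hc)
      have := h _ a1 a2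
      simp at this
    obtain ⟨b, hb⟩ := hBne
    have := hne b hb
    simp only [EqT, not_forall] at this
    obtain ⟨j, hj, hbj⟩ := this
    have hbj2 : b j ≠ c (t j) := fun h' => hm b hb ⟨j, hj, h'⟩
    have hcard : (T.erase j).card = n := by rw [Finset.card_erase_of_mem hj, hT]; simp
    have s1 := S1 hc (A := B) (D := ∅) (B := {t}) (C := ∅) (T0 := T) (y := t) (l := b j) hj
      (fun _ => ⟨hbj, hbj2⟩) (by intro x hx hxt; rw [h x hx hxt]; simp [val_one hxt])
    have e1 : fl {t} j (b j) = ∅ := by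
      apply Finset.eq_empty_of_forall_notMem; intro z hz
      simp [fl_mem] at hz; exact hbj (by rw [← hz.2, hz.1])
    have e2 : fl {t} j (c (b j)) = ∅ := by
      apply Finset.eq_empty_of_forall_notMem; intro z hz
      simp [fl_mem] at hz
      exact hbj2 (by rw [← hz.1, hz.2, hc.inv])
    have e3 : ∀ l, fl (∅ : Finset (ι → S)) j l = ∅ := fun l => rfl
    simp only [e1, e2, e3, sm_empty, add_zero, zero_add] at s1
    set P := fl B j (b j) with hP
    set Q := fl B j (c (b j)) with hQ
    have mP : ∀ e ∈ P, ¬ DT c (T.erase j) t e := fun e he hd =>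
      hm e (fl_sub he) (hd.mono (Finset.erase_subset _ _))
    have mQ : ∀ e ∈ Q, ¬ DT c (T.erase j) t e := fun e he hd =>
      hm e (fl_sub he) (hd.mono (Finset.erase_subset _ _))
    have ap := hTF.apart hj (l := b j)
    have hbP : b ∈ P := by simp [hP, fl_mem, hb]
    have sub1 : P.card ≤ B.card := Finset.card_le_card fl_sub
    have sub2 : Q.card ≤ B.card := Finset.card_le_card fl_sub
    have Qne : Q.Nonempty := by
      by_contra hh
      rw [Finset.not_nonempty_iff_eq_empty] at hh
      obtain ⟨a1, a2, a3⟩ := pt_spec hc (mP b hbP)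
      have h1 := s1 _ a1 a2
      rw [hh, sm_empty] at h1
      have h2 := val_le_sm (T := T.erase j) a1 hbP
      rw [h1, val_one a3] at h2; norm_num at h2
    by_cases c1 : P.card = 1
    · obtain ⟨p, hp⟩ := Finset.card_eq_one.1 c1
      have hpP : p ∈ P := by simp [hp]
      have r := red2 hc (E := Q) (a := p) (T := T.erase j) (y := t) mQ (mP p hpP) (by
        intro x hx hxt; rw [← s1 x hx hxt, hp, sm_single])
      have := ih _ hcard Q p (hB.fl hc) hTF.fl (fun q hq hh => ap p hpP q hq hh.symm) r.2 r.1
      omega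
    by_cases c2 : Q.card = 1
    · obtain ⟨p, hp⟩ := Finset.card_eq_one.1 c2
      have hpP : p ∈ Q := by simp [hp]
      have r := red2 hc (E := P) (a := p) (T := T.erase j) (y := t) mP (mQ p hpP) (by
        intro x hx hxt; rw [s1 x hx hxt, hp, sm_single])
      have := ih _ hcard P p (hB.fl hc) hTF.fl (fun q hq hh => ap q hq p hpP hh) r.2 r.1
      omega
    have d1 : 0 < P.card := Finset.card_pos.2 ⟨b, hbP⟩
    have d2 : 0 < Q.card := Finset.card_pos.2 Qne
    by_contra hlt
    have hdis : Disjoint P Q := by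
      rw [Finset.disjoint_left]; intro z hz hz'
      rw [fl_mem] at hz hz'
      exact hc.nf (b j) (hz'.2.symm.trans hz.2)
    have hun : P ∪ Q = B := by
      apply Finset.eq_of_subset_of_card_le
      · exact Finset.union_subset fl_sub fl_sub
      · rw [Finset.card_union_of_disjoint hdis]; omega
    have full : ∀ x, HP c x → InB (T.erase j) t x → sm (T.erase j) P x = 1 := by
      intro x hx hxt
      have hL : ∀ s ∈ [t j, b j], c s ∉ [t j, b j] := by
        intro s hs
        simp at hs ⊢
        rcases hs with rfl | rfl
        · exact ⟨hc.nf _, fun h => hbj2 h.symm⟩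
        · exact ⟨fun h => hbj2 (by rw [← h, hc.inv]), hc.nf _⟩
      have h1 := h _ (HP_upd (j := j) hx (mk_HU hc hL)) (InB_upd hxt (fun _ => mk_one (by simp)))
      rw [← hun, sm_union hdis, sm_upd hj, sm_upd hj] at h1
      have h2 : ∑ e ∈ P, mk c [t j, b j] (e j) * val (T.erase j) e x = sm (T.erase j) P x := by
        apply Finset.sum_congr rfl; intro e he
        rw [(fl_mem.1 he).2, mk_one (by simp), one_mul]
      have h3 : ∑ e ∈ Q, mk c [t j, b j] (e j) * val (T.erase j) e x = 0 := by
        apply Finset.sum_eq_zero; intro e he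
        rw [(fl_mem.1 he).2, mk_zero hc hL (by simp [hc.inv]), zero_mul]
      rw [h2, h3] at h1; simpa using h1
    have : 5 ≤ P.card := by
      apply ih _ hcard P t (hB.fl hc) hTF.fl _ mP full
      intro p hp hpt
      apply c1
      rw [Finset.card_eq_one]
      refine ⟨p, ?_⟩
      ext z
      rw [Finset.mem_singleton]
      exact ⟨fun hz => cover_eq hc full hp hpt hz (mP z hz), fun hz => hz ▸ hp⟩
    omega

end PB

namespace PB
open Finset Function
set_option linter.all false
variable {ι S : Type*} [Fintype ι] [DecidableEq ι] [DecidableEq S] {c : S → S}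
  {T U : Finset ι} {E F A B C D M N : Finset (ι → S)} {x : ι → S → ℚ} {j k : ι} {e f g y t a : ι → S}
  {l s : S} {u : S → ℚ}

open Classical in
noncomputable def mt (c : S → S) (T : Finset ι) (y : ι → S) (E : Finset (ι → S)) : Finset (ι → S) :=
  E.filter (fun e => ¬ DT c T y e)
theorem mt_mem : e ∈ mt c T y E ↔ e ∈ E ∧ ¬ DT c T y e := by simp [mt]
theorem mt_sub : mt c T y E ⊆ E := fun e he => (mt_mem.1 he).1
theorem sm_mt (hx : HP c x) (h : InB T y x) : sm T (mt c T y E) x = sm T E x := by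
  unfold mt sm
  rw [Finset.sum_filter]
  apply Finset.sum_congr rfl
  intro e he
  split_ifs with h1
  · exact (val_zero hx h h1).symm
  · rfl

theorem ok2 (hc : CI c) {a b : S} (h : b ≠ c a) : ∀ s ∈ [a, b], c s ∉ [a, b] := by
  intro s hs
  simp at hs ⊢
  rcases hs with rfl | rfl
  · exact ⟨hc.nf _, fun h' => h h'.symm⟩
  · exact ⟨fun h' => h (by rw [← h', hc.inv]), hc.nf _⟩
theorem ok1 (hc : CI c) {a : S} : ∀ s ∈ [a], c s ∉ [a] := by
  intro s hs; simp at hs ⊢; subst hs; exact hc.nf _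
theorem fl_disj {l l' : S} (h : l ≠ l') : Disjoint (fl A j l) (fl B j l') := by
  rw [Finset.disjoint_left]; intro z hz hz'
  rw [fl_mem] at hz hz'
  exact h (hz.2.symm.trans hz'.2)
theorem sm_updl (hj : j ∈ T) (h : ∀ e ∈ E, e j = l) :
    sm T E (update x j u) = u l * sm (T.erase j) E x := by
  rw [sm_upd hj, sm, Finset.mul_sum]
  apply Finset.sum_congr rfl
  intro e he; rw [h e he]
@[simp] theorem fl_empty : fl (∅ : Finset (ι → S)) j l = ∅ := rfl
theorem fl_l : ∀ e ∈ fl E j l, e j = l := fun e he => (fl_mem.1 he).2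
theorem fl_single_ne (h : e j ≠ l) : fl {e} j l = ∅ := by
  apply Finset.eq_empty_of_forall_notMem; intro z hz
  simp [fl_mem] at hz; exact h (by rw [← hz.2, hz.1])
theorem fl_single_eq (h : e j = l) : fl {e} j l = {e} := by
  ext z; simp [fl_mem]; rintro rfl; exact h
theorem empty_of {P : Finset (ι → S)} (h : ∀ z ∈ P, False) : P = ∅ :=
  Finset.eq_empty_of_forall_notMem h
theorem er_sub : T.erase j ⊆ T := Finset.erase_subset _ _

theorem cover (hc : CI c) (hB : Code c T B) (hTF : TF c T B) (hne : ∀ b ∈ B, ¬ EqT T b t)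
    (h : ∀ x, HP c x → InB T t x → sm T B x = 1) : 5 ≤ (mt c T t B).card := by
  apply coverA hc _ T rfl _ t (hB.mono mt_sub) (hTF.mono mt_sub) (fun b hb => hne b (mt_sub hb))
    (fun b hb => (mt_mem.1 hb).2)
  intro x hx hxt
  rw [sm_mt hx hxt]; exact h x hx hxt
theorem cover_card (hc : CI c) (hB : Code c T B) (hTF : TF c T B) (hne : ∀ b ∈ B, ¬ EqT T b t)
    (h : ∀ x, HP c x → InB T t x → sm T B x = 1) : 5 ≤ B.card :=
  (cover hc hB hTF hne h).trans (Finset.card_le_card mt_sub)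

theorem smL (hc : CI c) (hF : Code c T F) (hTF : TF c T F) (hm : ∀ f ∈ F, ¬ DT c T y f)
    (he : ¬ DT c T y e) (hne : ∀ f ∈ F, ¬ EqT T f e)
    (h : ∀ x, HP c x → InB T y x → sm T F x = val T e x) : 5 ≤ F.card := by
  have r := red2 hc hm he h
  exact cover_card hc hF hTF hne r.1

/-- two apart code parts which agree -/
theorem agree (hc : CI c) (hA : Code c T A) (hB : Code c T B) (hT : TF c T B) (hap : Apart T A B)
    (h : ∀ x, HP c x → sm T A x = sm T B x) (hne : A.Nonempty) : 5 ≤ B.card := by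
  obtain ⟨a, ha⟩ := hne
  apply cover_card hc hB hT (t := a) (fun b hb hh => hap a ha b hb hh.symm)
  intro x hx hxa
  rw [← h x hx, code_box hA ha hx hxa]

theorem sl2 (hc : CI c) (hj : j ∈ T) (h : ∀ x, HP c x → sm T A x = sm T B x) (l : S) :
    ∀ x, HP c x → sm (T.erase j) (fl A j l) x + sm (T.erase j) (fl B j (c l)) x
      = sm (T.erase j) (fl B j l) x + sm (T.erase j) (fl A j (c l)) x := by
  intro x hx
  have := S1 hc (A := A) (D := ∅) (B := B) (C := ∅) (T0 := ∅) (y := fun _ => l) (l := l) hj (by simp)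
    (by intro x hx _; simp [h x hx]) x hx (by simp [InB])
  simp at this; linarith

theorem K5 (hc : CI c) {X : Finset (ι → S)} (hB : Code c T B) (hT : TF c T B) (hap : Apart T B X)
    (h : ∀ x, HP c x → sm T B x = sm T X x) (hcard : B.card ≤ 5) : B = ∅ := by
  by_contra hne
  have hne' : 0 < B.card := Finset.card_pos.2 (Finset.nonempty_iff_ne_empty.2 hne)
  have hcX : B.card = X.card := card_of2 h
  have cov : ∀ z ∈ X, 5 ≤ (mt c T z B).card := by
    intro z hz
    apply cover hc hB hT (fun b hb hh => hap b hb z hz hh)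
    intro x hx hxz
    apply le_antisymm (code_le hc hB hx)
    rw [h x hx, ← val_one hxz]; exact val_le_sm hx hz
  have allm : ∀ z ∈ X, ∀ b ∈ B, ¬ DT c T z b := by
    intro z hz b hb
    have : mt c T z B = B := Finset.eq_of_subset_of_card_le mt_sub (hcard.trans (cov z hz))
    rw [← this] at hb; exact (mt_mem.1 hb).2
  obtain ⟨z0, hz0⟩ : X.Nonempty := Finset.card_pos.1 (by omega)
  have h5 : 5 ≤ B.card := (cov z0 hz0).trans (Finset.card_le_card mt_sub)
  obtain ⟨b1, hb1, b2, hb2, hb12⟩ := Finset.one_lt_card.1 (by omega : 1 < B.card)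
  obtain ⟨j, hj, hjj⟩ := hB b1 hb1 b2 hb2 hb12
  have s1 := sl2 hc hj h (b1 j)
  have e1 : fl X j (b1 j) = ∅ := empty_of (fun z hz => by
    rw [fl_mem] at hz; exact allm z hz.1 b2 hb2 ⟨j, hj, by rw [hjj, hz.2]⟩)
  have e2 : fl X j (c (b1 j)) = ∅ := empty_of (fun z hz => by
    rw [fl_mem] at hz; exact allm z hz.1 b1 hb1 ⟨j, hj, by rw [hz.2, hc.inv]⟩)
  simp only [e1, e2, sm_empty, add_zero, zero_add] at s1
  have m1 : b1 ∈ fl B j (b1 j) := fl_mem.2 ⟨hb1, rfl⟩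
  have := agree hc (hB.fl hc) (hB.fl hc) hT.fl (hT.apart hj) s1 ⟨b1, m1⟩
  have h3 : 0 < (fl B j (b1 j)).card := Finset.card_pos.2 ⟨b1, m1⟩
  have h4 := Finset.card_le_card (Finset.union_subset (fl_sub (E := B) (j := j) (l := b1 j))
    (fl_sub (E := B) (j := j) (l := c (b1 j))))
  rw [Finset.card_union_of_disjoint (fl_disj (hc.nf _).symm)] at h4
  omega

theorem fl_card2 {l l' : S} (h : l ≠ l') : (fl B j l).card + (fl B j l').card ≤ B.card := by
  have h4 := Finset.card_le_card (Finset.union_subset (fl_sub (E := B) (j := j) (l := l))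
    (fl_sub (E := B) (j := j) (l := l')))
  rwa [Finset.card_union_of_disjoint (fl_disj h)] at h4

theorem K6_aux (hc : CI c) {X : Finset (ι → S)} (hB : Code c T B) (hT : TF c T B) (hap : Apart T B X)
    (h : ∀ x, HP c x → sm T B x = sm T X x) (hcard : B.card ≤ 6) (hj : j ∈ T)
    (h0 : fl X j l = ∅) (h1 : (fl B j l).Nonempty) : fl B j (c l) = ∅ := by
  have s1 := sl2 hc hj h l
  have h1' : 0 < (fl B j l).card := Finset.card_pos.2 h1
  have h4 := fl_card2 (B := B) (j := j) (hc.nf l).symm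
  have dj : Disjoint (fl B j l) (fl X j (c l)) := fl_disj (hc.nf l).symm
  apply K5 hc (T := T.erase j) (X := fl B j l ∪ fl X j (c l)) (hB.fl hc) hT.fl
  · intro b hb z hz
    rcases Finset.mem_union.1 hz with hz | hz
    · exact (hT.apart hj).symm b hb z hz
    · exact hap.fl b hb z hz
  · intro x hx
    have := s1 x hx
    rw [sm_union dj]; rw [h0, sm_empty] at this; linarith
  · omega

theorem K6 (hc : CI c) {X : Finset (ι → S)} (hB : Code c T B) (hT : TF c T B) (hap : Apart T B X)
    (h : ∀ x, HP c x → sm T B x = sm T X x) (hcard : B.card ≤ 6) : B = ∅ := by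
  by_contra hne
  have hne' : 0 < B.card := Finset.card_pos.2 (Finset.nonempty_iff_ne_empty.2 hne)
  have hcX : B.card = X.card := card_of2 h
  have one : ∀ z ∈ X, ∀ x, HP c x → InB T z x → sm T B x = 1 := by
    intro z hz x hx hxz
    apply le_antisymm (code_le hc hB hx)
    rw [h x hx, ← val_one hxz]; exact val_le_sm hx hz
  have cov : ∀ z ∈ X, 5 ≤ (mt c T z B).card := fun z hz =>
    cover hc hB hT (fun b hb hh => hap b hb z hz hh) (one z hz)
  obtain ⟨z, hz⟩ : X.Nonempty := Finset.card_pos.1 (by omega)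
  obtain ⟨b, hb⟩ : (mt c T z B).Nonempty := Finset.card_pos.1 (by have := cov z hz; omega)
  have hbB := mt_sub hb
  have := hap b hbB z hz
  simp only [EqT, not_forall] at this
  obtain ⟨j, hj, hbj⟩ := this
  have hbj2 : b j ≠ c (z j) := fun h' => (mt_mem.1 hb).2 ⟨j, hj, h'⟩
  have s1 := S1 hc (A := mt c T z B) (D := ∅) (B := {z}) (C := ∅) (T0 := T) (y := z) (l := b j) hj
    (fun _ => ⟨hbj, hbj2⟩) (by
      intro x hx hxt; rw [sm_mt hx hxt, one z hz x hx hxt]; simp [val_one hxt])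
  rw [fl_single_ne (Ne.symm hbj), fl_single_ne (fun h' => hbj2 (by rw [h', hc.inv]))] at s1
  simp only [fl_empty, sm_empty, add_zero, zero_add] at s1
  have emp : ∀ l', 2 ≤ (fl B j l').card → fl X j (c l') = ∅ := by
    intro l' h2
    apply empty_of
    intro z' hz'
    rw [fl_mem] at hz'
    have h5 := cov z' hz'.1
    have : Disjoint (mt c T z' B) (fl B j l') := by
      rw [Finset.disjoint_left]
      intro w hw hw'
      exact (mt_mem.1 hw).2 ⟨j, hj, by rw [(fl_mem.1 hw').2, hz'.2, hc.inv]⟩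
    have h6 := Finset.card_le_card (Finset.union_subset (mt_sub (c := c) (T := T) (y := z') (E := B))
      (fl_sub (E := B) (j := j) (l := l')))
    rw [Finset.card_union_of_disjoint this] at h6
    omega
  have hbm : b ∈ fl (mt c T z B) j (b j) := fl_mem.2 ⟨hb, rfl⟩
  have hbl : b ∈ fl B j (b j) := fl_mem.2 ⟨hbB, rfl⟩
  obtain ⟨a1, a2, a3⟩ := pt_spec hc (T := T.erase j) (y := z) (e := b)
    (fun hd => (mt_mem.1 hb).2 (hd.mono er_sub))
  obtain ⟨b', hb'⟩ : (fl (mt c T z B) j (c (b j))).Nonempty := by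
    by_contra hh
    rw [Finset.not_nonempty_iff_eq_empty] at hh
    have h1 := s1 _ a1 a2
    rw [hh, sm_empty] at h1
    have h2 := val_le_sm (T := T.erase j) a1 hbm
    rw [h1, val_one a3] at h2; norm_num at h2
  have hb'l : b' ∈ fl B j (c (b j)) := fl_mem.2 ⟨mt_sub (fl_sub hb'), (fl_mem.1 hb').2⟩
  have n1 : 0 < (fl B j (b j)).card := Finset.card_pos.2 ⟨b, hbl⟩
  have n2 : 0 < (fl B j (c (b j))).card := Finset.card_pos.2 ⟨b', hb'l⟩
  by_cases c2 : 2 ≤ (fl B j (c (b j))).card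
  · have e1 := emp _ c2
    rw [hc.inv] at e1
    have := K6_aux hc hB hT hap h hcard hj e1 ⟨b, hbl⟩
    rw [this] at n2; simp at n2
  by_cases c1 : 2 ≤ (fl B j (b j)).card
  · have e1 := emp _ c1
    have := K6_aux hc hB hT hap h hcard hj e1 ⟨b', hb'l⟩
    rw [hc.inv] at this
    rw [this] at n1; simp at n1
  have u1 : fl (mt c T z B) j (b j) = {b} := by
    apply Finset.eq_singleton_iff_unique_mem.2 ⟨hbm, ?_⟩
    intro w hw
    exact Finset.card_le_one.1 (by omega : (fl B j (b j)).card ≤ 1) w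
      (fl_mem.2 ⟨mt_sub (fl_sub hw), (fl_mem.1 hw).2⟩) b hbl
  have u2 : fl (mt c T z B) j (c (b j)) = {b'} := by
    apply Finset.eq_singleton_iff_unique_mem.2 ⟨hb', ?_⟩
    intro w hw
    exact Finset.card_le_one.1 (by omega : (fl B j (c (b j))).card ≤ 1) w
      (fl_mem.2 ⟨mt_sub (fl_sub hw), (fl_mem.1 hw).2⟩) b' hb'l
  rw [u1, u2] at s1
  simp only [sm_single] at s1
  have hb'm := fl_sub hb'
  have := eqL hc (fun hd => (mt_mem.1 hb).2 (hd.mono er_sub))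
    (fun hd => (mt_mem.1 hb'm).2 (hd.mono er_sub)) s1
  exact hT b hbB b' (mt_sub hb'm) j hj (fl_mem.1 hb').2 this

theorem split2' (hc : CI c) (hf : ¬ DT c T e f) (hg : ¬ DT c T e g)
    (h : ∀ x, HP c x → InB T e x → val T f x + val T g x = 1) :
    ∃ k ∈ T, g k = c (f k) ∧ f k ≠ e k ∧ f k ≠ c (e k) ∧ EqT (T.erase k) f e ∧ EqT (T.erase k) g e := by
  obtain ⟨a1, a2, a3⟩ := pt_spec hc hf
  have h1 := h _ a1 a2
  rw [val_one a3] at h1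
  obtain ⟨k, hk, h2⟩ := zero_of_val (by linarith : val T g (pt c T e f) = 0)
  have hgf : g k = c (f k) := by
    rcases pt_zero hk h2 with h3 | h3
    · exact absurd ⟨k, hk, by rw [← h3, hc.inv]⟩ hg
    · rw [← h3, hc.inv]
  have fe : f k ≠ e k := fun h' => hg ⟨k, hk, by rw [hgf, h']⟩
  have fe' : f k ≠ c (e k) := fun h' => hf ⟨k, hk, h'⟩
  have ge' : g k ≠ c (e k) := fun h' => hg ⟨k, hk, h'⟩
  refine ⟨k, hk, hgf, fe, fe', ?_, ?_⟩
  · apply eqL hc (y := e) (fun hd => hf (hd.mono er_sub)) (notDT_self hc)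
    intro x hx hxe
    have h3 := h _ (HP_upd (j := k) hx (mk_HU hc (ok2 hc fe'))) (InB_upd hxe (fun _ => mk_one (by simp)))
    rw [val_upd' hk, val_upd' hk, mk_one (by simp), mk_zero hc (ok2 hc fe') (by simp [hgf, hc.inv])] at h3
    rw [val_one hxe]; linarith
  · apply eqL hc (y := e) (fun hd => hg (hd.mono er_sub)) (notDT_self hc)
    intro x hx hxe
    have h3 := h _ (HP_upd (j := k) hx (mk_HU hc (ok2 hc ge'))) (InB_upd hxe (fun _ => mk_one (by simp)))
    rw [val_upd' hk, val_upd' hk, mk_one (s := g k) (by simp), mk_zero hc (ok2 hc ge') (by simp [hgf])] at h3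
    rw [val_one hxe]; linarith

theorem split2 (hc : CI c) (hfg : f ≠ g) (he : ¬ DT c T y e) (hf : ¬ DT c T y f) (hg : ¬ DT c T y g)
    (h : ∀ x, HP c x → InB T y x → val T f x + val T g x = val T e x) :
    ∃ k ∈ T, e k = y k ∧ g k = c (f k) ∧ f k ≠ e k ∧ f k ≠ c (e k) ∧ EqT (T.erase k) f e ∧
      EqT (T.erase k) g e := by
  have hm : ∀ z ∈ ({f, g} : Finset (ι → S)), ¬ DT c T y z := by
    intro z hz; simp at hz; rcases hz with rfl | rfl <;> assumption
  have h' : ∀ x, HP c x → InB T y x → sm T {f, g} x = val T e x := by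
    intro x hx hxy; rw [sm_pair hfg, h x hx hxy]
  have r1 := red1 hc hm h'
  have r2 := red2 hc hm he h'
  obtain ⟨k, hk, h1, h2, h3, h4, h5⟩ := split2' hc (r2.2 f (by simp)) (r2.2 g (by simp)) (by
    intro x hx hxe; rw [← sm_pair hfg]; exact r2.1 x hx hxe)
  refine ⟨k, hk, ?_, h1, h2, h3, h4, h5⟩
  by_contra hh
  exact h2 (r1 f (by simp) k hk hh)

theorem CL (hc : CI c) {e1 e2 : ι → S} (hj : j ∈ T) (h1j : e1 j = l) (h2j : e2 j = c l)
    (m1 : ¬ DT c T y e1) (m2 : ¬ DT c T y e2) (hne : ¬ EqT (T.erase j) e1 e2)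
    (hF : Code c T F) (hT : TF c T F) (h3 : F.card ≤ 3) (hm : ∀ f ∈ F, ¬ DT c T y f)
    (ap1 : ∀ f ∈ F, ¬ EqT T f e1) (ap2 : ∀ f ∈ F, ¬ EqT T f e2)
    (h : ∀ x, HP c x → InB T y x → val T e1 x + val T e2 x = sm T F x) :
    ∃ f0 ∈ F, f0 j = y j ∧ (∀ f ∈ F, f ≠ f0 → f j = l ∨ f j = c l) ∧
      (∀ x, HP c x → InB (T.erase j) y x →
        sm (T.erase j) (fl F j l) x + val (T.erase j) f0 x = val (T.erase j) e1 x) ∧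
      (∀ x, HP c x → InB (T.erase j) y x →
        sm (T.erase j) (fl F j (c l)) x + val (T.erase j) f0 x = val (T.erase j) e2 x) := by
  have yl : l ≠ c (y j) := fun h' => m1 ⟨j, hj, by rw [h1j, h']⟩
  have yl2 : c l ≠ c (y j) := fun h' => m2 ⟨j, hj, by rw [h2j, h']⟩
  have yl3 : l ≠ y j := fun h' => yl2 (by rw [h'])
  have yl4 : c l ≠ y j := fun h' => yl (by rw [← h', hc.inv])
  have e12 : e1 ≠ e2 := fun h' => hc.nf l (by rw [← h2j, ← h', h1j])
  have fm : ∀ l', ∀ f ∈ fl F j l', ¬ DT c (T.erase j) y f := fun l' f hf hd =>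
    hm f (fl_sub hf) (hd.mono er_sub)
  have m1' : ¬ DT c (T.erase j) y e1 := fun hd => m1 (hd.mono er_sub)
  have m2' : ¬ DT c (T.erase j) y e2 := fun hd => m2 (hd.mono er_sub)
  -- letters
  have let1 : ∀ f ∈ F, f j = y j ∨ f j = l ∨ f j = c l := by
    intro f hf
    by_contra hh
    push Not at hh
    obtain ⟨g1, g2, g3⟩ := hh
    have g4 : f j ≠ c (y j) := fun h' => hm f hf ⟨j, hj, h'⟩
    have s1 := S1 hc (A := F) (D := ∅) (B := {e1}) (C := {e2}) (T0 := T) (y := y) (l := f j) hj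
      (fun _ => ⟨g1, g4⟩) (by
        intro x hx hxt; have := h x hx hxt; simp; linarith)
    rw [fl_single_ne (l := f j) (e := e1) (by rw [h1j]; exact g2.symm),
      fl_single_ne (l := f j) (e := e2) (by rw [h2j]; exact g3.symm),
      fl_single_ne (l := c (f j)) (e := e1) (by rw [h1j]; intro h'; exact g3 (by rw [h', hc.inv])),
      fl_single_ne (l := c (f j)) (e := e2) (by rw [h2j]; intro h'; exact g2 (hc.inj h').symm)] at s1
    simp only [fl_empty, sm_empty, add_zero, zero_add] at s1
    have hff : f ∈ fl F j (f j) := fl_mem.2 ⟨hf, rfl⟩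
    obtain ⟨a1, a2, a3⟩ := pt_spec hc (fm _ f hff)
    have n1 : 0 < (fl F j (f j)).card := Finset.card_pos.2 ⟨f, hff⟩
    have n2 : 0 < (fl F j (c (f j))).card := by
      rw [Finset.card_pos]
      by_contra hh
      rw [Finset.not_nonempty_iff_eq_empty] at hh
      have h1 := s1 _ a1 a2
      rw [hh, sm_empty] at h1
      have h2 := val_le_sm (T := T.erase j) a1 hff
      rw [h1, val_one a3] at h2; norm_num at h2
    have n3 := fl_card2 (B := F) (j := j) (hc.nf (f j)).symm
    have ap := hT.apart hj (l := f j)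
    rcases (by omega : (fl F j (f j)).card = 1 ∨ (fl F j (c (f j))).card = 1) with hh | hh
    · obtain ⟨p, hp⟩ := Finset.card_eq_one.1 hh
      have hpm : p ∈ fl F j (f j) := by simp [hp]
      have := smL hc (hF.fl hc) hT.fl (fm (c (f j))) (fm _ p hpm) (fun q hq hh => ap p hpm q hq hh.symm)
        (by intro x hx hxy; rw [← s1 x hx hxy, hp, sm_single])
      omega
    · obtain ⟨p, hp⟩ := Finset.card_eq_one.1 hh
      have hpm : p ∈ fl F j (c (f j)) := by simp [hp]
      have := smL hc (hF.fl hc) hT.fl (fm (f j)) (fm _ p hpm) (fun q hq hh => ap q hq p hpm hh)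
        (by intro x hx hxy; rw [s1 x hx hxy, hp, sm_single])
      omega
  have d1 : Disjoint (fl F j (y j)) (fl F j l) := fl_disj yl3.symm
  have d2 : Disjoint (fl F j (y j)) (fl F j (c l)) := fl_disj yl4.symm
  have d3 : Disjoint (fl F j l) (fl F j (c l)) := fl_disj (hc.nf l).symm
  have hun : F = (fl F j (y j) ∪ fl F j l) ∪ fl F j (c l) := by
    ext f; simp only [Finset.mem_union, fl_mem]
    constructor
    · intro hf; have := let1 f hf; tauto
    · tauto
  have d4 : Disjoint (fl F j (y j) ∪ fl F j l) (fl F j (c l)) := Finset.disjoint_union_left.2 ⟨d2, d3⟩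
  have hcd : F.card = (fl F j (y j)).card + (fl F j l).card + (fl F j (c l)).card := by
    conv_lhs => rw [hun]
    rw [Finset.card_union_of_disjoint d4, Finset.card_union_of_disjoint d1]
  have hsm : ∀ x, sm T F x = sm T (fl F j (y j)) x + sm T (fl F j l) x + sm T (fl F j (c l)) x := by
    intro x
    conv_lhs => rw [hun]
    rw [sm_union d4, sm_union d1]
  have i1 : ∀ x, HP c x → InB (T.erase j) y x →
      sm (T.erase j) (fl F j l) x + sm (T.erase j) (fl F j (y j)) x = val (T.erase j) e1 x := by
    intro x hx hxy
    have ok := ok2 hc yl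
    have := h _ (HP_upd (j := j) hx (mk_HU hc ok)) (InB_upd hxy (fun _ => mk_one (by simp)))
    rw [hsm, sm_updl hj fl_l, sm_updl hj fl_l, sm_updl hj fl_l, val_upd' hj, val_upd' hj, h1j, h2j,
      mk_one (s := y j) (by simp), mk_one (s := l) (by simp), mk_zero hc ok (by simp [hc.inv])] at this
    linarith
  have i2 : ∀ x, HP c x → InB (T.erase j) y x →
      sm (T.erase j) (fl F j (c l)) x + sm (T.erase j) (fl F j (y j)) x = val (T.erase j) e2 x := by
    intro x hx hxy
    have ok := ok2 hc yl2
    have := h _ (HP_upd (j := j) hx (mk_HU hc ok)) (InB_upd hxy (fun _ => mk_one (by simp)))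
    rw [hsm, sm_updl hj fl_l, sm_updl hj fl_l, sm_updl hj fl_l, val_upd' hj, val_upd' hj, h1j, h2j,
      mk_one (s := y j) (by simp), mk_one (s := c l) (by simp), mk_zero hc ok (by simp)] at this
    linarith
  have a1 : ∀ f ∈ fl F j l, ¬ EqT (T.erase j) f e1 := fun f hf hh =>
    ap1 f (fl_sub hf) (hh.ext (by rw [fl_l f hf, h1j]))
  have a2 : ∀ f ∈ fl F j (c l), ¬ EqT (T.erase j) f e2 := fun f hf hh =>
    ap2 f (fl_sub hf) (hh.ext (by rw [fl_l f hf, h2j]))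
  -- size of the middle part
  have c0 : (fl F j (y j)).card ≠ 0 := by
    intro h0
    rw [Finset.card_eq_zero] at h0
    have := smL hc (hF.fl hc) hT.fl (fm l) m1' a1 (by
      intro x hx hxy; rw [← i1 x hx hxy, h0, sm_empty, add_zero])
    omega
  have twin : ∀ e, ¬ DT c (T.erase j) y e → (fl F j (y j)).card = 2 →
      (∀ x, HP c x → InB (T.erase j) y x → sm (T.erase j) (fl F j (y j)) x = val (T.erase j) e x) →
      False := by
    intro e he h2 hx
    obtain ⟨f, g, hfg, hh⟩ := Finset.card_eq_two.1 h2
    have fM : f ∈ fl F j (y j) := by simp [hh]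
    have gM : g ∈ fl F j (y j) := by simp [hh]
    obtain ⟨k, hk, _, q2, _, _, q5, q6⟩ := split2 hc hfg he (fm _ f fM) (fm _ g gM) (by
      intro x hx' hxy; rw [← hx x hx' hxy, hh, sm_pair hfg])
    exact hT.fl f fM g gM k hk q2 (q5.trans q6.symm)
  have c1 : (fl F j (y j)).card = 1 := by
    by_contra hh
    have both : (fl F j l).card = 0 → (fl F j (c l)).card = 0 → False := by
      intro z1 z2
      rw [Finset.card_eq_zero] at z1 z2
      apply hne
      apply eqL hc m1' m2'
      intro x hx hxy
      rw [← i1 x hx hxy, ← i2 x hx hxy, z1, z2]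
    by_cases hl0 : (fl F j l).card = 0
    · by_cases hh3 : (fl F j (c l)).card = 0
      · exact both hl0 hh3
      · apply twin e1 m1' (by omega)
        intro x hx hxy
        rw [Finset.card_eq_zero] at hl0
        rw [← i1 x hx hxy, hl0, sm_empty, zero_add]
    · apply twin e2 m2' (by omega)
      intro x hx hxy
      have : (fl F j (c l)).card = 0 := by omega
      rw [Finset.card_eq_zero] at this
      rw [← i2 x hx hxy, this, sm_empty, zero_add]
  obtain ⟨f0, hf0⟩ := Finset.card_eq_one.1 c1
  have hf0m : f0 ∈ fl F j (y j) := by simp [hf0]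
  refine ⟨f0, fl_sub hf0m, fl_l _ hf0m, ?_, ?_, ?_⟩
  · intro f hf hff
    rcases let1 f hf with h' | h'
    · exfalso; apply hff
      have : f ∈ fl F j (y j) := fl_mem.2 ⟨hf, h'⟩
      rw [hf0] at this; simpa using this
    · exact h'
  · intro x hx hxy; have := i1 x hx hxy; rwa [hf0, sm_single] at this
  · intro x hx hxy; have := i2 x hx hxy; rwa [hf0, sm_single] at this

theorem val_le_half (hx : HP c x) (hj : j ∈ T) (h : x j (e j) ≤ 1/2) : val T e x ≤ 1/2 := by
  rw [val_erase hj]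
  have h1 := (hx j).le (e j)
  have h2 := val_le (T := T.erase j) (e := e) hx
  have h3 := val_nonneg (T := T.erase j) (e := e) hx
  nlinarith
theorem twotwo (hc : CI c) {h : ι → S} (hj : j ∈ T) (hk : k ∈ T) (hjk : j ≠ k)
    (gj : g j ≠ e j) (gk : g k ≠ e k)
    (hh : ∀ x, HP c x → val T e x + val T f x = val T g x + val T h x) : EqT T e h := by
  obtain ⟨a1, a2, a3⟩ := pt_spec hc (T := T) (notDT_self hc (e := e))
  have h1 := hh _ a1
  rw [val_one a2] at h1
  have hf0 := val_nonneg (T := T) (e := f) a1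
  have lt : ∀ (w : ι → S) i, i ∈ T → w i ≠ e i → pt c T e e i (w i) ≤ 1/2 := by
    intro w i hi hw
    rcases (a1 i (w i)).2 with h | h | h
    · rw [h]; norm_num
    · rw [h]
    · exact absurd (by simpa using pt_one hi h) hw
  have hg : val T g (pt c T e e) ≤ 1/4 := by
    rw [val_erase hj]
    have h1 := (a1 j).le (g j)
    have h2 := val_le_half (T := T.erase j) (e := g) a1 (Finset.mem_erase.2 ⟨hjk.symm, hk⟩) (lt g k hk gk)
    have h3 := val_nonneg (T := T.erase j) (e := g) a1
    have h4 := lt g j hj gj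
    nlinarith
  intro i hi
  by_contra hne
  have := val_le_half a1 hi (lt h i hi (Ne.symm hne))
  linarith

end PB

namespace PB
open Finset Function
set_option linter.all false
variable {ι S : Type*} [Fintype ι] [DecidableEq ι] [DecidableEq S] {c : S → S}
  {T U : Finset ι} {E F A B C D M N : Finset (ι → S)} {x : ι → S → ℚ} {j k : ι} {e f g y t a : ι → S}
  {l s : S} {u : S → ℚ}

structure Loc (c : S → S) (T : Finset ι) (A B C D : Finset (ι → S)) : Prop where
  cA : Code c T A
  cB : Code c T B
  cC : Code c T C
  cD : Code c T D
  tA : TF c T A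
  tB : TF c T B
  tC : TF c T C
  tD : TF c T D
  AB : Apart T A B
  AC : Apart T A C
  BD : Apart T B D
  CD : Apart T C D
  dBC : Disjoint B C
  dAD : Disjoint A D
  id : ∀ x, HP c x → sm T A x + sm T D x = sm T B x + sm T C x
  RY : ∀ x, ZO c x → sm T A x = 1 → sm T B x = 1 → sm T C x = 0 → sm T D x = 0 →
    ∃ y, InB T y x ∧ (∀ e ∈ C, DT c T y e) ∧ (∀ e ∈ D, DT c T y e)
  RZ : ∀ x, ZO c x → sm T C x = 1 → sm T D x = 1 → sm T A x = 0 → sm T B x = 0 →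
    ∃ y, InB T y x ∧ (∀ e ∈ A, DT c T y e) ∧ (∀ e ∈ B, DT c T y e)

theorem Loc.sV (h : Loc c T A B C D) : Loc c T C D A B :=
  ⟨h.cC, h.cD, h.cA, h.cB, h.tC, h.tD, h.tA, h.tB, h.CD, h.AC.symm, h.BD.symm, h.AB, h.dAD.symm,
    h.dBC.symm, fun x hx => by have := h.id x hx; linarith, h.RZ, h.RY⟩
theorem Loc.sP (h : Loc c T A B C D) : Loc c T B A D C :=
  ⟨h.cB, h.cA, h.cD, h.cC, h.tB, h.tA, h.tD, h.tC, h.AB.symm, h.BD, h.AC, h.CD.symm, h.dAD,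
    h.dBC, fun x hx => by have := h.id x hx; linarith,
    fun x hx a b p q => by obtain ⟨y, h1, h2, h3⟩ := h.RY x hx b a q p; exact ⟨y, h1, h3, h2⟩,
    fun x hx a b p q => by obtain ⟨y, h1, h2, h3⟩ := h.RZ x hx b a q p; exact ⟨y, h1, h3, h2⟩⟩

theorem not_DT_of (hx : HP c x) (h1 : InB T y x) (h2 : InB T e x) : ¬ DT c T y e := by
  intro hd
  have := val_zero hx h1 hd
  rw [val_one h2] at this; norm_num at this

theorem domL (hc : CI c) (hD : Code c T D) (hT : TF c T D) (hne : ∀ d ∈ D, ¬ EqT T d e)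
    (h : ∀ x, HP c x → val T e x ≤ sm T D x) : 5 ≤ D.card := by
  apply cover_card hc hD hT hne
  intro x hx hxe
  apply le_antisymm (code_le hc hD hx)
  rw [← val_one hxe]; exact h x hx

theorem SZR (hc : CI c) (h : Loc c T A B C D) (hn : A.card + D.card ≤ 5)
    (hne : ¬ (A = ∅ ∧ B = ∅ ∧ C = ∅ ∧ D = ∅)) :
    ∃ x, ZO c x ∧ sm T C x = 1 ∧ sm T D x = 1 ∧ sm T A x = 0 ∧ sm T B x = 0 := by
  by_contra hno
  push Not at hno
  have hcd := card_of h.id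
  have le : ∀ x, HP c x → sm T C x ≤ sm T A x := by
    intro x hx
    have := ext01 hc ((MA_sm (T := T) (E := A)).sub (MA_sm (T := T) (E := C))) hx (by
      intro z hz _
      have id := h.id z hz.hp
      have no := hno z hz
      rcases zo_code h.cA hz with a | a <;> rcases zo_code h.cB hz with b | b <;>
      rcases zo_code h.cC hz with p | p <;> rcases zo_code h.cD hz with q | q <;>
      simp [a, b, p, q] at id no ⊢ <;> norm_num at id)
    linarith
  by_cases hC : C = ∅
  · have : B = ∅ := by
      apply K5 hc (X := A ∪ D) h.cB h.tB
      · intro b hb z hz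
        rcases Finset.mem_union.1 hz with hz | hz
        · exact h.AB.symm b hb z hz
        · exact h.BD b hb z hz
      · intro x hx
        rw [sm_union h.dAD, h.id x hx, hC]; simp
      · omega
    rw [this, hC] at hcd
    simp at hcd
    exact hne ⟨hcd.1, this, hC, hcd.2⟩
  · obtain ⟨e, he⟩ := Finset.nonempty_iff_ne_empty.2 hC
    have h5 := domL hc h.cA h.tA (e := e) (fun d hd => h.AC d hd e he) (fun x hx =>
      (val_le_sm hx he).trans (le x hx))
    have hD : D = ∅ := Finset.card_eq_zero.1 (by omega)
    have : A = ∅ := by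
      apply K5 hc (X := B ∪ C) h.cA h.tA
      · intro b hb z hz
        rcases Finset.mem_union.1 hz with hz | hz
        · exact h.AB b hb z hz
        · exact h.AC b hb z hz
      · intro x hx
        rw [sm_union h.dBC, ← h.id x hx, hD]; simp
      · omega
    rw [this] at h5; simp at h5

/-- given y avoiding C and D, the words of A and B agree on the box of y -/
theorem Loc.onY (h : Loc c T A B C D) (hC : ∀ e ∈ C, DT c T y e) (hD : ∀ e ∈ D, DT c T y e) :
    ∀ x, HP c x → InB T y x → sm T (mt c T y A) x = sm T (mt c T y B) x := by
  intro x hx hxy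
  have z1 : sm T C x = 0 := Finset.sum_eq_zero (fun e he => val_zero hx hxy (hC e he))
  have z2 : sm T D x = 0 := Finset.sum_eq_zero (fun e he => val_zero hx hxy (hD e he))
  have := h.id x hx
  rw [sm_mt hx hxy, sm_mt hx hxy]; linarith

theorem Loc.two (hc : CI c) (h : Loc c T A B C D) (hx : ZO c x) (h1 : sm T A x = 1) (hxy : InB T y x)
    (hC : ∀ e ∈ C, DT c T y e) (hD : ∀ e ∈ D, DT c T y e) (hB : B.card ≤ 4) :
    2 ≤ (mt c T y A).card := by
  have hon := h.onY hC hD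
  have pos : 0 < (mt c T y A).card := by
    rw [Finset.card_pos]
    by_contra hh
    rw [Finset.not_nonempty_iff_eq_empty] at hh
    have := sm_mt (E := A) hx.hp hxy
    rw [hh, h1, sm_empty] at this; norm_num at this
  by_contra hlt
  obtain ⟨a, ha⟩ := Finset.card_eq_one.1 (by omega : (mt c T y A).card = 1)
  have ham : a ∈ mt c T y A := by simp [ha]
  have := smL hc (h.cB.mono (mt_sub (y := y) (c := c) (T := T))) (h.tB.mono mt_sub)
    (fun f hf => (mt_mem.1 hf).2) (mt_mem.1 ham).2 (fun f hf hh => h.AB a (mt_sub ham) f (mt_sub hf) hh.symm)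
    (by intro x hx hxy; rw [← hon x hx hxy, ha, sm_single])
  have h2 : (mt c T y B).card ≤ B.card := Finset.card_le_card mt_sub
  omega

theorem ne_of_sm (h : sm T A x = 1) : 0 < A.card := by
  rw [Finset.card_pos]
  by_contra hh
  rw [Finset.not_nonempty_iff_eq_empty] at hh
  rw [hh, sm_empty] at h; norm_num at h

theorem SZ (hc : CI c) (h : Loc c T A B C D) (hn : A.card + D.card ≤ 5)
    (hne : ¬ (A = ∅ ∧ B = ∅ ∧ C = ∅ ∧ D = ∅)) :
    (2 ≤ A.card ∧ 2 ≤ B.card ∧ 2 ≤ C.card ∧ 2 ≤ D.card) ∧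
    (∃ x, ZO c x ∧ sm T A x = 1 ∧ sm T B x = 1 ∧ sm T C x = 0 ∧ sm T D x = 0) := by
  have hcd := card_of h.id
  obtain ⟨z, hz, z1, z2, z3, z4⟩ := SZR hc h hn hne
  obtain ⟨x, hx, x1, x2, x3, x4⟩ := SZR hc h.sV (by omega) (by tauto)
  refine ⟨?_, x, hx, x1, x2, x3, x4⟩
  obtain ⟨y, y1, y2, y3⟩ := h.RY x hx x1 x2 x3 x4
  obtain ⟨v, v1, v2, v3⟩ := h.RZ z hz z1 z2 z3 z4
  have pA := ne_of_sm x1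
  have pB := ne_of_sm x2
  have pC := ne_of_sm z1
  have pD := ne_of_sm z2
  have q1 := (h.two hc hx x1 y1 y2 y3 (by omega)).trans (Finset.card_le_card mt_sub)
  have q2 := (h.sP.two hc hx x2 y1 y3 y2 (by omega)).trans (Finset.card_le_card mt_sub)
  have q3 := (h.sV.two hc hz z1 v1 v2 v3 (by omega)).trans (Finset.card_le_card mt_sub)
  have q4 := (h.sV.sP.two hc hz z2 v1 v3 v2 (by omega)).trans (Finset.card_le_card mt_sub)
  exact ⟨q1, q2, q3, q4⟩

/-- application of CL for a word y hitting R -/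
theorem Loc.cl (hc : CI c) (h : Loc c T A B C D) {a1 a2 : ι → S} (hA : A = {a1, a2}) (ha : a1 ≠ a2)
    (hB : B.card ≤ 3) (hj : j ∈ T) (h1j : a1 j = l) (h2j : a2 j = c l)
    (hx : ZO c x) (h1 : sm T A x = 1) (hxy : InB T y x)
    (hC : ∀ e ∈ C, DT c T y e) (hD : ∀ e ∈ D, DT c T y e) :
    ¬ DT c T y a1 ∧ ¬ DT c T y a2 ∧
    ∃ f0 ∈ mt c T y B, f0 j = y j ∧ (∀ f ∈ mt c T y B, f ≠ f0 → f j = l ∨ f j = c l) ∧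
      (∀ x, HP c x → InB (T.erase j) y x →
        sm (T.erase j) (fl (mt c T y B) j l) x + val (T.erase j) f0 x = val (T.erase j) a1 x) ∧
      (∀ x, HP c x → InB (T.erase j) y x →
        sm (T.erase j) (fl (mt c T y B) j (c l)) x + val (T.erase j) f0 x = val (T.erase j) a2 x) := by
  have h2 := h.two hc hx h1 hxy hC hD (by omega)
  have hAc : A.card = 2 := by rw [hA, Finset.card_pair ha]
  have hmA : mt c T y A = A := Finset.eq_of_subset_of_card_le mt_sub (by omega)
  have hon := h.onY hC hD
  rw [hmA] at hon
  have m : ∀ a ∈ A, ¬ DT c T y a := fun a haA => by rw [← hmA] at haA; exact (mt_mem.1 haA).2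
  have a1A : a1 ∈ A := by simp [hA]
  have a2A : a2 ∈ A := by simp [hA]
  refine ⟨m a1 a1A, m a2 a2A, ?_⟩
  apply CL hc hj h1j h2j (m a1 a1A) (m a2 a2A) (h.tA a1 a1A a2 a2A j hj (by rw [h2j, h1j]))
    (h.cB.mono mt_sub) (h.tB.mono mt_sub) ((Finset.card_le_card mt_sub).trans hB)
    (fun f hf => (mt_mem.1 hf).2)
    (fun f hf hh => h.AB a1 a1A f (mt_sub hf) hh.symm) (fun f hf hh => h.AB a2 a2A f (mt_sub hf) hh.symm)
  intro x hx hxy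
  rw [← hon x hx hxy, hA, sm_pair ha]

/-- all words hitting R have the same letter at j -/
theorem Loc.same (hc : CI c) (h : Loc c T A B C D) {a1 a2 : ι → S} (hA : A = {a1, a2}) (ha : a1 ≠ a2)
    (hB : B.card ≤ 3) (hj : j ∈ T) (h1j : a1 j = l) (h2j : a2 j = c l)
    (hx : ZO c x) (h1 : sm T A x = 1) (hxy : InB T y x)
    (hC : ∀ e ∈ C, DT c T y e) (hD : ∀ e ∈ D, DT c T y e) {x' : ι → S → ℚ} {y' : ι → S}
    (hx' : ZO c x') (h1' : sm T A x' = 1) (hxy' : InB T y' x')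
    (hC' : ∀ e ∈ C, DT c T y' e) (hD' : ∀ e ∈ D, DT c T y' e) : y' j = y j := by
  obtain ⟨m1, m2, f, fF, fj, fo, i1, i2⟩ := h.cl hc hA ha hB hj h1j h2j hx h1 hxy hC hD
  obtain ⟨m1', m2', f', fF', fj', fo', i1', i2'⟩ := h.cl hc hA ha hB hj h1j h2j hx' h1' hxy' hC' hD'
  by_cases hff : f = f'
  · rw [← fj, ← fj', hff]
  exfalso
  have nl : ∀ {y : ι → S}, ¬ DT c T y a1 → ¬ DT c T y a2 → y j ≠ l ∧ y j ≠ c l := by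
    intro y p q
    refine ⟨fun hh => q ⟨j, hj, by rw [h2j, hh]⟩, fun hh => p ⟨j, hj, by rw [h1j, hh, hc.inv]⟩⟩
  have n1 := nl m1 m2
  have n2 := nl m1' m2'
  rw [← fj] at n1
  rw [← fj'] at n2
  have fB := mt_sub fF
  have fB' := mt_sub fF'
  have key : ∀ (a : ι → S) (l' : S), ¬ DT c T y a → ¬ DT c T y' a → fl B j l' = ∅ →
      (∀ x, HP c x → InB (T.erase j) y x →
        sm (T.erase j) (fl (mt c T y B) j l') x + val (T.erase j) f x = val (T.erase j) a x) →
      (∀ x, HP c x → InB (T.erase j) y' x →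
        sm (T.erase j) (fl (mt c T y' B) j l') x + val (T.erase j) f' x = val (T.erase j) a x) → False := by
    intro a l' q1 q2 q3 q4 q5
    have em : ∀ y, fl (mt c T y B) j l' = ∅ := by
      intro y; apply empty_of; intro z hz
      have : z ∈ fl B j l' := fl_mem.2 ⟨mt_sub (fl_sub hz), fl_l _ hz⟩
      rw [q3] at this; simp at this
    simp only [em, sm_empty, zero_add] at q4 q5
    have r1 := eqL hc (fun hd => (mt_mem.1 fF).2 (hd.mono er_sub)) (fun hd => q1 (hd.mono er_sub)) q4
    have r2 := eqL hc (fun hd => (mt_mem.1 fF').2 (hd.mono er_sub)) (fun hd => q2 (hd.mono er_sub)) q5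
    have r3 := r1.trans r2.symm
    obtain ⟨i, hi, hd⟩ := h.cB f fB f' fB' hff
    by_cases hij : i = j
    · subst hij; exact h.tB f fB f' fB' i hi hd r3
    · exact notDT_eq hc r3 ⟨i, by simp [hij, hi], hd⟩
  by_cases e1 : fl B j l = ∅
  · exact key a1 l m1 m1' e1 i1 i1'
  by_cases e2 : fl B j (c l) = ∅
  · exact key a2 (c l) m2 m2' e2 i2 i2'
  have p1 := Finset.card_pos.2 (Finset.nonempty_iff_ne_empty.2 e1)
  have p2 := Finset.card_pos.2 (Finset.nonempty_iff_ne_empty.2 e2)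
  have d1 : Disjoint (fl B j l ∪ fl B j (c l)) {f, f'} := by
    rw [Finset.disjoint_left]; intro z hz hz'
    simp only [Finset.mem_union, fl_mem, Finset.mem_insert, Finset.mem_singleton] at hz hz'
    rcases hz' with rfl | rfl <;> tauto
  have := Finset.card_le_card (Finset.union_subset (Finset.union_subset (fl_sub (E := B) (j := j) (l := l))
    (fl_sub (E := B) (j := j) (l := c l))) (by
      intro z hz; simp at hz; rcases hz with rfl | rfl <;> assumption : ({f, f'} : Finset (ι → S)) ⊆ B))
  rw [Finset.card_union_of_disjoint d1, Finset.card_union_of_disjoint (fl_disj (hc.nf _).symm),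
    Finset.card_pair hff] at this
  omega

/-- covering of half a box by two words -/
theorem CA1 (hc : CI c) (hC : Code c T C) (hT : TF c T C) (h2 : C.card = 2) (hj : j ∈ T) {η : S}
    (hη : η ≠ l) (hη' : η ≠ c l) (haj : a j = l) (hap : ∀ z ∈ C, ¬ EqT T a z)
    (K : ∀ x, HP c x → InB T a x → x j (c η) = 1 → sm T C x = 1) :
    (∃ p ∈ C, p j = c η ∧ EqT (T.erase j) p a) ∨
    (∃ p ∈ C, ∃ q ∈ C, ∃ k ∈ T.erase j, p j = l ∧ q j = c η ∧ q k = c (p k) ∧ p k ≠ a k ∧ p k ≠ c (a k)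
      ∧ EqT ((T.erase j).erase k) p a ∧ EqT ((T.erase j).erase k) q a) := by
  obtain ⟨p, q, hpq, hCe⟩ := Finset.card_eq_two.1 h2
  have ok : ∀ s ∈ [l, c η], c s ∉ [l, c η] := ok2 hc (fun h => hη (hc.inj h))
  have hU := mk_HU hc ok
  have K' : ∀ x, HP c x → InB (T.erase j) a x →
      mk c [l, c η] (p j) * val (T.erase j) p x + mk c [l, c η] (q j) * val (T.erase j) q x = 1 := by
    intro x hx hxa
    have := K _ (HP_upd (j := j) hx hU) (InB_upd hxa (fun _ => mk_one (by simp [haj]))) (by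
      rw [update_self]; exact mk_one (by simp))
    rwa [hCe, sm_pair hpq, val_upd' hj, val_upd' hj] at this
  have pC : p ∈ C := by simp [hCe]
  have qC : q ∈ C := by simp [hCe]
  -- one-word case
  have one : ∀ p ∈ C, ¬ DT c (T.erase j) a p → (∀ x, HP c x → InB (T.erase j) a x →
      mk c [l, c η] (p j) * val (T.erase j) p x = 1) → p j = c η ∧ EqT (T.erase j) p a := by
    intro p pC hm h
    obtain ⟨a1, a2, a3⟩ := pt_spec hc hm
    have h1 := h _ a1 a2
    rw [val_one a3, mul_one] at h1
    have h3 : EqT (T.erase j) p a := by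
      apply eqL hc hm (notDT_self hc)
      intro x hx hxa
      rw [val_one hxa, ← h x hx hxa, h1, one_mul]
    have h4 := mk_eq_one h1
    simp at h4
    rcases h4 with h4 | h4
    · exact absurd (h3.symm.ext (by rw [haj, h4])) (hap p pC)
    · exact ⟨h4, h3⟩
  have van : ∀ p, (DT c (T.erase j) a p ∨ mk c [l, c η] (p j) = 0) →
      ∀ x, HP c x → InB (T.erase j) a x → mk c [l, c η] (p j) * val (T.erase j) p x = 0 := by
    intro p h x hx hxa
    rcases h with h | h
    · rw [val_zero hx hxa h, mul_zero]
    · rw [h, zero_mul]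
  have meets : ∀ p, (∀ x, HP c x → InB (T.erase j) a x →
      mk c [l, c η] (p j) * val (T.erase j) p x = 1) → ¬ DT c (T.erase j) a p := by
    intro p h hd
    obtain ⟨a1, a2, _⟩ := pt_spec hc (notDT_self hc (T := T.erase j) (e := a))
    have h1 := h _ a1 a2
    rw [val_zero a1 a2 hd] at h1; norm_num at h1
  by_cases vp : DT c (T.erase j) a p ∨ mk c [l, c η] (p j) = 0
  · have h1 : ∀ x, HP c x → InB (T.erase j) a x → mk c [l, c η] (q j) * val (T.erase j) q x = 1 := by
      intro x hx hxa
      have := K' x hx hxa; rw [van p vp x hx hxa] at this; linarith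
    exact Or.inl ⟨q, qC, one q qC (meets q h1) h1⟩
  by_cases vq : DT c (T.erase j) a q ∨ mk c [l, c η] (q j) = 0
  · have h1 : ∀ x, HP c x → InB (T.erase j) a x → mk c [l, c η] (p j) * val (T.erase j) p x = 1 := by
      intro x hx hxa
      have := K' x hx hxa; rw [van q vq x hx hxa] at this; linarith
    exact Or.inl ⟨p, pC, one p pC (meets p h1) h1⟩
  right
  push Not at vp vq
  obtain ⟨mp, up⟩ := vp
  obtain ⟨mq, uq⟩ := vq
  obtain ⟨p1, p2, p3⟩ := pt_spec hc mp
  obtain ⟨q1, q2, q3⟩ := pt_spec hc mq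
  have kp := K' _ p1 p2
  have kq := K' _ q1 q2
  rw [val_one p3, mul_one] at kp
  rw [val_one q3, mul_one] at kq
  have zz : val (T.erase j) p (pt c (T.erase j) a q) = 0 → val (T.erase j) q (pt c (T.erase j) a p) = 0 := by
    intro h0
    obtain ⟨k, hk, h1⟩ := zero_of_val h0
    rcases pt_zero hk h1 with h2 | h2
    · exact absurd ⟨k, hk, by rw [← h2, hc.inv]⟩ mp
    · apply val_zero p1 p3
      exact ⟨k, hk, h2.symm⟩
  have zz' : val (T.erase j) q (pt c (T.erase j) a p) = 0 → val (T.erase j) p (pt c (T.erase j) a q) = 0 := by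
    intro h0
    obtain ⟨k, hk, h1⟩ := zero_of_val h0
    rcases pt_zero hk h1 with h2 | h2
    · exact absurd ⟨k, hk, by rw [← h2, hc.inv]⟩ mq
    · apply val_zero q1 q3
      exact ⟨k, hk, h2.symm⟩
  have both : mk c [l, c η] (p j) = 1 ∧ mk c [l, c η] (q j) = 1 := by
    rcases (hU (p j)).2 with h1 | h1 | h1
    · exact absurd h1 up
    · rcases (hU (q j)).2 with h2 | h2 | h2
      · exact absurd h2 uq
      · exfalso
        have e1 : ∀ x, HP c x → InB (T.erase j) a x → val (T.erase j) p x = 1 ∧ val (T.erase j) q x = 1 := by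
          intro x hx hxa
          have := K' x hx hxa
          rw [h1, h2] at this
          have v1 := val_le (T := T.erase j) (e := p) hx
          have v2 := val_le (T := T.erase j) (e := q) hx
          constructor <;> linarith
        have r1 : EqT (T.erase j) p a := eqL hc mp (notDT_self hc) (fun x hx hxa => by
          rw [val_one hxa, (e1 x hx hxa).1])
        have r2 : EqT (T.erase j) q a := eqL hc mq (notDT_self hc) (fun x hx hxa => by
          rw [val_one hxa, (e1 x hx hxa).2])
        have r3 := r1.trans r2.symm
        obtain ⟨i, hi, hd⟩ := hC p pC q qC hpq
        by_cases hij : i = j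
        · subst hij; exact hT p pC q qC i hi hd r3
        · exact notDT_eq hc r3 ⟨i, by simp [hij, hi], hd⟩
      · exfalso
        rw [h1, h2] at kp kq
        have := zz (by linarith)
        rw [this] at kp; norm_num at kp
    · rcases (hU (q j)).2 with h2 | h2 | h2
      · exact absurd h2 uq
      · exfalso
        rw [h1, h2] at kp kq
        have := zz' (by linarith)
        rw [this] at kq; norm_num at kq
      · exact ⟨h1, h2⟩
  obtain ⟨k, hk, s1, s2, s3, s4, s5⟩ := split2' hc mp mq (by
    intro x hx hxa
    have := K' x hx hxa
    rwa [both.1, both.2, one_mul, one_mul] at this)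
  have lp := mk_eq_one both.1
  have lq := mk_eq_one both.2
  simp at lp lq
  have hpqj : p j ≠ q j := by
    intro hh
    refine hT p pC q qC k (Finset.mem_of_mem_erase hk) s1 ?_
    intro i hi
    by_cases hij : i = j
    · rw [hij, hh]
    · have hi' : i ∈ (T.erase j).erase k := by
        simp at hi ⊢; tauto
      rw [s4 i hi', s5 i hi']
  rcases lp with lp | lp
  · rcases lq with lq | lq
    · exact absurd (lp.trans lq.symm) hpqj
    · exact ⟨p, pC, q, qC, k, hk, lp, lq, s1, s2, s3, s4, s5⟩
  · rcases lq with lq | lq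
    · refine ⟨q, qC, p, pC, k, hk, lq, lp, by rw [s1, hc.inv], ?_, ?_, s5, s4⟩
      · rw [s1]; intro h'; exact s3 (by rw [← h', hc.inv])
      · rw [s1]; intro h'; exact s2 (hc.inj h')
    · exact absurd (lp.trans lq.symm) hpqj

end PB

namespace PB
open Finset Function
set_option linter.all false
variable {ι S : Type*} [Fintype ι] [DecidableEq ι] [DecidableEq S] {c : S → S}
  {T U : Finset ι} {E F A B C D M N : Finset (ι → S)} {x : ι → S → ℚ} {j k : ι} {e f g y t a : ι → S}
  {l s : S} {u : S → ℚ}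

def N4out (c : S → S) (T : Finset ι) (A B C D : Finset (ι → S)) : Prop :=
  ∃ j ∈ T, ∃ k ∈ T.erase j, ∃ o z : ι → S, EqT ((T.erase j).erase k) o z ∧ z j ≠ o j ∧ z j ≠ c (o j) ∧
    o k ≠ z k ∧ o k ≠ c (z k) ∧ (∀ x, HP c x → sm T A x + val T z x = sm T C x + val T o x) ∧
    (∀ y, (∀ e ∈ C, DT c T y e) → (∀ e ∈ D, DT c T y e) → ¬ DT c ((T.erase j).erase k) o y →
      y j = o j ∧ y k = o k) ∧
    (∀ y, (∀ e ∈ A, DT c T y e) → (∀ e ∈ B, DT c T y e) → ¬ DT c ((T.erase j).erase k) z y →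
      y j = z j ∧ y k = z k)

theorem val_jk {w : ι → S} (hj : j ∈ T) (hk : k ∈ T.erase j) (h : EqT ((T.erase j).erase k) e w) :
    val T e x = x j (e j) * (x k (e k) * val ((T.erase j).erase k) w x) := by
  rw [val_erase hj, val_erase hk, val_eqT h]

theorem mkw (hk : k ∈ T.erase j) (w : ι → S) (p q : S) :
    ∃ e : ι → S, e j = p ∧ e k = q ∧ EqT ((T.erase j).erase k) e w := by
  have hjk : j ≠ k := fun h => by simp [h] at hk
  refine ⟨update (update w j p) k q, ?_, ?_, ?_⟩
  · rw [update_of_ne hjk, update_self]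
  · rw [update_self]
  · intro i hi
    simp at hi
    rw [update_of_ne hi.1, update_of_ne hi.2.1]

theorem EqT.ext2 (h : EqT ((T.erase j).erase k) e f) (hj : e j = f j) (hk : e k = f k) : EqT T e f := by
  intro i hi
  by_cases h1 : i = j
  · rw [h1, hj]
  · by_cases h2 : i = k
    · rw [h2, hk]
    · exact h i (by simp [h1, h2, hi])

theorem DT_jk {w : ι → S} (hd : DT c T y e) (he : EqT ((T.erase j).erase k) e w)
    (hm : ¬ DT c ((T.erase j).erase k) y w) : e j = c (y j) ∨ e k = c (y k) := by
  obtain ⟨i, hi, h⟩ := hd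
  by_cases h1 : i = j
  · subst h1; exact Or.inl h
  · by_cases h2 : i = k
    · subst h2; exact Or.inr h
    · have hi' : i ∈ (T.erase j).erase k := by simp [h1, h2, hi]
      exact absurd ⟨i, hi', by rw [← he i hi', h]⟩ hm

theorem N4T_core (hc : CI c) (h : Loc c T A B C D) {a1 a2 p q f0 : ι → S} {η : S}
    (hA : A = {a1, a2}) (ha : a1 ≠ a2) (hC : C = {p, q}) (hpq : p ≠ q)
    (hB2 : 2 ≤ B.card) (hB : B.card ≤ 3) (hBD : B.card = D.card)
    (hj : j ∈ T) (hk : k ∈ T.erase j) (h1j : a1 j = l) (h2j : a2 j = c l) (pj : p j = l) (qj : q j = c η)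
    (pk : p k = c (a2 k)) (qa : EqT (T.erase j) q a2) (pw : EqT ((T.erase j).erase k) p a1)
    (a2w : EqT ((T.erase j).erase k) a2 a1) (k1 : a2 k ≠ a1 k) (k2 : a2 k ≠ c (a1 k))
    (η1 : η ≠ l) (η2 : η ≠ c l) (hy : y j = η) (m1 : ¬ DT c T y a1) (m2 : ¬ DT c T y a2)
    (f0F : f0 ∈ mt c T y B) (f0j : f0 j = y j)
    (oth : ∀ f ∈ mt c T y B, f ≠ f0 → f j = l ∨ f j = c l)
    (i1 : ∀ x, HP c x → InB (T.erase j) y x →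
        sm (T.erase j) (fl (mt c T y B) j l) x + val (T.erase j) f0 x = val (T.erase j) a1 x)
    (i2 : ∀ x, HP c x → InB (T.erase j) y x →
        sm (T.erase j) (fl (mt c T y B) j (c l)) x + val (T.erase j) f0 x = val (T.erase j) a2 x) :
    B.card = 2 ∧ N4out c T A B C D := by
  have hjk : j ≠ k := fun h => by simp [h] at hk
  have hkT : k ∈ T := Finset.mem_of_mem_erase hk
  obtain ⟨o, oj, ok, ow⟩ := mkw hk a1 η (a2 k)
  obtain ⟨z, zj, zk, zw⟩ := mkw hk a1 l (c (a1 k))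
  have qw : EqT ((T.erase j).erase k) q a1 := (qa.mono er_sub).trans a2w
  have qk : q k = a2 k := qa k hk
  have self : EqT ((T.erase j).erase k) a1 a1 := fun _ _ => rfl
  have id1 : ∀ x, HP c x → sm T A x + val T z x = sm T C x + val T o x := by
    intro x hx
    rw [hA, hC, sm_pair ha, sm_pair hpq, val_jk hj hk zw, val_jk hj hk ow, val_jk hj hk self,
      val_jk hj hk a2w, val_jk hj hk pw, val_jk hj hk qw, zj, zk, oj, ok, h1j, h2j, pj, pk, qj, qk,
      (hx j l).1, (hx j η).1, (hx k _).1, (hx k _).1]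
    ring
  have id2 : ∀ x, HP c x → sm T D x + val T o x = sm T B x + val T z x := by
    intro x hx
    have := id1 x hx
    have := h.id x hx
    linarith
  -- b dominated by D is impossible
  have nodom : ∀ b ∈ B, (∀ x, HP c x → val T b x ≤ sm T D x) → False := by
    intro b hb hd
    have := domL hc h.cD h.tD (fun d hd' hh => h.BD b hb d hd' hh.symm) hd
    omega
  have noω : ∀ b ∈ B, ¬ EqT T b o := by
    intro b hb hbo
    have : 0 < (B.erase b).card := by rw [Finset.card_erase_of_mem hb]; omega
    obtain ⟨b', hb'⟩ := Finset.card_pos.1 this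
    apply nodom b' (Finset.mem_of_mem_erase hb')
    intro x hx
    have := id2 x hx
    rw [sm_erase hb, val_eqT hbo] at this
    have h1 := val_le_sm (T := T) hx hb'
    have h2 := val_nonneg (T := T) (e := z) hx
    linarith
  set F := mt c T y B with hF
  have fm : ∀ f ∈ F, ¬ DT c (T.erase j) y f := fun f hf hd => (mt_mem.1 hf).2 (hd.mono er_sub)
  have FB : ∀ f ∈ F, f ∈ B := fun f hf => mt_sub hf
  have m1' : ¬ DT c (T.erase j) y a1 := fun hd => m1 (hd.mono er_sub)
  have m2' : ¬ DT c (T.erase j) y a2 := fun hd => m2 (hd.mono er_sub)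
  have f0B := FB f0 f0F
  have f0η : f0 j = η := by rw [f0j, hy]
  have cardF : (fl F j l).card + (fl F j (c l)).card + 1 ≤ B.card := by
    have d1 : Disjoint (fl F j l ∪ fl F j (c l)) {f0} := by
      rw [Finset.disjoint_left]; intro z hz hz'
      simp only [Finset.mem_union, fl_mem, Finset.mem_singleton] at hz hz'
      subst hz'; rw [f0η] at hz; tauto
    have := Finset.card_le_card (Finset.union_subset (Finset.union_subset (fl_sub (E := F) (j := j) (l := l))
      (fl_sub (E := F) (j := j) (l := c l))) (by simpa using f0F : ({f0} : Finset (ι → S)) ⊆ F))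
    rw [Finset.card_union_of_disjoint d1, Finset.card_union_of_disjoint (fl_disj (hc.nf _).symm)] at this
    have h2 : F.card ≤ B.card := Finset.card_le_card mt_sub
    simpa using this.trans h2
  have a12 : ¬ EqT (T.erase j) a1 a2 := fun hh => k1 (hh k hk).symm
  by_cases c2 : (fl F j (c l)).card = 0
  · exfalso
    rw [Finset.card_eq_zero] at c2
    have : EqT (T.erase j) f0 a2 := eqL hc (fm f0 f0F) m2' (by
      intro x hx hxy; rw [← i2 x hx hxy, c2, sm_empty, zero_add])
    apply noω f0 f0B
    apply EqT.ext2 ((this.mono er_sub).trans (a2w.trans ow.symm)) (by rw [f0η, oj]) (by rw [this k hk, ok])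
  by_cases c1 : (fl F j l).card = 0
  swap
  · exfalso
    obtain ⟨f, hf⟩ := Finset.card_eq_one.1 (by omega : (fl F j (c l)).card = 1)
    obtain ⟨g, hg⟩ := Finset.card_eq_one.1 (by omega : (fl F j l).card = 1)
    have fF : f ∈ fl F j (c l) := by simp [hf]
    have gF : g ∈ fl F j l := by simp [hg]
    obtain ⟨n1, hn1, u1, u2, u3, u4, u5, u6⟩ := split2 hc (e := a1) (f := f0) (g := g) (y := y) (T := T.erase j)
      (fun hh => η1 (by rw [← f0η, hh, fl_l g gF])) m1' (fm f0 f0F) (fm g (fl_sub gF)) (by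
        intro x hx hxy; rw [← i1 x hx hxy, hg, sm_single, add_comm])
    obtain ⟨n2, hn2, v1, v2, v3, v4, v5, v6⟩ := split2 hc (e := a2) (f := f0) (g := f) (y := y) (T := T.erase j)
      (fun hh => η2 (by rw [← f0η, hh, fl_l f fF])) m2' (fm f0 f0F) (fm f (fl_sub fF)) (by
        intro x hx hxy; rw [← i2 x hx hxy, hf, sm_single, add_comm])
    have only : ∀ i ∈ T.erase j, a1 i ≠ a2 i → i = k := by
      intro i hi hne; by_contra hik
      exact hne (a2w i (by simp [hik]; simpa using hi)).symm
    by_cases h12 : n1 = n2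
    · subst h12
      apply a12
      intro i hi
      by_cases hin : i = n1
      · rw [hin, u1, v1]
      · have hi' : i ∈ (T.erase j).erase n1 := Finset.mem_erase.2 ⟨hin, hi⟩
        rw [← u5 i hi', ← v5 i hi']
    · have e1 : n1 = k := only n1 hn1 (fun hh => u3 (by
        rw [v5 n1 (Finset.mem_erase.2 ⟨h12, hn1⟩), hh]))
      have e2 : n2 = k := only n2 hn2 (fun hh => v3 (by
        rw [u5 n2 (Finset.mem_erase.2 ⟨Ne.symm h12, hn2⟩), hh]))
      exact h12 (e1.trans e2.symm)
  rw [Finset.card_eq_zero] at c1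
  have f0a : EqT (T.erase j) f0 a1 := eqL hc (fm f0 f0F) m1' (by
      intro x hx hxy; rw [← i1 x hx hxy, c1, sm_empty, zero_add])
  have f0k : f0 k = a1 k := f0a k hk
  have f0w : EqT ((T.erase j).erase k) f0 a1 := f0a.mono er_sub
  by_cases c3 : (fl F j (c l)).card = 1
  · obtain ⟨f, hf⟩ := Finset.card_eq_one.1 c3
    have fF : f ∈ fl F j (c l) := by simp [hf]
    have fB := FB f (fl_sub fF)
    have fj : f j = c l := fl_l f fF
    have f0f : f0 ≠ f := fun hh => η2 (by rw [← f0η, hh, fj])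
    obtain ⟨n, hn, u1, u2, u3, u4, u5, u6⟩ := split2 hc (e := a2) (f := f0) (g := f) (y := y) (T := T.erase j)
      f0f m2' (fm f0 f0F) (fm f (fl_sub fF)) (by
        intro x hx hxy; rw [← i2 x hx hxy, hf, sm_single, add_comm])
    have hnk : n = k := by
      by_contra hnk
      exact k1 (by rw [← u5 k (Finset.mem_erase.2 ⟨fun h' => hnk h'.symm, hk⟩), f0k])
    subst hnk
    have fk : f n = c (a1 n) := by rw [u2, f0k]
    have fw : EqT ((T.erase j).erase n) f a1 := u6.trans a2w
    obtain ⟨d1, d1j, d1k, d1w⟩ := mkw hk a1 η (c (a2 n))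
    obtain ⟨d2, d2j, d2k, d2w⟩ := mkw hk a1 (c η) (c (a1 n))
    have fB' : f ∈ B.erase f0 := Finset.mem_erase.2 ⟨f0f.symm, fB⟩
    have idD : ∀ x, HP c x → sm T D x = sm T ((B.erase f0).erase f) x + (val T d1 x + val T d2 x) := by
      intro x hx
      have := id2 x hx
      rw [sm_erase f0B, sm_erase fB', val_jk hj hk f0w, val_jk hj hk fw, val_jk hj hk ow, val_jk hj hk zw,
        zj, zk, oj, ok, fj, fk, f0η, f0k, (hx j l).1, (hx _ (a1 n)).1] at this
      rw [val_jk hj hk d1w, val_jk hj hk d2w, d1j, d1k, d2j, d2k, (hx j η).1, (hx _ (a1 n)).1, (hx _ (a2 n)).1]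
      linarith
    have cB : B.card = 2 := by
      by_contra hne
      have : 0 < ((B.erase f0).erase f).card := by
        rw [Finset.card_erase_of_mem fB', Finset.card_erase_of_mem f0B]; omega
      obtain ⟨b', hb'⟩ := Finset.card_pos.1 this
      apply nodom b' (Finset.mem_of_mem_erase (Finset.mem_of_mem_erase hb'))
      intro x hx
      rw [idD x hx]
      have h1 := val_le_sm (T := T) hx hb'
      have h2 := val_nonneg (T := T) (e := d1) hx
      have h3 := val_nonneg (T := T) (e := d2) hx
      linarith
    refine ⟨cB, j, hj, n, hk, o, z, ow.trans zw.symm, ?_, ?_, ?_, ?_, id1, ?_, ?_⟩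
    · rw [zj, oj]; exact η1.symm
    · rw [zj, oj]; intro hh; exact η2 (by rw [hh, hc.inv])
    · rw [ok, zk]; exact k2
    · rw [ok, zk, hc.inv]; exact k1
    · intro v vC vD vo
      have vm : ¬ DT c ((T.erase j).erase n) v a1 := fun hd => vo ((hd.symm hc).congr ow.symm)
      have r1 := DT_jk (vC p (by simp [hC])) pw vm
      have r2 := DT_jk (vC q (by simp [hC])) qw vm
      have vd1 : DT c T v d1 := by
        by_contra hd
        obtain ⟨b1, b2, b3⟩ := pt_spec hc hd
        have e1 : sm T D (pt c T v d1) = 0 := Finset.sum_eq_zero (fun e he => val_zero b1 b2 (vD e he))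
        have e2 := idD _ b1
        rw [e1, val_one b3] at e2
        have h1 := sm_nonneg (T := T) (E := (B.erase f0).erase f) b1
        have h3 := val_nonneg (T := T) (e := d2) b1
        linarith
      have r3 := DT_jk vd1 d1w vm
      rw [pj, pk] at r1
      rw [qj, qk] at r2
      rw [d1j, d1k] at r3
      rw [oj, ok]
      have inj : ∀ {a b : S}, c a = c b → a = b := fun hh => hc.inj hh
      have cv : ∀ {a b : S}, a = c b → b = c a := fun hh => by rw [hh, hc.inv]
      rcases r2 with r2 | r2
      · rcases r1 with r1 | r1
        · exfalso; exact η2 (by rw [inj r2, cv r1])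
        · exact ⟨(inj r2).symm, (inj r1).symm⟩
      · exfalso
        have nk : c (a2 n) ≠ c (v n) := fun hh => hc.nf (v n) (r2.symm.trans (inj hh))
        rcases r1 with r1 | r1
        · rcases r3 with r3 | r3
          · exact η1 (by rw [r1, r3])
          · exact nk r3
        · exact nk r1
    · intro v vA vB vo
      have vm : ¬ DT c ((T.erase j).erase n) v a1 := fun hd => vo ((hd.symm hc).congr zw.symm)
      have r1 := DT_jk (vA a1 (by simp [hA])) self vm
      have r2 := DT_jk (vA a2 (by simp [hA])) a2w vm
      have r3 := DT_jk (vB f fB) fw vm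
      rw [h1j] at r1
      rw [h2j] at r2
      rw [fj, fk] at r3
      rw [zj, zk]
      have inj : ∀ {a b : S}, c a = c b → a = b := fun hh => hc.inj hh
      have cv : ∀ {a b : S}, a = c b → b = c a := fun hh => by rw [hh, hc.inv]
      rcases r2 with r2 | r2
      · rcases r1 with r1 | r1
        · exfalso; exact hc.nf (v j) (r1.symm.trans (inj r2))
        · exact ⟨(inj r2).symm, cv r1⟩
      · exfalso
        rcases r1 with r1 | r1
        · rcases r3 with r3 | r3
          · exact hc.nf (v j) (r1.symm.trans (inj r3))
          · exact k2 (by rw [inj r3]; exact r2)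
        · exact k1 (by rw [r1, r2])
  · exfalso
    obtain ⟨f, g, hfg, hfge⟩ := Finset.card_eq_two.1 (by omega : (fl F j (c l)).card = 2)
    have fF : f ∈ fl F j (c l) := by simp [hfge]
    have gF : g ∈ fl F j (c l) := by simp [hfge]
    have fne : f ≠ f0 := fun hh => η2 (by rw [← f0η, ← hh, fl_l f fF])
    have gne : g ≠ f0 := fun hh => η2 (by rw [← f0η, ← hh, fl_l g gF])
    have sum3 : ∀ x, HP c x → InB (T.erase j) y x →
        val (T.erase j) f x + val (T.erase j) g x + val (T.erase j) f0 x = val (T.erase j) a2 x := by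
      intro x hx hxy
      rw [← i2 x hx hxy, hfge, sm_pair hfg]
    have dE : Disjoint ({f, g} : Finset (ι → S)) {f0} := by
      rw [Finset.disjoint_left]; intro w hw hw'
      simp at hw hw'; subst hw'; rcases hw with hw | hw
      · exact fne hw.symm
      · exact gne hw.symm
    have r := red1 hc (E := {f, g} ∪ {f0}) (a := a2) (y := y) (T := T.erase j) (by
      intro e he; simp only [Finset.mem_union, Finset.mem_insert, Finset.mem_singleton] at he
      rcases he with (rfl | rfl) | rfl
      · exact fm _ (fl_sub fF)
      · exact fm _ (fl_sub gF)
      · exact fm _ f0F) (by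
      intro x hx hxy; rw [sm_union dE, sm_pair hfg, sm_single, sum3 x hx hxy])
    have yk : a2 k = y k := by
      by_contra hh
      exact k1 (by rw [← r f0 (by simp) k hk hh, f0k])
    have s1 := S1 hc (T := T.erase j) (A := {f, g}) (D := {f0}) (B := {a2}) (C := ∅) (T0 := T.erase j) (y := y)
      (l := a1 k) hk (fun _ => ⟨by rw [← yk]; exact k1.symm, by
        rw [← yk]; intro hh; exact k2 (by rw [hh, hc.inv])⟩) (by
        intro x hx hxy; rw [sm_pair hfg, sm_single, sm_single, sm_empty, sum3 x hx hxy, add_zero])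
    rw [fl_single_ne (l := a1 k) (e := a2) k1, fl_single_ne (l := c (a1 k)) (e := a2) k2,
      fl_single_eq f0k, fl_single_ne (l := c (a1 k)) (e := f0) (by rw [f0k]; exact (hc.nf _).symm)] at s1
    simp only [fl_empty, sm_empty, sm_single, add_zero, zero_add] at s1
    have tw : ∀ u v : ι → S, u ∈ fl F j (c l) → v ∈ fl F j (c l) → u k = v k →
        ∀ n ∈ (T.erase j).erase k, v n = c (u n) → EqT (((T.erase j).erase k).erase n) u v → False := by
      intro u v hu hv huv n hn hd he
      have hnT : n ∈ T := by simp at hn; exact hn.2.2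
      refine h.tB u (FB u (fl_sub hu)) v (FB v (fl_sub hv)) n hnT hd ?_
      intro i hi
      simp at hi
      by_cases hij : i = j
      · rw [hij, fl_l u hu, fl_l v hv]
      · by_cases hik : i = k
        · rw [hik, huv]
        · exact he i (by simp [hi, hij, hik])
    have fmU : ∀ e ∈ F, ¬ DT c ((T.erase j).erase k) y e := fun e he hd => fm e he (hd.mono er_sub)
    -- one word equal to the complement slot
    have caseA : ∀ f g : ι → S, f ∈ fl F j (c l) → g ∈ fl F j (c l) → f k = c (a1 k) →
        (∀ x, HP c x → InB (T.erase j) y x →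
          val (T.erase j) f x + val (T.erase j) g x + val (T.erase j) f0 x = val (T.erase j) a2 x) →
        (∀ x, HP c x → InB ((T.erase j).erase k) y x →
          val ((T.erase j).erase k) f0 x = val ((T.erase j).erase k) f x) → False := by
      intro f g hf hg hfk s3 he
      have e1 := eqL hc (fmU f0 f0F) (fmU f (fl_sub hf)) he
      obtain ⟨b1, b2, b3⟩ := pt_spec hc (fm g (fl_sub hg))
      have := s3 _ b1 b2
      rw [val_one b3, val_erase hk, val_erase hk, val_erase hk (e := a2), hfk, f0k, yk, b2 k hk,
        (b1 k _).1, ← val_eqT e1, val_eqT f0w, val_eqT a2w] at this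
      linarith
    -- mixed case
    have caseB : ∀ f g : ι → S, f ∈ fl F j (c l) → g ∈ fl F j (c l) → f k = c (a1 k) → g ≠ f0 →
        f ∈ ({f, g} : Finset (ι → S)) ∪ {f0} →
        (∀ j_1 ∈ T.erase j, a2 j_1 ≠ y j_1 → f j_1 = a2 j_1) →
        (∀ x, HP c x → InB ((T.erase j).erase k) y x →
          val ((T.erase j).erase k) g x + val ((T.erase j).erase k) f0 x = val ((T.erase j).erase k) f x) →
        False := by
      intro f g hf hg hfk hgf0 _ hr he
      obtain ⟨n, hn, u1, u2, u3, u4, u5, u6⟩ := split2 hc (e := f) (f := f0) (g := g) (y := y)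
        (T := (T.erase j).erase k) (Ne.symm hgf0) (fmU f (fl_sub hf)) (fmU f0 f0F) (fmU g (fl_sub hg)) (by
          intro x hx hxy; rw [← he x hx hxy, add_comm])
      by_cases hay : a2 n = y n
      · exact u3 (by rw [f0w n hn, ← a2w n hn, hay, u1])
      · exact u3 (by rw [f0w n hn, ← a2w n hn, hr n (Finset.mem_of_mem_erase hn) hay])
    have sub : ∀ l', fl ({f, g} : Finset (ι → S)) k l' =
        (if f k = l' then {f} else ∅) ∪ (if g k = l' then {g} else ∅) := by
      intro l'; ext w; simp only [fl_mem, Finset.mem_insert, Finset.mem_singleton, Finset.mem_union]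
      constructor
      · rintro ⟨rfl | rfl, h2⟩
        · left; simp [h2]
        · right; simp [h2]
      · split_ifs with b1 b2 b2 <;> simp
        · rintro (rfl | rfl) <;> simp [b1, b2]
        · rintro rfl; simp [b1]
        · rintro rfl; simp [b2]
    have nf1 := hc.nf (a1 k)
    by_cases fk : f k = c (a1 k)
    · by_cases gk : g k = c (a1 k)
      · rw [sub, sub, fk, gk, if_neg nf1, if_pos rfl, if_pos rfl] at s1
        obtain ⟨n, hn, u1, u2, u3, u4, u5, u6⟩ := split2 hc (e := f0) (f := f) (g := g) (y := y)
          (T := (T.erase j).erase k) hfg (fmU f0 f0F) (fmU f (fl_sub fF)) (fmU g (fl_sub gF)) (by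
          intro x hx hxy
          have := s1 x hx hxy
          rw [if_neg nf1, Finset.empty_union, sm_empty, zero_add, sm_union (by simpa using hfg), sm_single, sm_single] at this
          linarith)
        exact tw f g fF gF (by rw [fk, gk]) n hn u2 (u5.trans u6.symm)
      · by_cases gk2 : g k = a1 k
        · apply caseB f g fF gF fk gne (by simp) (r f (by simp))
          intro x hx hxy
          have := s1 x hx hxy
          rw [sub, sub, fk, gk2, if_neg nf1, if_pos rfl, if_pos rfl, if_neg nf1.symm] at this
          simpa using this
        · apply caseA f g fF gF fk sum3
          intro x hx hxy
          have := s1 x hx hxy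
          rw [sub, sub, fk, if_neg nf1, if_pos rfl, if_neg gk, if_neg gk2] at this
          simpa using this
    · by_cases gk : g k = c (a1 k)
      · by_cases fk2 : f k = a1 k
        · apply caseB g f gF fF gk fne (by simp) (r g (by simp))
          intro x hx hxy
          have := s1 x hx hxy
          rw [sub, sub, gk, fk2, if_neg nf1, if_pos rfl, if_pos rfl, if_neg nf1.symm] at this
          simpa using this
        · apply caseA g f gF fF gk (fun x hx hxy => by rw [← sum3 x hx hxy]; ring)
          intro x hx hxy
          have := s1 x hx hxy
          rw [sub, sub, gk, if_neg nf1, if_pos rfl, if_neg fk, if_neg fk2] at this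
          simpa using this
      · obtain ⟨b1, b2, b3⟩ := pt_spec hc (fmU f0 f0F)
        have := s1 _ b1 b2
        rw [sub (c (a1 k)), if_neg fk, if_neg gk, val_one b3] at this
        simp at this
        have h1 := sm_nonneg (T := (T.erase j).erase k) (E := fl {f, g} k (a1 k)) b1
        linarith

end PB

namespace PB
open Finset Function
set_option linter.all false
variable {ι S : Type*} [Fintype ι] [DecidableEq ι] [DecidableEq S] {c : S → S}
  {T U : Finset ι} {E F A B C D M N : Finset (ι → S)} {x : ι → S → ℚ} {j k : ι} {e f g y t a : ι → S}
  {l s : S} {u : S → ℚ}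


theorem N4T_half (hc : CI c) (h : Loc c T A B C D) {a1 a2 f0 : ι → S} {η : S}
    (hA : A = {a1, a2}) (ha : a1 ≠ a2) (h2 : C.card = 2)
    (hB2 : 2 ≤ B.card) (hB : B.card ≤ 3) (hBD : B.card = D.card)
    (hj : j ∈ T) (h1j : a1 j = l) (h2j : a2 j = c l)
    (η1 : η ≠ l) (η2 : η ≠ c l) (hy : y j = η) (m1 : ¬ DT c T y a1) (m2 : ¬ DT c T y a2)
    (f0F : f0 ∈ mt c T y B) (f0j : f0 j = y j)
    (oth : ∀ f ∈ mt c T y B, f ≠ f0 → f j = l ∨ f j = c l)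
    (i1 : ∀ x, HP c x → InB (T.erase j) y x →
        sm (T.erase j) (fl (mt c T y B) j l) x + val (T.erase j) f0 x = val (T.erase j) a1 x)
    (i2 : ∀ x, HP c x → InB (T.erase j) y x →
        sm (T.erase j) (fl (mt c T y B) j (c l)) x + val (T.erase j) f0 x = val (T.erase j) a2 x)
    (o1 : ∃ p ∈ C, ∃ q ∈ C, ∃ k ∈ T.erase j, p j = l ∧ q j = c η ∧ q k = c (p k) ∧ p k ≠ a1 k ∧ p k ≠ c (a1 k)
      ∧ EqT ((T.erase j).erase k) p a1 ∧ EqT ((T.erase j).erase k) q a1)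
    (o2 : ∃ p ∈ C, p j = c η ∧ EqT (T.erase j) p a2) :
    B.card = 2 ∧ N4out c T A B C D := by
  obtain ⟨p, pC, q, qC, k, hk, pj, qj, qk, k1, k2, pw, qw⟩ := o1
  obtain ⟨r, rC, rj, ra⟩ := o2
  have nl : c η ≠ l := fun hh => η2 (by rw [← hh, hc.inv])
  have hpq : p ≠ q := fun hh => nl (by rw [← qj, ← hh, pj])
  have hC : C = {p, q} := by
    symm; apply Finset.eq_of_subset_of_card_le
    · intro z hz; simp at hz; rcases hz with rfl | rfl <;> assumption
    · rw [h2, Finset.card_pair hpq]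
  have hrq : r = q := by
    have := rC; rw [hC] at this; simp at this
    rcases this with hh | hh
    · exfalso; exact nl (by rw [← rj, hh, pj])
    · exact hh
  rw [hrq] at ra
  have qk2 := ra k hk
  have pk : p k = c (a2 k) := by rw [← qk2, qk, hc.inv]
  exact N4T_core hc h hA ha hC hpq hB2 hB hBD hj hk h1j h2j pj qj pk ra pw ((ra.symm.mono er_sub).trans qw)
    (fun hh => k2 (by rw [pk, hh])) (fun hh => k1 (by rw [pk, hh, hc.inv])) η1 η2 hy m1 m2 f0F f0j oth i1 i2

theorem N4T (hc : CI c) (h : Loc c T A B C D) (hA2 : A.card = 2) (hC2 : C.card = 2)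
    (hB2 : 2 ≤ B.card) (hB : B.card ≤ 3)
    (hR : ∃ x, ZO c x ∧ sm T A x = 1 ∧ sm T B x = 1 ∧ sm T C x = 0 ∧ sm T D x = 0) :
    B.card = 2 ∧ N4out c T A B C D := by
  have hcd := card_of h.id
  obtain ⟨x, hx, x1, x2, x3, x4⟩ := hR
  obtain ⟨y, y1, y2, y3⟩ := h.RY x hx x1 x2 x3 x4
  obtain ⟨a1, a2, ha, hA⟩ := Finset.card_eq_two.1 hA2
  have a1A : a1 ∈ A := by simp [hA]
  have a2A : a2 ∈ A := by simp [hA]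
  obtain ⟨j, hj, hd⟩ := h.cA a1 a1A a2 a2A ha
  obtain ⟨m1, m2, f0, f0F, f0j, oth, i1, i2⟩ := h.cl hc hA ha hB hj rfl hd hx x1 y1 y2 y3
  have n1 : y j ≠ a1 j := fun hh => m2 ⟨j, hj, by rw [hd, hh]⟩
  have n2 : y j ≠ c (a1 j) := fun hh => m1 ⟨j, hj, by rw [hh, hc.inv]⟩
  have K : ∀ a ∈ A, ∀ x, HP c x → InB T a x → x j (c (y j)) = 1 → sm T C x = 1 := by
    intro a haA z hz hza hzj
    apply le_antisymm (code_le hc h.cC hz)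
    have := ext01 hc ((MA_sm (T := T) (E := C)).sub (MA_const 1)) hz (by
      intro w hw hzw
      have e1 : sm T A w = 1 := code_box h.cA haA hw.hp (fun i hi => hzw _ _ (hza i hi))
      have id := h.id w hw.hp
      have wj := hzw _ _ hzj
      rcases zo_code h.cC hw with e3 | e3
      · exfalso
        have e24 : sm T B w = 1 ∧ sm T D w = 0 := by
          rcases zo_code h.cB hw with e2 | e2 <;> rcases zo_code h.cD hw with e4 | e4 <;>
          simp [e1, e2, e3, e4] at id ⊢ <;> norm_num at id
        obtain ⟨y', q1, q2, q3⟩ := h.RY w hw e1 e24.1 e3 e24.2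
        have := h.same hc hA ha hB hj rfl hd hx x1 y1 y2 y3 hw e1 q1 q2 q3
        have q4 := q1 j hj
        rw [this] at q4
        have := (hw j (y j)).1
        rw [wj, q4] at this; norm_num at this
      · rw [e3.1]; norm_num)
    linarith
  have o1 := CA1 hc h.cC h.tC hC2 hj n1 n2 rfl (fun z hz => h.AC a1 a1A z hz) (K a1 a1A)
  have n1' : y j ≠ c (a2 j) := by rw [hd, hc.inv]; exact n1
  have n2' : y j ≠ a2 j := by rw [hd]; exact n2
  have o2 := CA1 hc h.cC h.tC hC2 hj n2' n1' rfl (fun z hz => h.AC a2 a2A z hz) (K a2 a2A)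
  have hBD : B.card = D.card := by omega
  have f0m := (mt_mem.1 f0F).2
  rcases o1 with o1 | o1 <;> rcases o2 with o2 | o2
  · exfalso
    obtain ⟨p, pC, pj, pa⟩ := o1
    obtain ⟨q, qC, qj, qa⟩ := o2
    have hpq : p ≠ q := by
      rintro rfl
      exact h.tA a1 a1A a2 a2A j hj hd (pa.symm.trans qa)
    obtain ⟨i, hi, hdi⟩ := h.cC p pC q qC hpq
    have hij : i ≠ j := by
      rintro rfl
      rw [pj, qj] at hdi; exact hc.nf _ hdi.symm
    have hi' : i ∈ T.erase j := by simp [hij, hi]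
    have hdd : DT c (T.erase j) a1 a2 := ⟨i, hi', by rw [← pa i hi', ← qa i hi', hdi]⟩
    obtain ⟨q1, q2, q3⟩ := pt_spec hc (fun hd => f0m (hd.mono er_sub) : ¬ DT c (T.erase j) y f0)
    have v1 := i1 _ q1 q2
    have v2 := i2 _ q1 q2
    rw [val_one q3] at v1 v2
    have s1 := sm_nonneg (T := T.erase j) (E := fl (mt c T y B) j (a1 j)) q1
    have s2 := sm_nonneg (T := T.erase j) (E := fl (mt c T y B) j (c (a1 j))) q1
    have b1 := one_of_val q1 (by rw [← v1]; linarith : 1 ≤ val (T.erase j) a1 _)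
    have b2 := one_of_val q1 (by rw [← v2]; linarith : 1 ≤ val (T.erase j) a2 _)
    exact not_DT_of q1 b1 b2 hdd
  · have hA' : A = {a2, a1} := by rw [hA, Finset.pair_comm]
    have hd' : a1 j = c (a2 j) := by rw [hd, hc.inv]
    apply N4T_half (y := y) (f0 := f0) hc h hA' ha.symm hC2 hB2 hB hBD hj rfl hd' n2' n1' rfl m2 m1 f0F f0j
      ?_ ?_ ?_ o2 o1
    · intro f hf hn; have := oth f hf hn; rw [hd, hc.inv]; tauto
    · rw [hd]; exact i2
    · rw [← hd']; exact i1
  · exact N4T_half hc h hA ha hC2 hB2 hB hBD hj rfl hd n1 n2 rfl m1 m2 f0F f0j oth i1 i2 o1 o2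
  · exfalso
    obtain ⟨p, pC, q, qC, k, hk, pj, qj, -⟩ := o1
    obtain ⟨p', pC', q', qC', k', hk', pj', qj', -⟩ := o2
    have e1 : p ≠ q := by rintro rfl; rw [pj] at qj; exact n2 (by rw [qj, hc.inv])
    have e2 : p' ≠ q := by
      rintro rfl; rw [pj'] at qj; exact n1' (by rw [qj, hc.inv])
    have e3 : p ≠ p' := by rintro rfl; rw [pj, hd] at pj'; exact hc.nf _ pj'.symm
    have : ({p, p', q} : Finset (ι → S)) ⊆ C := by
      intro z hz; simp at hz; rcases hz with rfl | rfl | rfl <;> assumption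
    have := Finset.card_le_card this
    rw [Finset.card_eq_three.2 ⟨p, p', q, e3, e1, e2, rfl⟩] at this
    omega
end PB

namespace PB
open Finset Function
set_option linter.all false
variable {ι S : Type*} [Fintype ι] [DecidableEq ι] [DecidableEq S] {c : S → S}
  {T U : Finset ι} {E F A B C D M N : Finset (ι → S)} {x : ι → S → ℚ} {j k : ι} {e f g y t a : ι → S}
  {l s : S} {u : S → ℚ}


theorem letters3 (hc : CI c) {a1 a2 a3 b1 b2 b3 : S}
    (h12 : (a2 = c a1 ∧ b1 ≠ b2) ∨ (b2 = c b1 ∧ a1 ≠ a2))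
    (h13 : (a3 = c a1 ∧ b1 ≠ b3) ∨ (b3 = c b1 ∧ a1 ≠ a3))
    (h23 : (a3 = c a2 ∧ b2 ≠ b3) ∨ (b3 = c b2 ∧ a2 ≠ a3)) : False := by
  have i := hc.inv
  have n := hc.nf
  grind

theorem in_jk (hc : CI c) (hC : Code c T C) (hT : TF c T C) (hj : j ∈ T) (hk : k ∈ T.erase j)
    {w : ι → S} (hw : ∀ e ∈ C, EqT ((T.erase j).erase k) e w) : C.card ≤ 2 := by
  by_contra hlt
  have hkT := Finset.mem_of_mem_erase hk
  have hkj : k ≠ j := (Finset.mem_erase.1 hk).1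
  obtain ⟨D, hDC, hD⟩ := Finset.exists_subset_card_eq (by omega : 3 ≤ C.card)
  obtain ⟨a, b, d, hab, had, hbd, rfl⟩ := Finset.card_eq_three.1 hD
  have key : ∀ e ∈ C, ∀ f ∈ C, e ≠ f →
      (f j = c (e j) ∧ e k ≠ f k) ∨ (f k = c (e k) ∧ e j ≠ f j) := by
    intro e he f hf hef
    have hq : EqT ((T.erase j).erase k) e f := (hw e he).trans (hw f hf).symm
    obtain ⟨i, hi, hd⟩ := hC e he f hf hef
    by_cases h1 : i = j
    · subst h1; left; refine ⟨hd, fun hh => hT e he f hf i hi hd ?_⟩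
      exact hq.ext hh
    by_cases h2 : i = k
    · subst h2; right; refine ⟨hd, fun hh => hT e he f hf i hi hd ?_⟩
      rw [Finset.erase_right_comm] at hq
      exact hq.ext hh
    · exact absurd ⟨i, by simp [h1, h2, hi], hd⟩ (notDT_eq hc hq)
  have ha : a ∈ C := hDC (by simp)
  have hb : b ∈ C := hDC (by simp)
  have hd : d ∈ C := hDC (by simp)
  exact letters3 hc (key a ha b hb hab) (key a ha d hd had) (key b hb d hd hbd)

theorem sm4 (hc : CI c) (hj : j ∈ T) {w g : S} (h1 : g ≠ w) (h2 : g ≠ c w)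
    (h : ∀ e ∈ E, e j = w ∨ e j = c w ∨ e j = g ∨ e j = c g) (u : S → ℚ) :
    sm T E (update x j u) = u w * sm (T.erase j) (fl E j w) x + u (c w) * sm (T.erase j) (fl E j (c w)) x
      + u g * sm (T.erase j) (fl E j g) x + u (c g) * sm (T.erase j) (fl E j (c g)) x := by
  rw [sm_upd hj]
  simp only [sm, fl, Finset.sum_filter, Finset.mul_sum]
  rw [← Finset.sum_add_distrib, ← Finset.sum_add_distrib, ← Finset.sum_add_distrib]
  apply Finset.sum_congr rfl
  intro e he
  have n1 := hc.nf w
  have n2 := hc.nf g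
  have n3 : c g ≠ w := fun hh => h2 (by rw [← hh, hc.inv])
  have n4 : c g ≠ c w := fun hh => h1 (hc.inj hh)
  rcases h e he with hh | hh | hh | hh <;> simp [hh, h1, h2, n1, n2, n3, n4, n1.symm, n2.symm, n3.symm, n4.symm, h1.symm, h2.symm]

theorem dom1 (hc : CI c) (hD : Code c T D) (hT : TF c T D) (h4 : D.card ≤ 4) (hap : Apart T C D)
    (h : ∀ x, HP c x → sm T C x ≤ sm T D x) : C = ∅ := by
  apply empty_of
  intro e he
  have := domL hc hD hT (e := e) (fun d hd hh => hap e he d hd hh.symm)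
    (fun x hx => (val_le_sm hx he).trans (h x hx))
  omega

theorem four (hc : CI c) {P Q R X : Finset (ι → S)} (hX : Code c T X) (tX : TF c T X) (h4 : X.card ≤ 4)
    (h1 : Apart T Q X) (h2 : Apart T R X)
    (h : ∀ x, HP c x → sm T P x + sm T X x = sm T Q x + sm T R x) (hP : P = ∅) : Q = ∅ ∧ R = ∅ ∧ X = ∅ := by
  subst hP
  have q : Q = ∅ := dom1 hc hX tX h4 h1 (fun x hx => by
    have := h x hx; have := sm_nonneg (T := T) (E := R) hx; simp at *; linarith)
  have r : R = ∅ := dom1 hc hX tX h4 h2 (fun x hx => by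
    have := h x hx; have := sm_nonneg (T := T) (E := Q) hx; simp at *; linarith)
  refine ⟨q, r, ?_⟩
  have := card_of h
  rw [q, r] at this; simpa using this

/-- letters at t -/
theorem Xt (hc : CI c) (cC : Code c T C) (cD : Code c T D) (tC : TF c T C) (tD : TF c T D)
    (ap : Apart T C D) (hC3 : C.card = 3) (hD3 : D.card = 3) {θ τ : ι → S} {t : ι} (ht : t ∈ T)
    (hj : j ∈ T.erase t) (hk : k ∈ T.erase t) (hjk : j ≠ k) (q1 : τ j ≠ θ j) (q2 : τ k ≠ θ k)
    (hw : τ t = θ t) (id : ∀ x, HP c x → sm T D x + val T τ x = sm T C x + val T θ x) :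
    ∀ e ∈ C ∪ D, e t = θ t := by
  have sl : ∀ g, g ≠ θ t → g ≠ c (θ t) → ∀ x, HP c x →
      sm (T.erase t) (fl D t g) x + sm (T.erase t) (fl C t (c g)) x =
      sm (T.erase t) (fl C t g) x + sm (T.erase t) (fl D t (c g)) x := by
    intro g g1 g2 x hx
    have := S1 (T0 := ∅) (y := θ) (A := D) (D := {τ}) (B := C) (C := {θ}) (l := g) hc ht (by simp) (fun x hx _ => by
      rw [sm_single, sm_single]; exact id x hx) x hx (by intro i hi; simp at hi)
    have n3 : θ t ≠ c g := fun hh => g2 (by rw [hh, hc.inv])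
    rw [fl_single_ne (e := τ) (by rw [hw]; exact g1.symm), fl_single_ne (e := θ) g1.symm,
      fl_single_ne (e := τ) (by rw [hw]; exact n3), fl_single_ne (e := θ) n3] at this
    simp at this; linarith
  have cle : ∀ (E : Finset (ι → S)) g, (fl E t g).card ≤ E.card := fun E g => Finset.card_le_card fl_sub
  have all : ∀ g, g ≠ θ t → g ≠ c (θ t) → (∃ e ∈ C ∪ D, e t = g) →
      (fl D t g).Nonempty ∧ (fl C t g).Nonempty ∧ (fl D t (c g)).Nonempty ∧ (fl C t (c g)).Nonempty := by
    intro g g1 g2 ⟨e, he, eg⟩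
    have h := sl g g1 g2
    simp only [Finset.nonempty_iff_ne_empty]
    have apg : ∀ l, Apart (T.erase t) (fl C t l) (fl D t l) := fun l => ap.fl
    have aC : Apart (T.erase t) (fl C t g) (fl C t (c g)) := tC.apart ht
    have aD : Apart (T.erase t) (fl D t g) (fl D t (c g)) := tD.apart ht
    have k1 := four hc (P := fl D t g) (X := fl C t (c g)) (cC.fl hc) tC.fl (by have := cle C (c g); omega)
      aC (apg _).symm h
    have k2 := four hc (P := fl C t (c g)) (X := fl D t g) (cD.fl hc) tD.fl (by have := cle D g; omega)
      (apg _) aD.symm (fun x hx => by have := h x hx; linarith)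
    have k3 := four hc (P := fl C t g) (X := fl D t (c g)) (cD.fl hc) tD.fl (by have := cle D (c g); omega)
      aD (apg _) (fun x hx => by have := h x hx; linarith)
    have k4 := four hc (P := fl D t (c g)) (X := fl C t g) (cC.fl hc) tC.fl (by have := cle C g; omega)
      (apg _).symm aC.symm (fun x hx => by have := h x hx; linarith)
    have : fl C t g ≠ ∅ ∨ fl D t g ≠ ∅ := by
      rcases Finset.mem_union.1 he with he | he
      · left; exact Finset.ne_empty_of_mem (fl_mem.2 ⟨he, eg⟩)
      · right; exact Finset.ne_empty_of_mem (fl_mem.2 ⟨he, eg⟩)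
    tauto
  -- no other letters
  have nog : ∀ g, g ≠ θ t → g ≠ c (θ t) → ¬ (∃ e ∈ C ∪ D, e t = g) := by
    intro g g1 g2 hg
    have al := all g g1 g2 hg
    obtain ⟨n1, n2, n3, n4⟩ := al
    have three : ∀ E : Finset (ι → S), E.card = 3 → E ⊆ C ∪ D →
        (∀ g', (∃ e ∈ C ∪ D, e t = g') → g' ≠ θ t → g' ≠ c (θ t) → (fl E t g').Nonempty ∧ (fl E t (c g')).Nonempty) →
        ∀ e ∈ E, e t = θ t ∨ e t = c (θ t) ∨ e t = g ∨ e t = c g := by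
      intro E hE hs hh e he
      by_contra hcon
      push Not at hcon
      obtain ⟨p1, p2, p3, p4⟩ := hcon
      obtain ⟨⟨d1, h1⟩, ⟨d2, h2⟩⟩ := hh g hg g1 g2
      obtain ⟨_, ⟨d4, h4⟩⟩ := hh (e t) ⟨e, hs he, rfl⟩ p1 p2
      rw [fl_mem] at h1 h2 h4
      have s : ({d1, d2, e, d4} : Finset (ι → S)) ⊆ E := by
        intro z hz; simp at hz; rcases hz with rfl | rfl | rfl | rfl
        exacts [h1.1, h2.1, he, h4.1]
      have := Finset.card_le_card s
      have e12 : d1 ≠ d2 := by rintro rfl; exact hc.nf g (by rw [← h2.2, h1.2])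
      have e1e : d1 ≠ e := by rintro rfl; exact p3 h1.2
      have e2e : d2 ≠ e := by rintro rfl; exact p4 h2.2
      have e14 : d1 ≠ d4 := by rintro rfl; exact p4 (by rw [← h1.2, h4.2, hc.inv])
      have e24 : d2 ≠ d4 := by rintro rfl; exact p3 (hc.inj (by rw [← h2.2, h4.2]))
      have ee4 : e ≠ d4 := by rintro rfl; exact hc.nf _ h4.2.symm
      rw [Finset.card_insert_of_notMem (by simp [e12, e1e, e14]), Finset.card_insert_of_notMem (by simp [e2e, e24]),
        Finset.card_pair ee4] at this
      omega
    have tD' := three D hD3 Finset.subset_union_right (fun g' h1 h2 h3 => ⟨(all g' h2 h3 h1).1, (all g' h2 h3 h1).2.2.1⟩)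
    have tC' := three C hC3 Finset.subset_union_left (fun g' h1 h2 h3 => ⟨(all g' h2 h3 h1).2.1, (all g' h2 h3 h1).2.2.2⟩)
    have eval : ∀ l1 l2, l2 ≠ c l1 → ∀ x, HP c x → _ := fun l1 l2 hl x hx =>
      id _ (HP_upd (j := t) hx (mk_HU hc (ok2 hc hl)))
    simp only [sm4 hc ht g1 g2 tD', sm4 hc ht g1 g2 tC', val_upd' ht, hw] at eval
    have cg1 : c g ≠ θ t := fun hh => g2 (by rw [← hh, hc.inv])
    have cg2 : c g ≠ c (θ t) := fun hh => g1 (hc.inj hh)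
    have zer : ∀ l1 l2, l2 ≠ c l1 → ∀ s, c s = l1 ∨ c s = l2 → mk c [l1, l2] s = 0 := by
      intro l1 l2 hl s hs; exact mk_zero hc (ok2 hc hl) (by simp; exact hs)
    have one : ∀ l1 l2 s, s = l1 ∨ s = l2 → mk c [l1, l2] s = 1 := by
      intro l1 l2 s hs; exact mk_one (by simp; exact hs)
    have i := hc.inv
    have ev1 : ∀ g', g' ≠ θ t → g' ≠ c (θ t) → (g' = g ∨ g' = c g) → ∀ x, HP c x →
        sm (T.erase t) (fl D t (c (θ t))) x + sm (T.erase t) (fl D t g') x =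
        sm (T.erase t) (fl C t (c (θ t))) x + sm (T.erase t) (fl C t g') x := by
      intro g' p1 p2 p3 x hx
      have hl : g' ≠ c (c (θ t)) := by rw [i]; exact p1
      have := eval (c (θ t)) g' hl x hx
      rw [zer _ _ hl (θ t) (by simp), one _ _ (c (θ t)) (by simp)] at this
      rcases p3 with rfl | rfl
      · rw [one _ _ g' (by simp), zer _ _ hl (c g') (by simp [i])] at this
        linarith
      · rw [one _ _ (c g) (by simp), zer _ _ hl g (by simp [i])] at this
        linarith
    have ev2 : ∀ g', g' ≠ θ t → g' ≠ c (θ t) → (g' = g ∨ g' = c g) → ∀ x, HP c x →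
        sm (T.erase t) (fl D t (θ t)) x + sm (T.erase t) (fl D t g') x + val (T.erase t) τ x =
        sm (T.erase t) (fl C t (θ t)) x + sm (T.erase t) (fl C t g') x + val (T.erase t) θ x := by
      intro g' p1 p2 p3 x hx
      have := eval (θ t) g' p2 x hx
      rw [one _ _ (θ t) (by simp), zer _ _ p2 (c (θ t)) (by simp [i])] at this
      rcases p3 with rfl | rfl
      · rw [one _ _ g' (by simp), zer _ _ p2 (c g') (by simp [i])] at this
        linarith
      · rw [one _ _ (c g) (by simp), zer _ _ p2 g (by simp [i])] at this
        linarith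
    have eD : fl D t (c (θ t)) ≠ ∅ := by
      intro he
      have := dom1 hc (cD.fl hc) tD.fl (by have := cle D g; omega) (ap.fl (j := t) (l := g)) (fun x hx => by
        have h1 := ev1 g g1 g2 (Or.inl rfl) x hx
        have h2 := sm_nonneg (T := T.erase t) (E := fl C t (c (θ t))) hx
        rw [he] at h1; simp at h1; linarith)
      exact Finset.nonempty_iff_ne_empty.1 n2 this
    have eC : fl C t (c (θ t)) ≠ ∅ := by
      intro he
      have := dom1 hc (cC.fl hc) tC.fl (by have := cle C g; omega) (ap.fl (j := t) (l := g)).symm (fun x hx => by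
        have h1 := ev1 g g1 g2 (Or.inl rfl) x hx
        have h2 := sm_nonneg (T := T.erase t) (E := fl D t (c (θ t))) hx
        rw [he] at h1; simp at h1; linarith)
      exact Finset.nonempty_iff_ne_empty.1 n1 this
    have cards : ∀ E : Finset (ι → S), E.card = 3 → (fl E t g).Nonempty → (fl E t (c g)).Nonempty →
        fl E t (c (θ t)) ≠ ∅ → fl E t (θ t) = ∅ ∧ (fl E t g).card = 1 ∧ (fl E t (c g)).card = 1 := by
      intro E h3 hg hcg hcw
      have p1 := Finset.card_pos.2 hg
      have p2 := Finset.card_pos.2 hcg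
      have p3 := Finset.card_pos.2 (Finset.nonempty_iff_ne_empty.2 hcw)
      have hs : fl E t (θ t) ∪ fl E t (c (θ t)) ∪ (fl E t g ∪ fl E t (c g)) ⊆ E :=
        Finset.union_subset (Finset.union_subset fl_sub fl_sub) (Finset.union_subset fl_sub fl_sub)
      have := Finset.card_le_card hs
      rw [Finset.card_union_of_disjoint, Finset.card_union_of_disjoint (fl_disj (hc.nf _).symm),
        Finset.card_union_of_disjoint (fl_disj (hc.nf _).symm)] at this
      · refine ⟨Finset.card_eq_zero.1 ?_, ?_, ?_⟩ <;> omega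
      · rw [Finset.disjoint_union_left, Finset.disjoint_union_right, Finset.disjoint_union_right]
        exact ⟨⟨fl_disj g1.symm, fl_disj cg1.symm⟩, fl_disj g2.symm, fl_disj cg2.symm⟩
    obtain ⟨D0, D1, D2⟩ := cards D hD3 n1 n3 eD
    obtain ⟨C0, C1, C2⟩ := cards C hC3 n2 n4 eC
    have fin : ∀ g', g' ≠ θ t → g' ≠ c (θ t) → (g' = g ∨ g' = c g) → (fl D t g').card = 1 →
        (fl C t g').card = 1 → ∃ d ∈ D, d t = g' ∧ EqT (T.erase t) θ d := by
      intro g' p1 p2 p3 d1 d2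
      obtain ⟨d, hd⟩ := Finset.card_eq_one.1 d1
      obtain ⟨e, he⟩ := Finset.card_eq_one.1 d2
      have hdm : d ∈ fl D t g' := by simp [hd]
      refine ⟨d, (fl_mem.1 hdm).1, (fl_mem.1 hdm).2, ?_⟩
      apply twotwo hc (f := e) (g := τ) hj hk hjk q1 q2
      intro x hx
      have := ev2 g' p1 p2 p3 x hx
      rw [D0, C0, hd, he] at this
      simp only [sm_empty, sm_single] at this
      linarith
    obtain ⟨d, dD, dt, de⟩ := fin g g1 g2 (Or.inl rfl) D1 C1
    obtain ⟨d', dD', dt', de'⟩ := fin (c g) cg1 cg2 (Or.inr rfl) D2 C2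
    exact tD d dD d' dD' t ht (by rw [dt', dt]) (de.symm.trans de')
  -- only two letters
  have two : ∀ e ∈ C ∪ D, e t = θ t ∨ e t = c (θ t) := by
    intro e he
    by_contra hcon
    push Not at hcon
    exact nog (e t) hcon.1 hcon.2 ⟨e, he, rfl⟩
  have ev : ∀ (E : Finset (ι → S)) x, E ⊆ C ∪ D → HP c x → sm T E (update x t (mk c [c (θ t)])) =
      sm (T.erase t) (fl E t (c (θ t))) x := by
    intro E x hE hx
    rw [sm_upd ht]
    simp only [sm, fl, Finset.sum_filter]
    apply Finset.sum_congr rfl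
    intro e he
    rcases two e (hE he) with hh | hh
    · rw [hh, mk_zero hc (ok1 hc) (by simp)]; simp [(hc.nf (θ t)).symm]
    · rw [hh, mk_one (by simp)]; simp
  have idc : ∀ x, HP c x → sm (T.erase t) (fl C t (c (θ t))) x = sm (T.erase t) (fl D t (c (θ t))) x := by
    intro x hx
    have := id _ (HP_upd (j := t) hx (mk_HU hc (ok1 hc (a := c (θ t)))))
    rw [ev D x Finset.subset_union_right hx, ev C x Finset.subset_union_left hx, val_upd' ht, val_upd' ht, hw,
      mk_zero hc (ok1 hc) (by simp)] at this
    linarith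
  have c0 : fl C t (c (θ t)) = ∅ := by
    by_contra hne
    have := agree hc (cC.fl hc) (cD.fl hc) tD.fl ap.fl idc (Finset.nonempty_iff_ne_empty.2 hne)
    have := cle D (c (θ t)); omega
  have d0 : fl D t (c (θ t)) = ∅ := by
    have := card_of2 idc
    rw [c0] at this; simpa using this.symm
  intro e he
  rcases two e he with hh | hh
  · exact hh
  · exfalso
    rcases Finset.mem_union.1 he with he | he
    · have : e ∈ fl C t (c (θ t)) := fl_mem.2 ⟨he, hh⟩
      rw [c0] at this; simp at this
    · have : e ∈ fl D t (c (θ t)) := fl_mem.2 ⟨he, hh⟩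
      rw [d0] at this; simp at this
end PB

namespace PB
open Finset Function
set_option linter.all false
variable {ι S : Type*} [Fintype ι] [DecidableEq ι] [DecidableEq S] {c : S → S}
  {T U : Finset ι} {E F A B C D M N : Finset (ι → S)} {x : ι → S → ℚ} {j k : ι} {e f g y t a : ι → S}
  {l s : S} {u : S → ℚ}


theorem X_half (hc : CI c) (h : Loc c T A B C D) {a1 a2 f0 : ι → S}
    (hA : A = {a1, a2}) (ha : a1 ≠ a2) (hB2 : B.card = 2) (hC3 : C.card = 3) (hD3 : D.card = 3)
    (hj : j ∈ T) (h1j : a1 j = l) (h2j : a2 j = c l)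
    (m1 : ¬ DT c T y a1) (m2 : ¬ DT c T y a2)
    (f0F : f0 ∈ mt c T y B) (f0j : f0 j = y j)
    (oth : ∀ f ∈ mt c T y B, f ≠ f0 → f j = l ∨ f j = c l)
    (i1 : ∀ x, HP c x → InB (T.erase j) y x →
        sm (T.erase j) (fl (mt c T y B) j l) x + val (T.erase j) f0 x = val (T.erase j) a1 x)
    (i2 : ∀ x, HP c x → InB (T.erase j) y x →
        sm (T.erase j) (fl (mt c T y B) j (c l)) x + val (T.erase j) f0 x = val (T.erase j) a2 x)
    (hl0 : fl (mt c T y B) j l = ∅) : False := by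
  have a1A : a1 ∈ A := by simp [hA]
  have a2A : a2 ∈ A := by simp [hA]
  have n1 : y j ≠ l := fun hh => m2 ⟨j, hj, by rw [h2j, hh]⟩
  have n2 : y j ≠ c l := fun hh => m1 ⟨j, hj, by rw [hh, hc.inv, h1j]⟩
  have mf0 : ¬ DT c (T.erase j) y f0 := fun hd => (mt_mem.1 f0F).2 (hd.mono er_sub)
  have m1' : ¬ DT c (T.erase j) y a1 := fun hd => m1 (hd.mono er_sub)
  have m2' : ¬ DT c (T.erase j) y a2 := fun hd => m2 (hd.mono er_sub)
  simp only [hl0, sm_empty, zero_add] at i1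
  have q1 := eqL hc mf0 m1' i1
  have hne : fl (mt c T y B) j (c l) ≠ ∅ := by
    intro hh
    simp only [hh, sm_empty, zero_add] at i2
    exact h.tA a1 a1A a2 a2A j hj (by rw [h2j, h1j]) (q1.symm.trans (eqL hc mf0 m2' i2))
  obtain ⟨f, hf⟩ := Finset.nonempty_iff_ne_empty.2 hne
  have hf' := fl_mem.1 hf
  have hff : f0 ≠ f := by rintro rfl; exact n2 (by rw [← f0j, hf'.2])
  have hBe : B = {f0, f} := by
    symm; apply Finset.eq_of_subset_of_card_le
    · intro z hz; simp at hz; rcases hz with rfl | rfl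
      exacts [mt_sub f0F, mt_sub hf'.1]
    · rw [hB2, Finset.card_pair hff]
  have hs : fl (mt c T y B) j (c l) = {f} := by
    apply Finset.eq_singleton_iff_unique_mem.2 ⟨hf, ?_⟩
    intro z hz
    have hz' := fl_mem.1 hz
    have : z ∈ B := mt_sub hz'.1
    rw [hBe] at this; simp at this
    rcases this with rfl | rfl
    · exact absurd (by rw [← f0j, hz'.2]) n2
    · rfl
  simp only [hs, sm_single] at i2
  obtain ⟨k, hk, yk, f0k, fk1, fk2, fw, f0w⟩ := split2 hc hff.symm m2'
    (fun hd => (mt_mem.1 hf'.1).2 (hd.mono er_sub)) mf0 i2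
  have hkT := Finset.mem_of_mem_erase hk
  have hkj : k ≠ j := (Finset.mem_erase.1 hk).1
  have fk : f k = c (a1 k) := by rw [← q1 k hk, f0k, hc.inv]
  have a1w : EqT ((T.erase j).erase k) a1 a2 := (q1.symm.mono er_sub).trans f0w
  obtain ⟨τ, τj, τk, τw⟩ := mkw hk a2 (c (y j)) (a1 k)
  obtain ⟨θ, θj, θk, θw⟩ := mkw hk a2 (c l) (c (a2 k))
  have self : EqT ((T.erase j).erase k) a2 a2 := fun _ _ => rfl
  have id : ∀ x, HP c x → sm T D x + val T τ x = sm T C x + val T θ x := by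
    intro x hx
    have := h.id x hx
    rw [hA, hBe, sm_pair ha, sm_pair hff, val_jk hj hk f0w, val_jk hj hk fw, val_jk hj hk self,
      val_jk hj hk a1w, h1j, h2j, f0j, hf'.2, q1 k hk, fk, (hx j l).1, (hx k _).1] at this
    rw [val_jk hj hk τw, val_jk hj hk θw, τj, τk, θj, θk, (hx j l).1, (hx j _).1, (hx k (a2 k)).1]
    linarith
  have hall : ∀ e ∈ C, EqT ((T.erase j).erase k) e a2 := by
    intro e he t ht
    have ht' := Finset.mem_erase.1 ht
    have ht'' := Finset.mem_erase.1 ht'.2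
    rw [← θw t ht]
    apply Xt (j := j) (k := k) hc h.cC h.cD h.tC h.tD h.CD hC3 hD3 ht''.2 (by simp [hj, Ne.symm ht''.1])
      (by simp [hkT, Ne.symm ht'.1]) hkj.symm (by rw [τj, θj]; exact fun hh => n1 (hc.inj hh))
      (by rw [τk, θk]; intro hh; exact fk1 (by rw [fk, hh, hc.inv])) ((τw t ht).trans (θw t ht).symm) id e
      (Finset.mem_union_left _ he)
  have := in_jk hc h.cC h.tC hj hk hall
  omega

theorem X_no (hc : CI c) (h : Loc c T A B C D) (hA2 : A.card = 2) (hB2 : B.card = 2) (hC3 : C.card = 3)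
    (hD3 : D.card = 3)
    (hR : ∃ x, ZO c x ∧ sm T A x = 1 ∧ sm T B x = 1 ∧ sm T C x = 0 ∧ sm T D x = 0) : False := by
  obtain ⟨x, hx, x1, x2, x3, x4⟩ := hR
  obtain ⟨y, y1, y2, y3⟩ := h.RY x hx x1 x2 x3 x4
  obtain ⟨a1, a2, ha, hA⟩ := Finset.card_eq_two.1 hA2
  have a1A : a1 ∈ A := by simp [hA]
  have a2A : a2 ∈ A := by simp [hA]
  obtain ⟨j, hj, hd⟩ := h.cA a1 a1A a2 a2A ha
  obtain ⟨m1, m2, f0, f0F, f0j, oth, i1, i2⟩ := h.cl hc hA ha (by omega) hj rfl hd hx x1 y1 y2 y3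
  have n1 : y j ≠ a1 j := fun hh => m2 ⟨j, hj, by rw [hd, hh]⟩
  have n2 : y j ≠ c (a1 j) := fun hh => m1 ⟨j, hj, by rw [hh, hc.inv]⟩
  by_cases e1 : fl (mt c T y B) j (a1 j) = ∅
  · exact X_half hc h hA ha hB2 hC3 hD3 hj rfl hd m1 m2 f0F f0j oth i1 i2 e1
  have hd' : a1 j = c (a2 j) := by rw [hd, hc.inv]
  by_cases e2 : fl (mt c T y B) j (c (a1 j)) = ∅
  · refine X_half (y := y) (f0 := f0) hc h (by rw [hA, Finset.pair_comm]) ha.symm hB2 hC3 hD3 hj rfl hd' m2 m1 f0F f0j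
      ?_ ?_ ?_ ?_
    · intro f hf hn; have := oth f hf hn; rw [hd, hc.inv]; tauto
    · rw [hd]; exact i2
    · rw [← hd']; exact i1
    · rw [hd]; exact e2
  obtain ⟨f, hf⟩ := Finset.nonempty_iff_ne_empty.2 e1
  obtain ⟨g, hg⟩ := Finset.nonempty_iff_ne_empty.2 e2
  rw [fl_mem] at hf hg
  have : ({f0, f, g} : Finset (ι → S)) ⊆ B := by
    intro z hz; simp at hz; rcases hz with rfl | rfl | rfl
    exacts [mt_sub f0F, mt_sub hf.1, mt_sub hg.1]
  have := Finset.card_le_card this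
  rw [Finset.card_eq_three.2 ⟨f0, f, g, ?_, ?_, ?_, rfl⟩] at this
  · omega
  · rintro rfl; exact n1 (by rw [← f0j, hf.2])
  · rintro rfl; exact n2 (by rw [← f0j, hg.2])
  · rintro rfl; exact hc.nf (a1 j) (by rw [← hg.2, hf.2])

theorem F1 (hc : CI c) (h : Loc c T A B C D) (hn : A.card + D.card ≤ 5)
    (hne : ¬ (A = ∅ ∧ B = ∅ ∧ C = ∅ ∧ D = ∅)) :
    A.card = 2 ∧ B.card = 2 ∧ C.card = 2 ∧ D.card = 2 ∧ N4out c T A B C D := by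
  have hcd := card_of h.id
  obtain ⟨⟨p1, p2, p3, p4⟩, hR⟩ := SZ hc h hn hne
  obtain ⟨-, hR'⟩ := SZ hc h.sV (by omega) (by tauto)
  obtain ⟨-, hR''⟩ := SZ hc h.sP (by omega) (by tauto)
  by_cases c1 : A.card = 2 ∧ C.card = 2
  · have := N4T hc h c1.1 c1.2 p2 (by omega) hR
    exact ⟨c1.1, this.1, c1.2, by omega, this.2⟩
  by_cases c2 : B.card = 2 ∧ D.card = 2
  · have := N4T hc h.sP c2.1 c2.2 p1 (by omega) hR''
    omega
  by_cases c3 : A.card = 2 ∧ B.card = 2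
  · exact (X_no hc h c3.1 c3.2 (by omega) (by omega) hR).elim
  · exact (X_no hc h.sV (by omega) (by omega) (by omega) (by omega) hR').elim
end PB

namespace PB
open Finset Function
set_option linter.all false
variable {ι S : Type*} [Fintype ι] [DecidableEq ι] [DecidableEq S] {c : S → S}
  {T U : Finset ι} {E F A B C D M N : Finset (ι → S)} {x : ι → S → ℚ} {j k : ι} {e f g y t a : ι → S}
  {l s : S} {u : S → ℚ}


structure Gl (c : S → S) (V W : Finset (ι → S)) : Prop where
  cV : Code c univ V
  cW : Code c univ W
  tV : TF c univ V
  tW : TF c univ W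
  dis : Disjoint V W
  eq : ∀ x, HP c x → sm univ V x = sm univ W x
  le : V.card ≤ 16

theorem EqT.full (h : EqT univ e f) : e = f := funext fun i => h i (mem_univ i)

variable {V W : Finset (ι → S)} {i : ι}

theorem Gl.symm (h : Gl c V W) : Gl c W V :=
  ⟨h.cW, h.cV, h.tW, h.tV, h.dis.symm, fun x hx => (h.eq x hx).symm, by rw [← card_of2 h.eq]; exact h.le⟩

theorem Gl.ap (h : Gl c V W) : Apart univ V W := by
  intro e he f hf hh
  rw [hh.full] at he
  exact Finset.disjoint_left.1 h.dis he hf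

theorem Gl.RYaux (hc : CI c) (h : Gl c V W) (p : S) : ∀ x, ZO c x → sm (univ.erase i) (fl V i p) x = 1 →
    sm (univ.erase i) (fl V i (c p)) x = 1 → sm (univ.erase i) (fl W i p) x = 0 →
    sm (univ.erase i) (fl W i (c p)) x = 0 →
    ∃ y, InB (univ.erase i) y x ∧ (∀ e ∈ fl W i p, DT c (univ.erase i) y e) ∧
      (∀ e ∈ fl W i (c p), DT c (univ.erase i) y e) := by
  intro x hx x1 x2 x3 x4
  obtain ⟨u, hu⟩ := base_zo hc
  have hx' : ZO c (update x i u) := by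
    intro t
    by_cases ht : t = i
    · subst ht; rw [update_self]; exact hu
    · rw [update_of_ne ht]; exact hx t
  have getw : ∀ (E : Finset (ι → S)) l, Code c univ E → sm (univ.erase i) (fl E i l) x = 1 →
      ∃ e ∈ E, e i = l ∧ InB (univ.erase i) e x := by
    intro E l hE h1
    rcases zo_code (hE.fl hc) hx with h0 | ⟨-, e, he, hb⟩
    · rw [h1] at h0; norm_num at h0
    · exact ⟨e, (fl_mem.1 he).1, (fl_mem.1 he).2, hb⟩
  obtain ⟨a, aV, ai, ab⟩ := getw V p h.cV x1
  obtain ⟨b, bV, bi, bb⟩ := getw V (c p) h.cV x2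
  have hV : sm univ V (update x i u) = 1 := by
    rcases (hu p).2 with h0 | h1
    · apply code_box h.cV bV hx'.hp
      exact InB_upd bb (fun _ => by rw [bi, (hu p).1, h0]; norm_num)
    · apply code_box h.cV aV hx'.hp
      exact InB_upd ab (fun _ => by rw [ai, h1])
  rw [h.eq _ hx'.hp] at hV
  rcases zo_code h.cW hx' with h0 | ⟨-, y, yW, yb⟩
  · rw [hV] at h0; norm_num at h0
  have yb' : InB (univ.erase i) y x := by
    intro t ht
    have := yb t (mem_univ t)
    rwa [update_of_ne (Finset.mem_erase.1 ht).1] at this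
  have no : ∀ l, sm (univ.erase i) (fl W i l) x = 0 → y i ≠ l := by
    intro l hl hy
    have := val_le_sm (T := univ.erase i) hx.hp (fl_mem.2 ⟨yW, hy⟩ : y ∈ fl W i l)
    rw [val_one yb', hl] at this; norm_num at this
  have n1 := no p x3
  have n2 := no (c p) x4
  refine ⟨y, yb', ?_, ?_⟩
  · intro e he
    rw [fl_mem] at he
    obtain ⟨t, ht, hd⟩ := h.cW y yW e he.1 (by rintro rfl; exact n1 he.2)
    refine ⟨t, ?_, hd⟩
    simp; rintro rfl; rw [he.2] at hd; exact n2 (by rw [hd, hc.inv])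
  · intro e he
    rw [fl_mem] at he
    obtain ⟨t, ht, hd⟩ := h.cW y yW e he.1 (by rintro rfl; exact n2 he.2)
    refine ⟨t, ?_, hd⟩
    simp; rintro rfl; rw [he.2] at hd; exact n1 (hc.inj hd).symm

theorem Gl.loc (hc : CI c) (h : Gl c V W) (i : ι) (p : S) :
    Loc c (univ.erase i) (fl V i p) (fl V i (c p)) (fl W i p) (fl W i (c p)) where
  cA := h.cV.fl hc
  cB := h.cV.fl hc
  cC := h.cW.fl hc
  cD := h.cW.fl hc
  tA := h.tV.fl
  tB := h.tV.fl
  tC := h.tW.fl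
  tD := h.tW.fl
  AB := h.tV.apart (mem_univ i)
  AC := h.ap.fl
  BD := h.ap.fl
  CD := h.tW.apart (mem_univ i)
  dBC := fl_disj (hc.nf p)
  dAD := fl_disj (hc.nf p).symm
  id := fun x hx => by have := sl2 hc (mem_univ i) h.eq p x hx; linarith
  RY := h.RYaux hc p
  RZ := h.symm.RYaux hc p

/-- number attached to a letter -/
def nn (c : S → S) (V W : Finset (ι → S)) (i : ι) (u : S) : ℕ := (fl V i u).card + (fl W i (c u)).card
def nn' (c : S → S) (V W : Finset (ι → S)) (i : ι) (u : S) : ℕ := (fl V i (c u)).card + (fl W i u).card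

def occ (c : S → S) (V W : Finset (ι → S)) (i : ι) (u : S) : Prop :=
  ∃ e ∈ V ∪ W, e i = u ∨ e i = c u

theorem Gl.nneq (hc : CI c) (h : Gl c V W) (u : S) : nn c V W i u = nn' c V W i u := card_of (h.loc hc i u).id

theorem Gl.F1 (hc : CI c) (h : Gl c V W) (ho : occ c V W i s) (hn : nn c V W i s ≤ 5) :
    (fl V i s).card = 2 ∧ (fl V i (c s)).card = 2 ∧ (fl W i s).card = 2 ∧ (fl W i (c s)).card = 2 ∧
    N4out c (univ.erase i) (fl V i s) (fl V i (c s)) (fl W i s) (fl W i (c s)) := by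
  apply PB.F1 hc (h.loc hc i s) hn
  rintro ⟨h1, h2, h3, h4⟩
  obtain ⟨e, he, hh⟩ := ho
  rcases Finset.mem_union.1 he with he | he <;> rcases hh with hh | hh
  · have := fl_mem.2 ⟨he, hh⟩; rw [h1] at this; simp at this
  · have := fl_mem.2 ⟨he, hh⟩; rw [h2] at this; simp at this
  · have := fl_mem.2 ⟨he, hh⟩; rw [h3] at this; simp at this
  · have := fl_mem.2 ⟨he, hh⟩; rw [h4] at this; simp at this

theorem Gl.n46 (hc : CI c) (h : Gl c V W) (ho : occ c V W i s) : nn c V W i s = 4 ∨ 6 ≤ nn c V W i s := by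
  by_cases hn : nn c V W i s ≤ 5
  · obtain ⟨h1, h2, h3, h4, -⟩ := h.F1 hc ho hn
    left; unfold nn; omega
  · right; omega

def six (L : List S) (i : ι) (E : Finset (ι → S)) : Finset (ι → S) := E.filter (fun e => e i ∈ L)

theorem sum_fl (hc : CI c) : ∀ L : List S, L.Nodup → ∀ E : Finset (ι → S),
    (L.map (fun l => (fl E i l).card)).sum ≤ E.card := by
  intro L hL E
  induction L generalizing E with
  | nil => simp
  | cons a L ih =>
    have hL' := List.nodup_cons.1 hL
    have h1 := ih hL'.2 (E.filter (fun e => e i ≠ a))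
    have h2 : ∀ l ∈ L, fl (E.filter (fun e => e i ≠ a)) i l = fl E i l := by
      intro l hl
      ext e
      simp only [fl, Finset.mem_filter]
      constructor
      · rintro ⟨⟨p, q⟩, r⟩; exact ⟨p, r⟩
      · rintro ⟨p, r⟩; refine ⟨⟨p, ?_⟩, r⟩; rw [r]; rintro rfl; exact hL'.1 hl
    rw [List.map_congr_left (fun l hl => by rw [h2 l hl] : ∀ l ∈ L, (fl (E.filter (fun e => e i ≠ a)) i l).card = (fl E i l).card)] at h1
    have h3 : (fl E i a).card + (E.filter (fun e => e i ≠ a)).card = E.card :=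
      Finset.card_filter_add_card_filter_not (fun e : ι → S => e i = a)
    simp only [List.map_cons, List.sum_cons]
    omega

def dif (c : S → S) (a b : S) : Prop := a ≠ b ∧ a ≠ c b

theorem dif.symm (hc : CI c) {a b : S} (h : dif c a b) : dif c b a :=
  ⟨h.1.symm, fun hh => h.2 (by rw [hh, hc.inv])⟩
theorem dif.cl (hc : CI c) {a b : S} (h : dif c a b) : dif c (c a) b :=
  ⟨fun hh => h.2 (by rw [← hh, hc.inv]), fun hh => h.1 (hc.inj hh)⟩
theorem dif.cr (hc : CI c) {a b : S} (h : dif c a b) : dif c a (c b) :=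
  ⟨h.2, by rw [hc.inv]; exact h.1⟩

theorem Gl.sum3 (hc : CI c) (h : Gl c V W) {p q r : S} (h1 : dif c p q) (h2 : dif c p r) (h3 : dif c q r) :
    nn c V W i p + nn c V W i q + nn c V W i r ≤ 16 := by
  have nd : [p, c p, q, c q, r, c r].Nodup := by
    have n := fun s => (hc.nf s).symm
    simp [n, h1.1, h1.2, h2.1, h2.2, h3.1, h3.2, (h1.cl hc).1, (h1.cl hc).2, (h2.cl hc).1, (h2.cl hc).2,
      (h3.cl hc).1, (h3.cl hc).2]
  have a := sum_fl (i := i) hc _ nd V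
  have b := sum_fl (i := i) hc _ nd W
  have e := card_of2 h.eq
  have := h.le
  have e1 := h.nneq (i := i) hc p
  have e2 := h.nneq (i := i) hc q
  have e3 := h.nneq (i := i) hc r
  simp at a b
  unfold nn nn' at *
  omega

theorem Gl.sum4 (hc : CI c) (h : Gl c V W) {p q r s : S} (h1 : dif c p q) (h2 : dif c p r) (h3 : dif c q r)
    (h4 : dif c p s) (h5 : dif c q s) (h6 : dif c r s) :
    nn c V W i p + nn c V W i q + nn c V W i r + nn c V W i s ≤ 16 := by
  have nd : [p, c p, q, c q, r, c r, s, c s].Nodup := by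
    have n := fun s => (hc.nf s).symm
    simp [n, h1.1, h1.2, h2.1, h2.2, h3.1, h3.2, (h1.cl hc).1, (h1.cl hc).2, (h2.cl hc).1, (h2.cl hc).2,
      (h3.cl hc).1, (h3.cl hc).2, h4.1, h4.2, h5.1, h5.2, h6.1, h6.2, (h4.cl hc).1, (h4.cl hc).2,
      (h5.cl hc).1, (h5.cl hc).2, (h6.cl hc).1, (h6.cl hc).2]
  have a := sum_fl (i := i) hc _ nd V
  have b := sum_fl (i := i) hc _ nd W
  have e := card_of2 h.eq
  have := h.le
  have e1 := h.nneq (i := i) hc p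
  have e2 := h.nneq (i := i) hc q
  have e3 := h.nneq (i := i) hc r
  have e4 := h.nneq (i := i) hc s
  simp at a b
  unfold nn nn' at *
  omega
end PB

namespace PB
open Finset Function
set_option linter.all false
variable {ι S : Type*} [Fintype ι] [DecidableEq ι] [DecidableEq S] {c : S → S}
  {T U : Finset ι} {E F A B C D M N : Finset (ι → S)} {x : ι → S → ℚ} {j k : ι} {e f g y t a : ι → S}
  {l s : S} {u : S → ℚ}


variable {V W Y : Finset (ι → S)} {i : ι} {o : ι → S}

/-- centre of the box of o -/
def ctr (c : S → S) (o : ι → S) : ι → S → ℚ := fun t => mk c [o t]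

theorem ctr_HP (hc : CI c) : HP c (ctr c o) := fun _ => mk_HU hc (ok1 hc)
theorem ctr_In : InB T o (ctr c o) := fun _ _ => mk_one (by simp)

theorem ctr_half {t : ι} (h1 : s ≠ o t) (h2 : s ≠ c (o t)) (hc : CI c) : ctr c o t s = 1/2 :=
  mk_half (by simpa using h1) (by simp; intro hh; exact h2 (by rw [← hh, hc.inv]))

theorem ctr_pow (hc : CI c) (h : ¬ DT c T o e) : ∃ n : ℕ, val T e (ctr c o) = (1/2)^n := by
  classical
  induction T using Finset.induction_on with
  | empty => exact ⟨0, by simp [val]⟩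
  | insert t T ht ih =>
    obtain ⟨n, hn⟩ := ih (fun hd => h (hd.mono (Finset.subset_insert _ _)))
    have hv : val (insert t T) e (ctr c o) = ctr c o t (e t) * val T e (ctr c o) := by
      simp only [val]; rw [Finset.prod_insert ht]
    by_cases h1 : e t = o t
    · refine ⟨n, ?_⟩
      rw [hv, hn, ctr, h1, mk_one (by simp), one_mul]
    · refine ⟨n + 1, ?_⟩
      rw [hv, hn, ctr_half h1 (fun hh => h ⟨t, by simp, hh⟩) hc]; ring

theorem pair22_aux (hc : CI c) {e1 e2 f0 f : ι → S} (hj : j ∈ U) (ha : e1 ≠ e2) (hff : f0 ≠ f)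
    (m1 : ¬ DT c U o e1) (m2 : ¬ DT c U o e2) (n1 : ctr c o j (e1 j) = 1/2) (n2 : ctr c o j (e2 j) = 1/2)
    (mf0 : ¬ DT c U o f0) (mf : ¬ DT c U o f)
    (i1 : ∀ x, HP c x → InB (U.erase j) o x → val (U.erase j) f0 x = val (U.erase j) e1 x)
    (i2 : ∀ x, HP c x → InB (U.erase j) o x →
      val (U.erase j) f x + val (U.erase j) f0 x = val (U.erase j) e2 x) :
    ∃ n : ℕ, val U e1 (ctr c o) + val U e2 (ctr c o) = 3 * (1/2)^n := by
  obtain ⟨k, hk, yk, f0k, fk1, fk2, fw, f0w⟩ := split2 hc hff.symm (fun hd => m2 (hd.mono er_sub))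
    (fun hd => mf (hd.mono er_sub)) (fun hd => mf0 (hd.mono er_sub)) i2
  obtain ⟨n, hn⟩ := ctr_pow hc (T := U.erase j) (fun hd => mf0 (hd.mono er_sub))
  have v1 := i1 _ (ctr_HP hc) ctr_In
  have v2 := i2 _ (ctr_HP hc) ctr_In
  have hff : val (U.erase j) f (ctr c o) = val (U.erase j) f0 (ctr c o) := by
    rw [val_erase hk, val_erase (e := f0) hk, val_eqT fw, val_eqT f0w, f0k]
    rw [yk] at fk1 fk2
    rw [ctr_half fk1 fk2 hc, ctr_half _ _ hc]
    · intro hh; exact fk2 (by rw [← hh, hc.inv])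
    · intro hh; exact fk1 (hc.inj hh)
  refine ⟨n + 1, ?_⟩
  rw [val_erase hj, val_erase (e := e2) hj, n1, n2, ← v1, ← v2, hff, hn]
  ring

theorem pair22 (hc : CI c) (hE : Code c U E) (hF : Code c U F) (tE : TF c U E) (tF : TF c U F)
    (ap : Apart U E F) (hE2 : E.card = 2) (hF2 : F.card = 2) (mE : ∀ e ∈ E, ¬ DT c U o e)
    (mF : ∀ e ∈ F, ¬ DT c U o e) (h : ∀ x, HP c x → InB U o x → sm U E x = sm U F x) :
    ∃ n : ℕ, sm U E (ctr c o) = 3 * (1/2)^n := by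
  obtain ⟨e1, e2, ha, rfl⟩ := Finset.card_eq_two.1 hE2
  have h1 : e1 ∈ ({e1, e2} : Finset (ι → S)) := by simp
  have h2 : e2 ∈ ({e1, e2} : Finset (ι → S)) := by simp
  obtain ⟨j, hj, hd⟩ := hE e1 h1 e2 h2 ha
  have m1 := mE e1 h1
  have m2 := mE e2 h2
  obtain ⟨f0, f0F, f0j, oth, i1, i2⟩ := CL (y := o) hc hj rfl hd m1 m2 (tE e1 h1 e2 h2 j hj hd) hF tF (by omega) mF
    (fun f hf hh => ap e1 h1 f hf hh.symm) (fun f hf hh => ap e2 h2 f hf hh.symm)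
    (fun x hx hxo => by rw [← h x hx hxo, sm_pair ha])
  have n1 : o j ≠ e1 j := fun hh => m2 ⟨j, hj, by rw [hd, hh]⟩
  have n2 : o j ≠ c (e1 j) := fun hh => m1 ⟨j, hj, by rw [hh, hc.inv]⟩
  have c1 : ctr c o j (e1 j) = 1/2 := ctr_half n1.symm (fun hh => n2 (by rw [hh, hc.inv])) hc
  have c2 : ctr c o j (e2 j) = 1/2 := by
    rw [hd]; exact ctr_half n2.symm (fun hh => n1 (hc.inj hh).symm) hc
  obtain ⟨f, hf, hff⟩ : ∃ f ∈ F, f ≠ f0 := by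
    by_contra hcon; push Not at hcon
    have : F ⊆ {f0} := fun f hf => by simp [hcon f hf]
    have := Finset.card_le_card this
    simp at this; omega
  have hFe : F = {f0, f} := by
    symm; apply Finset.eq_of_subset_of_card_le
    · intro z hz; simp at hz; rcases hz with rfl | rfl <;> assumption
    · rw [hF2, Finset.card_pair hff.symm]
  have flF : ∀ l, o j ≠ l → (f j = l → fl F j l = {f}) ∧ (f j ≠ l → fl F j l = ∅) := by
    intro l hl
    constructor
    · intro hh; ext z; rw [fl_mem, hFe]; simp
      constructor
      · rintro ⟨rfl | rfl, h⟩
        · rw [f0j] at h; exact absurd h hl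
        · rfl
      · rintro rfl; exact ⟨Or.inr rfl, hh⟩
    · intro hh; apply empty_of; intro z hz; rw [fl_mem, hFe] at hz; simp at hz
      rcases hz with ⟨rfl | rfl, h⟩
      · rw [f0j] at h; exact hl h
      · exact hh h
  rw [sm_pair ha]
  rcases oth f hf hff with hh | hh
  · rw [(flF _ n1).1 hh] at i1
    rw [(flF _ n2).2 (by rw [hh]; exact (hc.nf _).symm)] at i2
    simp only [sm_single, sm_empty, zero_add] at i1 i2
    rw [add_comm]
    exact pair22_aux hc hj ha.symm hff.symm m2 m1 c2 c1 (mF _ f0F) (mF _ hf) i2 i1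
  · rw [(flF _ n1).2 (by rw [hh]; exact (hc.nf _))] at i1
    rw [(flF _ n2).1 hh] at i2
    simp only [sm_single, sm_empty, zero_add] at i1 i2
    exact pair22_aux hc hj ha hff.symm m1 m2 c1 c2 (mF _ f0F) (mF _ hf) i1 i2

theorem no3 (a b : ℕ) : 3 * ((1/2 : ℚ)^a) + 3 * (1/2)^b ≠ 1 := by
  intro h
  have : (3 * (2^b + 2^a) : ℚ) = 2^a * 2^b := by
    have h1 : (2:ℚ)^a * (1/2)^a = 1 := by rw [← mul_pow]; norm_num
    have h2 : (2:ℚ)^b * (1/2)^b = 1 := by rw [← mul_pow]; norm_num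
    calc (3 * (2^b + 2^a) : ℚ) = 2^b * (3 * (2^a * (1/2)^a)) + 2^a * (3 * (2^b * (1/2)^b)) := by rw [h1, h2]; ring
      _ = 2^a * 2^b * (3 * ((1/2 : ℚ)^a) + 3 * (1/2)^b) := by ring
      _ = _ := by rw [h]; ring
  have h' : 3 * (2^b + 2^a) = 2^(a+b) := by rw [pow_add]; exact_mod_cast this
  have h3 : 3 ∣ 2^(a+b) := ⟨_, h'.symm⟩
  have := Nat.Prime.dvd_of_dvd_pow Nat.prime_three h3
  omega

structure YS (c : S → S) (U : Finset ι) (o : ι → S) (i : ι) (Y : Finset (ι → S)) : Prop where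
  cd : ∀ u, Code c U (fl Y i u)
  tf : ∀ u, TF c U (fl Y i u)
  ap : ∀ u, Apart U (fl Y i u) (fl Y i (c u))
  m : ∀ y ∈ Y, ¬ DT c U o y
  eq : ∀ u x, HP c x → InB U o x → sm U (fl Y i u) x = sm U (fl Y i (c u)) x
  two : ∀ x, HP c x → InB U o x → sm U Y x = 2

theorem YS.cards (h : YS c U o i Y) (hc : CI c) (hne : (fl Y i s).Nonempty) :
    (2 ≤ (fl Y i s).card ∧ 2 ≤ (fl Y i (c s)).card) ∨ 6 ≤ (fl Y i s).card + (fl Y i (c s)).card := by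
  have key : ∀ u, (fl Y i u).card = 1 → 5 ≤ (fl Y i (c u)).card := by
    intro u hu
    obtain ⟨e, he⟩ := Finset.card_eq_one.1 hu
    have hem : e ∈ fl Y i u := by simp [he]
    apply smL hc (y := o) (e := e) (h.cd _) (h.tf _) (fun f hf => h.m f (fl_sub hf)) (h.m e (fl_sub hem))
      (fun f hf hh => h.ap u e hem f hf hh.symm)
    intro x hx hxo
    rw [← h.eq u x hx hxo, he, sm_single]
  have k2 := key (c s)
  rw [hc.inv] at k2
  have k1 := key s
  have pos := Finset.card_pos.2 hne
  have pos2 : 0 < (fl Y i (c s)).card := by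
    rw [Finset.card_pos]
    by_contra hh
    rw [Finset.not_nonempty_iff_eq_empty] at hh
    obtain ⟨e, he⟩ := hne
    obtain ⟨q1, q2, q3⟩ := pt_spec hc (h.m e (fl_sub he))
    have := h.eq s _ q1 q2
    rw [hh, sm_empty] at this
    have h2 := val_le_sm (T := U) q1 he
    rw [this, val_one q3] at h2; norm_num at h2
  omega

theorem flflNe {l m : S} (h : m ≠ l) : fl (Y.filter (fun e => e i ≠ l)) i m = fl Y i m := by
  ext e; simp only [fl, Finset.mem_filter]
  constructor
  · rintro ⟨⟨p, q⟩, r⟩; exact ⟨p, r⟩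
  · rintro ⟨p, r⟩; exact ⟨⟨p, by rw [r]; exact h⟩, r⟩

theorem pair_split (hc : CI c) (u : S) : sm U Y x = sm U (fl Y i u) x + sm U (fl Y i (c u)) x +
    sm U (Y.filter (fun e => e i ≠ u ∧ e i ≠ c u)) x := by
  simp only [sm, fl, Finset.sum_filter]
  rw [← Finset.sum_add_distrib, ← Finset.sum_add_distrib]
  apply Finset.sum_congr rfl
  intro e he
  have := hc.nf u
  by_cases h1 : e i = u
  · simp [h1, this, this.symm]
  · by_cases h2 : e i = c u
    · simp [h2, this]
    · simp [h1, h2]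

theorem pair_split_card (hc : CI c) (u : S) : Y.card = (fl Y i u).card + (fl Y i (c u)).card +
    (Y.filter (fun e => e i ≠ u ∧ e i ≠ c u)).card := by
  have := pair_split (U := (∅ : Finset ι)) (Y := Y) (i := i) (x := fun _ _ => 0) hc u
  simp [sm, val] at this
  have h : ((Y.card : ℚ)) = (((fl Y i u).card + (fl Y i (c u)).card +
    (Y.filter (fun e => e i ≠ u ∧ e i ≠ c u)).card : ℕ) : ℚ) := by rw [this]; push_cast; ring
  exact_mod_cast h

theorem YS.main (h : YS c U o i Y) (hc : CI c) :
    6 ≤ Y.card ∧ (Y.card ≤ 8 → ∃ ω ∈ Y, EqT U ω o ∧ 5 ≤ (fl Y i (c (ω i))).card) := by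
  by_cases hex : ∃ ω ∈ Y, EqT U ω o
  · obtain ⟨ω, hω, hq⟩ := hex
    have hmem : ω ∈ fl Y i (ω i) := fl_mem.2 ⟨hω, rfl⟩
    have h5 : 5 ≤ (fl Y i (c (ω i))).card := by
      apply cover_card (t := o) hc (h.cd _) (h.tf _) (fun b hb hh => h.ap _ ω hmem b hb (hq.trans hh.symm))
      intro x hx hxo
      rw [← h.eq _ x hx hxo]
      apply code_box (h.cd _) hmem hx
      intro t ht; rw [hq t ht]; exact hxo t ht
    refine ⟨?_, fun _ => ⟨ω, hω, hq, h5⟩⟩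
    have := fl_card2 (B := Y) (j := i) (hc.nf (ω i)).symm
    have := Finset.card_pos.2 ⟨ω, hmem⟩
    omega
  · push Not at hex
    suffices 9 ≤ Y.card from ⟨by omega, fun hh => by omega⟩
    by_contra hlt
    have two0 := h.two _ (ctr_HP hc) ctr_In
    obtain ⟨e, he⟩ : Y.Nonempty := by
      by_contra hh
      rw [Finset.not_nonempty_iff_eq_empty] at hh
      rw [hh, sm_empty] at two0; norm_num at two0
    have hu : e ∈ fl Y i (e i) := fl_mem.2 ⟨he, rfl⟩
    have k1 := h.cards hc ⟨e, hu⟩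
    have sp := pair_split_card (Y := Y) (i := i) hc (e i)
    set R := Y.filter (fun f => f i ≠ e i ∧ f i ≠ c (e i)) with hR
    by_cases hRe : R = ∅
    · have full : ∀ x, HP c x → InB U o x → sm U (fl Y i (e i)) x = 1 := by
        intro x hx hxo
        have q1 := h.two x hx hxo
        rw [pair_split (i := i) hc (e i), ← hR, hRe, sm_empty, ← h.eq _ x hx hxo] at q1
        linarith
      have a1 := cover_card (t := o) hc (h.cd _) (h.tf _) (fun b hb => hex b (fl_sub hb)) full
      have a2 := cover_card (t := o) hc (h.cd _) (h.tf _) (fun b hb => hex b (fl_sub hb))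
        (fun x hx hxo => by rw [← h.eq _ x hx hxo]; exact full x hx hxo)
      omega
    · obtain ⟨f, hf⟩ := Finset.nonempty_iff_ne_empty.2 hRe
      have hf' := Finset.mem_filter.1 hf
      have hfu : f ∈ fl Y i (f i) := fl_mem.2 ⟨hf'.1, rfl⟩
      have k2 := h.cards hc ⟨f, hfu⟩
      have sp2 := pair_split_card (Y := R) (i := i) hc (f i)
      have r1 : fl R i (f i) = fl Y i (f i) := by
        ext z; simp only [fl, hR, Finset.mem_filter]
        constructor
        · rintro ⟨⟨p, q⟩, r⟩; exact ⟨p, r⟩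
        · rintro ⟨p, r⟩; exact ⟨⟨p, by rw [r]; exact hf'.2⟩, r⟩
      have r2 : fl R i (c (f i)) = fl Y i (c (f i)) := by
        ext z; simp only [fl, hR, Finset.mem_filter]
        constructor
        · rintro ⟨⟨p, q⟩, r⟩; exact ⟨p, r⟩
        · rintro ⟨p, r⟩
          refine ⟨⟨p, ?_, ?_⟩, r⟩ <;> rw [r] <;> intro hh
          · exact hf'.2.2 (by rw [← hh, hc.inv])
          · exact hf'.2.1 (hc.inj hh)
      rw [r1, r2] at sp2
      have z0 : (R.filter (fun g => g i ≠ f i ∧ g i ≠ c (f i))) = ∅ := Finset.card_eq_zero.1 (by omega)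
      obtain ⟨a, ha⟩ := pair22 hc (h.cd (e i)) (h.cd (c (e i))) (h.tf _) (h.tf _) (h.ap _) (by omega) (by omega)
        (fun f hf => h.m f (fl_sub hf)) (fun f hf => h.m f (fl_sub hf)) (h.eq _)
      obtain ⟨b, hb⟩ := pair22 hc (h.cd (f i)) (h.cd (c (f i))) (h.tf _) (h.tf _) (h.ap _) (by omega) (by omega)
        (fun f hf => h.m f (fl_sub hf)) (fun f hf => h.m f (fl_sub hf)) (h.eq _)
      rw [pair_split (i := i) hc (e i), ← hR, pair_split (i := i) (Y := R) hc (f i), r1, r2, z0, sm_empty,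
        ← h.eq _ _ (ctr_HP hc) ctr_In, ← h.eq _ _ (ctr_HP hc) ctr_In, ha, hb] at two0
      exact no3 a b (by linarith)
end PB

namespace PB
open Finset Function
set_option linter.all false
variable {ι S : Type*} [Fintype ι] [DecidableEq ι] [DecidableEq S] {c : S → S}
  {T U : Finset ι} {E F A B C D M N : Finset (ι → S)} {x : ι → S → ℚ} {j k : ι} {e f g y t a : ι → S}
  {l s : S} {u : S → ℚ}


variable {V W Y : Finset (ι → S)} {i : ι} {o z : ι → S} {p : S}

def Ui (i j k : ι) : Finset ι := ((univ.erase i).erase j).erase k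
def qq (c : S → S) (i : ι) (p : S) (E : Finset (ι → S)) : Finset (ι → S) :=
  E.filter (fun e => e i ≠ p ∧ e i ≠ c p)

theorem qq_mem : e ∈ qq c i p E ↔ e ∈ E ∧ e i ≠ p ∧ e i ≠ c p := by simp [qq]
theorem qq_sub : qq c i p E ⊆ E := Finset.filter_subset _ _

structure St (c : S → S) (V W : Finset (ι → S)) (i : ι) (p : S) (j k : ι) (o z : ι → S) : Prop where
  gl : Gl c V W
  hj : j ∈ univ.erase i
  hk : k ∈ (univ.erase i).erase j
  ow : EqT (Ui i j k) o z
  zj : dif c (z j) (o j)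
  ok : dif c (o k) (z k)
  id : ∀ x, HP c x → sm (univ.erase i) (fl V i p) x + val (univ.erase i) z x =
    sm (univ.erase i) (fl W i p) x + val (univ.erase i) o x
  Y : ∀ y ∈ qq c i p W, ¬ DT c (Ui i j k) o y → y j = o j ∧ y k = o k
  Z : ∀ y ∈ qq c i p V, ¬ DT c (Ui i j k) z y → y j = z j ∧ y k = z k
  s1 : (fl V i p).card = 2
  s2 : (fl V i (c p)).card = 2
  s3 : (fl W i p).card = 2
  s4 : (fl W i (c p)).card = 2

theorem St.symm (hc : CI c) (h : St c V W i p j k o z) : St c W V i p j k z o :=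
  ⟨h.gl.symm, h.hj, h.hk, h.ow.symm, h.zj.symm hc, h.ok.symm hc, fun x hx => (h.id x hx).symm, h.Z, h.Y,
    h.s3, h.s4, h.s1, h.s2⟩

theorem Gl.qDT (hc : CI c) (hW : Code c univ W) {y : ι → S} (hy : y ∈ qq c i p W) :
    (∀ e ∈ fl W i p, DT c (univ.erase i) y e) ∧ (∀ e ∈ fl W i (c p), DT c (univ.erase i) y e) := by
  obtain ⟨yW, n1, n2⟩ := qq_mem.1 hy
  constructor
  · intro e he
    rw [fl_mem] at he
    obtain ⟨t, ht, hd⟩ := hW y yW e he.1 (by rintro rfl; exact n1 he.2)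
    refine ⟨t, ?_, hd⟩
    simp; rintro rfl; rw [he.2] at hd; exact n2 (by rw [hd, hc.inv])
  · intro e he
    rw [fl_mem] at he
    obtain ⟨t, ht, hd⟩ := hW y yW e he.1 (by rintro rfl; exact n2 he.2)
    refine ⟨t, ?_, hd⟩
    simp; rintro rfl; rw [he.2] at hd; exact n1 (hc.inj hd).symm

theorem Gl.st (hc : CI c) (h : Gl c V W) (ho : occ c V W i p) (hn : nn c V W i p ≤ 5) :
    ∃ j k o z, St c V W i p j k o z := by
  obtain ⟨h1, h2, h3, h4, j, hj, k, hk, o, z, ow, zj, zj', ok, ok', id, hY, hZ⟩ := h.F1 hc ho hn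
  refine ⟨j, k, o, z, h, hj, hk, ow, ⟨zj, zj'⟩, ⟨ok, ok'⟩, id, ?_, ?_, h1, h2, h3, h4⟩
  · intro y hy hd
    have := Gl.qDT hc h.cW hy
    exact hY y this.1 this.2 hd
  · intro y hy hd
    have := Gl.qDT hc h.cV hy
    exact hZ y this.1 this.2 hd

/-- set coordinates j and k so that o is in and z is out -/
def xp (c : S → S) (o z : ι → S) (j k : ι) (x : ι → S → ℚ) : ι → S → ℚ :=
  update (update x j (mk c [o j, c (z j)])) k (mk c [o k])

theorem St.ok2' (hc : CI c) (h : St c V W i p j k o z) : ∀ s ∈ [o j, c (z j)], c s ∉ [o j, c (z j)] :=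
  ok2 hc (fun hh => h.zj.1 (hc.inj hh))

theorem St.jk (h : St c V W i p j k o z) : j ≠ k := fun hh => by have := h.hk; simp [hh] at this

theorem St.xpHP (hc : CI c) (h : St c V W i p j k o z) (hx : HP c x) : HP c (xp c o z j k x) :=
  HP_upd (HP_upd hx (mk_HU hc (h.ok2' hc))) (mk_HU hc (ok1 hc))

theorem St.xpval (h : St c V W i p j k o z) : val (univ.erase i) e (xp c o z j k x) =
    PB.mk c [o j, c (z j)] (e j) * (PB.mk c [o k] (e k) * val (Ui i j k) e x) := by
  rw [val_erase h.hj, val_erase h.hk, xp, val_upd, update_of_ne h.jk, update_self, update_self]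
  rw [Finset.erase_right_comm, val_upd, Finset.erase_right_comm, Ui]

theorem St.xpo (h : St c V W i p j k o z) (h1 : e j = o j) (h2 : e k = o k) :
    val (univ.erase i) e (xp c o z j k x) = val (Ui i j k) e x := by
  rw [h.xpval, h1, h2, mk_one (by simp), mk_one (by simp)]; ring

theorem St.xpz (hc : CI c) (h : St c V W i p j k o z) (h1 : e j = z j) :
    val (univ.erase i) e (xp c o z j k x) = 0 := by
  rw [h.xpval, h1, mk_zero hc (h.ok2' hc) (by simp)]; ring

theorem St.xple (hc : CI c) (h : St c V W i p j k o z) (hx : HP c x) :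
    val (univ.erase i) e (xp c o z j k x) ≤ val (Ui i j k) e x := by
  rw [h.xpval]
  have h1 := (mk_HU hc (h.ok2' hc)).le (e j)
  have h2 := (mk_HU hc (ok1 hc (a := o k))).le (e k)
  have h3 := val_nonneg (T := Ui i j k) (e := e) hx
  have h4 : PB.mk c [o k] (e k) * val (Ui i j k) e x ≤ 1 * val (Ui i j k) e x :=
    mul_le_mul_of_nonneg_right h2.2 h3
  have h5 : 0 ≤ PB.mk c [o k] (e k) * val (Ui i j k) e x := mul_nonneg h2.1 h3
  nlinarith

theorem St.xpY (hc : CI c) (h : St c V W i p j k o z) (hx : HP c x) (hxo : InB (Ui i j k) o x)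
    (hE : E ⊆ qq c i p W) : sm (univ.erase i) E (xp c o z j k x) = sm (Ui i j k) (mt c (Ui i j k) o E) x := by
  classical
  unfold sm mt
  rw [Finset.sum_filter]
  apply Finset.sum_congr rfl
  intro e he
  by_cases hd : DT c (Ui i j k) o e
  · rw [if_neg (by simpa using hd)]
    apply le_antisymm
    · rw [← val_zero hx hxo hd]; exact h.xple hc hx
    · exact val_nonneg (h.xpHP hc hx)
  · rw [if_pos hd]
    have := h.Y e (hE he) hd
    exact h.xpo this.1 this.2

theorem ev1 (hc : CI c) : sm univ E (update x i (PB.mk c [p])) =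
    sm (univ.erase i) (fl E i p) x + 1/2 * sm (univ.erase i) (qq c i p E) x := by
  rw [sm_upd (mem_univ i)]
  simp only [sm, fl, qq, Finset.sum_filter, Finset.mul_sum]
  rw [← Finset.sum_add_distrib]
  apply Finset.sum_congr rfl
  intro e he
  have := hc.nf p
  by_cases h1 : e i = p
  · rw [h1, mk_one (by simp)]; simp
  · by_cases h2 : e i = c p
    · rw [h2, mk_zero hc (ok1 hc) (by simp [hc.inv])]; simp [this]
    · rw [mk_half (by simpa using h1) (by simp; intro hh; exact h2 (by rw [← hh, hc.inv]))]
      simp [h1, h2]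

theorem St.idQ (hc : CI c) (h : St c V W i p j k o z) (hx : HP c x) :
    sm (univ.erase i) (qq c i p V) x + 2 * val (univ.erase i) o x =
    sm (univ.erase i) (qq c i p W) x + 2 * val (univ.erase i) z x := by
  have h1 := h.gl.eq _ (HP_upd (j := i) hx (mk_HU hc (ok1 hc (a := p))))
  rw [ev1 hc, ev1 hc] at h1
  have := h.id x hx
  linarith

noncomputable def YW (c : S → S) (W : Finset (ι → S)) (i : ι) (p : S) (j k : ι) (o : ι → S) : Finset (ι → S) :=
  mt c (Ui i j k) o (qq c i p W)

theorem sm_mono (hx : HP c x) (h : E ⊆ F) : sm T E x ≤ sm T F x :=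
  Finset.sum_le_sum_of_subset_of_nonneg h (fun _ _ _ => val_nonneg hx)

theorem St.YWp (h : St c V W i p j k o z) (he : e ∈ YW c W i p j k o) :
    e ∈ W ∧ e i ≠ p ∧ e i ≠ c p ∧ e j = o j ∧ e k = o k := by
  obtain ⟨h1, h2⟩ := mt_mem.1 he
  have h3 := qq_mem.1 h1
  exact ⟨h3.1, h3.2.1, h3.2.2, h.Y e h1 h2⟩

theorem St.ys (hc : CI c) (h : St c V W i p j k o z) : YS c (Ui i j k) o i (YW c W i p j k o) := by
  have at0 : ∀ x, HP c x → InB (Ui i j k) o x →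
      sm (univ.erase i) (qq c i p V) (xp c o z j k x) = 0 ∧ sm (univ.erase i) (qq c i p W) (xp c o z j k x) = 2 := by
    intro x hx hxo
    have hx' := h.xpHP hc hx
    have e1 := h.id _ hx'
    rw [h.xpz hc rfl, h.xpo rfl rfl, val_one hxo] at e1
    have e2 := sm_nonneg (T := univ.erase i) (E := fl W i p) hx'
    have e3 := code_le hc h.gl.cV (HP_upd (j := i) hx' (mk_HU hc (ok1 hc (a := p))))
    rw [ev1 hc] at e3
    have e4 := sm_nonneg (T := univ.erase i) (E := qq c i p V) hx'
    have e5 := h.idQ hc hx'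
    rw [h.xpz hc rfl, h.xpo rfl rfl, val_one hxo] at e5
    constructor <;> linarith
  have sub : ∀ u, ∀ e ∈ fl (YW c W i p j k o) i u, e ∈ W ∧ e i = u ∧ e j = o j ∧ e k = o k := by
    intro u e he
    have h1 := fl_mem.1 he
    have h2 := h.YWp h1.1
    exact ⟨h2.1, h1.2, h2.2.2.2⟩
  refine ⟨?_, ?_, ?_, ?_, ?_, ?_⟩
  · intro u
    exact (((h.gl.cW.mono (fun e he => (sub u e he).1)).er hc (fun e he => (sub u e he).2.1)).er hc
      (fun e he => (sub u e he).2.2.1)).er hc (fun e he => (sub u e he).2.2.2)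
  · intro u
    exact (((h.gl.tW.mono (fun e he => (sub u e he).1)).er (fun e he => (sub u e he).2.1)).er
      (fun e he => (sub u e he).2.2.1)).er (fun e he => (sub u e he).2.2.2)
  · intro u e he f hf hq
    obtain ⟨p1, p2, p3, p4⟩ := sub _ e he
    obtain ⟨q1, q2, q3, q4⟩ := sub _ f hf
    exact h.gl.tW e p1 f q1 i (mem_univ i) (by rw [q2, p2])
      (EqT.ext2 hq (by rw [p3, q3]) (by rw [p4, q4]))
  · intro y hy; exact (mt_mem.1 hy).2
  · intro u x hx hxo
    by_cases hu : u = p ∨ u = c p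
    · have e1 : ∀ v, v = p ∨ v = c p → fl (YW c W i p j k o) i v = ∅ := by
        intro v hv; apply empty_of; intro e he
        have h1 := fl_mem.1 he
        have h2 := h.YWp h1.1
        rcases hv with rfl | rfl
        · exact h2.2.1 h1.2
        · exact h2.2.2.1 h1.2
      rw [e1 u hu, e1 (c u) (by rcases hu with rfl | rfl <;> simp [hc.inv])]
    · push Not at hu
      have hx' := h.xpHP hc hx
      have e1 := sl2 hc (mem_univ i) h.gl.eq u _ hx'
      obtain ⟨a1, a2⟩ := at0 x hx hxo
      have hs : ∀ (E : Finset (ι → S)) (v : S), dif c v p → fl E i v ⊆ qq c i p E := by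
        intro E v hv e he
        have h1 := fl_mem.1 he
        exact qq_mem.2 ⟨h1.1, by rw [h1.2]; exact hv⟩
      have hz : ∀ v, dif c v p → sm (univ.erase i) (fl V i v) (xp c o z j k x) = 0 := by
        intro v hv
        apply le_antisymm
        · rw [← a1]; exact sm_mono hx' (hs V v hv)
        · exact sm_nonneg hx'
      have hw : ∀ v, mt c (Ui i j k) o (fl W i v) = fl (mt c (Ui i j k) o W) i v := by
        intro v; ext e; simp only [mt_mem, fl_mem]; tauto
      have hv : ∀ v, dif c v p → mt c (Ui i j k) o (fl W i v) = fl (YW c W i p j k o) i v := by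
        intro v hv; ext e; simp only [mt_mem, fl_mem, YW, qq_mem]
        constructor
        · rintro ⟨⟨p1, p2⟩, p3⟩; exact ⟨⟨⟨p1, by rw [p2]; exact hv⟩, p3⟩, p2⟩
        · rintro ⟨⟨⟨p1, -⟩, p3⟩, p2⟩; exact ⟨⟨p1, p2⟩, p3⟩
      have hdu : dif c u p := hu
      have hdc := hdu.cl hc
      rw [hz u hdu, hz (c u) hdc, h.xpY hc hx hxo (hs W _ hdu), h.xpY hc hx hxo (hs W _ hdc), hv _ hdu, hv _ hdc] at e1
      linarith
  · intro x hx hxo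
    have := (at0 x hx hxo).2
    rwa [h.xpY hc hx hxo (fun _ h => h)] at this

/-- evaluation at the half point -/
def gp (c : S → S) (o z : ι → S) (j k : ι) : ι → S → ℚ := xp c o z j k hfp

theorem St.gp_o (h : St c V W i p j k o z) (hE : ∀ e ∈ E, e j = o j ∧ e k = o k) :
    sm (univ.erase i) E (gp c o z j k) = E.card * (1/2)^(Ui i j k).card := by
  rw [← hfp_sm (T := Ui i j k) (E := E)]
  exact Finset.sum_congr rfl (fun e he => h.xpo (hE e he).1 (hE e he).2)
theorem St.gp_z (hc : CI c) (h : St c V W i p j k o z) (hE : ∀ e ∈ E, e j = z j) :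
    sm (univ.erase i) E (gp c o z j k) = 0 :=
  Finset.sum_eq_zero (fun e he => h.xpz hc (hE e he))
theorem St.gp_le (hc : CI c) (h : St c V W i p j k o z) :
    sm (univ.erase i) E (gp c o z j k) ≤ E.card * (1/2)^(Ui i j k).card := by
  rw [← hfp_sm (T := Ui i j k) (E := E)]
  exact Finset.sum_le_sum (fun e he => h.xple hc hfp_HP)

theorem sm_sdiff (h : F ⊆ E) : sm T E x = sm T F x + sm T (E \ F) x := by
  unfold sm; rw [add_comm, Finset.sum_sdiff h]

theorem St.gp_oz (hc : CI c) (h : St c V W i p j k o z) :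
    val (univ.erase i) o (gp c o z j k) = (1/2)^(Ui i j k).card ∧ val (univ.erase i) z (gp c o z j k) = 0 := by
  constructor
  · have := h.gp_o (E := {o}) (by simp)
    simpa [sm_single] using this
  · exact h.xpz hc rfl

theorem hpos (n : ℕ) : (0 : ℚ) < (1/2)^n := by positivity

/-- counting: sm M + val o = sm N + val z -/
theorem St.count (hc : CI c) (h : St c V W i p j k o z) (q : ℕ)
    (id : sm (univ.erase i) M (gp c o z j k) + q * val (univ.erase i) o (gp c o z j k) =
      sm (univ.erase i) N (gp c o z j k) + q * val (univ.erase i) z (gp c o z j k))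
    (hF : F ⊆ M) (hFz : ∀ e ∈ F, e j = z j) (hE : E ⊆ N) (hEo : ∀ e ∈ E, e j = o j ∧ e k = o k) :
    E.card + F.card ≤ M.card + q := by
  have gH : HP c (gp c o z j k) := h.xpHP hc hfp_HP
  rw [(h.gp_oz hc).1, (h.gp_oz hc).2, sm_sdiff hF, h.gp_z hc hFz, sm_sdiff hE, h.gp_o hEo] at id
  have h1 := h.gp_le hc (E := M \ F)
  have h2 := sm_nonneg (T := univ.erase i) (E := N \ E) gH
  have h3 := hpos (Ui i j k).card
  rw [Finset.card_sdiff_of_subset hF] at h1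
  have h4 := Finset.card_le_card hF
  push_cast [h4] at h1
  have : ((E.card : ℚ) + F.card) * (1/2)^(Ui i j k).card ≤ (M.card + q) * (1/2)^(Ui i j k).card := by
    rw [add_mul, add_mul]; rw [sub_mul] at h1; linarith
  have := le_of_mul_le_mul_right this h3
  exact_mod_cast this

theorem St.YZ (hc : CI c) (h : St c V W i p j k o z) :
    (YW c W i p j k o).card + (YW c V i p j k z).card ≤ 14 := by
  have gH : HP c (gp c o z j k) := h.xpHP hc hfp_HP
  have := h.count hc 2 (by exact_mod_cast h.idQ hc gH) (F := YW c V i p j k z) (E := YW c W i p j k o) mt_sub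
    (fun e he => ((h.symm hc).YWp he).2.2.2.1) mt_sub (fun e he => (h.YWp he).2.2.2)
  have h1 := pair_split_card (Y := V) (i := i) hc p
  have h2 := h.gl.le
  have h3 := h.s1
  have h4 := h.s2
  have h5 : (qq c i p V).card = (V.filter (fun e => e i ≠ p ∧ e i ≠ c p)).card := rfl
  omega

theorem St.get (hc : CI c) (h : St c V W i p j k o z) :
    ∃ ω ∈ W, dif c (ω i) p ∧ EqT (univ.erase i) ω o ∧
      ∃ G ⊆ fl W i (c (ω i)), 5 ≤ G.card ∧ ∀ e ∈ G, e j = o j ∧ e k = o k := by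
  have h1 := (h.ys hc).main hc
  have h2 := ((h.symm hc).ys hc).main hc
  have h3 := h.YZ hc
  obtain ⟨ω, hω, hq, h5⟩ := h1.2 (by omega)
  have hp := h.YWp hω
  refine ⟨ω, hp.1, ⟨hp.2.1, hp.2.2.1⟩, EqT.ext2 hq hp.2.2.2.1 hp.2.2.2.2, _, ?_, h5, ?_⟩
  · intro e he
    have := fl_mem.1 he
    exact fl_mem.2 ⟨(h.YWp this.1).1, this.2⟩
  · intro e he
    exact (h.YWp (fl_mem.1 he).1).2.2.2
end PB

namespace PB
open Finset Function
set_option linter.all false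
variable {ι S : Type*} [Fintype ι] [DecidableEq ι] [DecidableEq S] {c : S → S}
  {T U : Finset ι} {E F A B C D M N : Finset (ι → S)} {x : ι → S → ℚ} {j k : ι} {e f g y t a : ι → S}
  {l s : S} {u : S → ℚ}

variable {V W Y : Finset (ι → S)} {i : ι} {o z v ω ζ : ι → S} {p q r η : S}

theorem eqA (hc : CI c) (h : ∀ x, HP c x → val T e x = val T f x) : EqT T e f := by
  have hf : ¬ DT c T e f := by
    intro hd
    obtain ⟨x, hx, h1, -⟩ := meet_pt hc (notDT_self hc (T := T) (e := e))
    have := h x hx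
    rw [val_one h1, val_zero hx h1 hd] at this
    norm_num at this
  exact eqL hc (notDT_self hc) hf (fun x hx _ => h x hx)

theorem one_eq (hc : CI c) (h : ∀ x, HP c x → val T e x = sm T N x) : ∃ n, N = {n} ∧ EqT T e n := by
  have h1 : ({e} : Finset (ι → S)).card = N.card := card_of2 (T := T) (c := c) (by simpa using h)
  obtain ⟨n, hn⟩ := Finset.card_eq_one.1 (h1.symm.trans (by simp))
  refine ⟨n, hn, eqA hc ?_⟩
  intro x hx; rw [h x hx, hn, sm_single]

theorem ev1' (hc : CI c) (hj : j ∈ T) : sm T E (update x j (mk c [p])) =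
    sm (T.erase j) (fl E j p) x + 1/2 * sm (T.erase j) (qq c j p E) x := by
  rw [sm_upd hj]
  simp only [sm, fl, qq, Finset.sum_filter, Finset.mul_sum]
  rw [← Finset.sum_add_distrib]
  apply Finset.sum_congr rfl
  intro e he
  have := hc.nf p
  by_cases h1 : e j = p
  · rw [h1, mk_one (by simp)]; simp
  · by_cases h2 : e j = c p
    · rw [h2, mk_zero hc (ok1 hc) (by simp [hc.inv])]; simp [this]
    · rw [mk_half (by simpa using h1) (by simp; intro hh; exact h2 (by rw [← hh, hc.inv]))]
      simp [h1, h2]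

theorem allz (hj : j ∈ T) (hu : HU c u) (h : sm T N (update hfp j u) = 0) : ∀ e ∈ N, u (e j) = 0 := by
  intro e he
  unfold sm at h
  rw [Finset.sum_eq_zero_iff_of_nonneg (fun e _ => val_nonneg (HP_upd hfp_HP hu))] at h
  have h1 := h e he
  rw [val_upd' hj] at h1
  rcases mul_eq_zero.1 h1 with h2 | h2
  · exact h2
  · simp [val, hfp] at h2

theorem B1 (hc : CI c) (hj : j ∈ T) (hM : Code c T M) (tM : TF c T M) (M5 : M.card = 5) (hη : ∀ e ∈ M, e j = η)
    (ap : Apart T M N) (vN : ∀ e ∈ N, ¬ EqT T v e)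
    (id : ∀ x, HP c x → sm T M x + val T v x = sm T N x) : v j = η ∧ ∀ e ∈ N, e j = η := by
  have nf := hc.nf η
  have vN' : ∀ e ∈ N, v j = e j → ¬ EqT (T.erase j) v e := fun e he h1 h2 => vN e he (h2.ext h1)
  have N6 : N.card = 6 := by
    have := card_of (T := T) (c := c) (A := M) (D := {v}) (B := N) (C := ∅) (by simpa using id)
    simp at this; omega
  have idu : ∀ u, HU c u → ∀ x, HP c x →
      u η * sm (T.erase j) M x + u (v j) * val (T.erase j) v x = sm T N (update x j u) := by
    intro u hu x hx
    rw [← id _ (HP_upd hx hu), sm_updl hj hη, val_upd' hj]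
  by_cases h1 : v j = η
  · refine ⟨h1, ?_⟩
    have hu := mk_HU hc (ok1 hc (a := c η))
    have h2 := idu _ hu _ hfp_HP
    have h0 : mk c [c η] η = 0 := mk_zero hc (ok1 hc) (by simp)
    rw [h1, h0] at h2
    intro e he
    have := mk_eq_zero (allz hj hu (by rw [← h2]; ring) e he)
    exact hc.inj (by simpa using this)
  exfalso
  by_cases h2 : v j = c η
  · have hu := mk_HU hc (ok1 hc (a := c η))
    have h0 : mk c [c η] η = 0 := mk_zero hc (ok1 hc) (by simp)
    have h0' : mk c [c η] (c η) = 1 := mk_one (by simp)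
    have k0 : mk c [η] (c η) = 0 := mk_zero hc (ok1 hc) (by simp [hc.inv])
    have k0' : mk c [η] η = 1 := mk_one (by simp)
    have hq : qq c j (c η) N = qq c j η N := by
      ext e; simp only [qq_mem, hc.inv]; tauto
    have e1 : ∀ x, HP c x → val (T.erase j) v x = sm (T.erase j) (fl N j (c η)) x + 1/2 * sm (T.erase j) (qq c j η N) x := by
      intro x hx
      have := idu _ hu x hx
      rw [ev1' hc hj, h2, h0, h0', hq] at this
      linarith
    have e2 : ∀ x, HP c x → sm (T.erase j) M x = sm (T.erase j) (fl N j η) x + 1/2 * sm (T.erase j) (qq c j η N) x := by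
      intro x hx
      have := idu _ (mk_HU hc (ok1 hc (a := η))) x hx
      rw [ev1' hc hj, h2, k0, k0'] at this
      linarith
    have c1 : (1 : ℚ) = (fl N j (c η)).card + 1/2 * (qq c j η N).card := by
      have a := e1 _ hfp_HP
      rw [← sm_single, hfp_sm, hfp_sm, hfp_sm] at a
      have := hpos (T.erase j).card
      have h3 : ((1/2 : ℚ)^(T.erase j).card) ≠ 0 := this.ne'
      apply mul_right_cancel₀ h3
      rw [card_singleton] at a
      push_cast at a; linarith
    have c2 : 2 = 2 * (fl N j (c η)).card + (qq c j η N).card := by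
      have : (2 : ℚ) = 2 * (fl N j (c η)).card + (qq c j η N).card := by linarith
      exact_mod_cast this
    by_cases c3 : (qq c j η N).card = 0
    · have c4 := Finset.card_eq_zero.1 c3
      obtain ⟨n, hn, he⟩ := one_eq hc (T := T.erase j) (e := v) (N := fl N j (c η)) (by
        intro x hx; rw [e1 x hx, c4]; simp)
      have : n ∈ fl N j (c η) := by rw [hn]; simp
      have := fl_mem.1 this
      exact vN' n this.1 (by rw [h2, this.2]) he
    · have c4 : (fl N j (c η)).card = 0 := by omega
      have c5 := Finset.card_eq_zero.1 c4
      have c6 : (fl N j η).card = 4 := by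
        have := pair_split_card (Y := N) (i := j) hc η
        have h5 : (qq c j η N).card = (N.filter (fun e => e j ≠ η ∧ e j ≠ c η)).card := rfl
        omega
      have e3 : ∀ x, HP c x → sm (T.erase j) M x = sm (T.erase j) (fl N j η) x + val (T.erase j) v x := by
        intro x hx
        rw [e2 x hx, e1 x hx, c5]; simp
      have apj : Apart (T.erase j) M (fl N j η) := by
        intro e he f hf hh
        have := fl_mem.1 hf
        exact ap e he f this.1 (hh.ext (by rw [this.2, hη e he]))
      by_cases hw : ∃ w ∈ M, EqT (T.erase j) w v
      · obtain ⟨w, wM, hw⟩ := hw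
        have := K5 hc (X := fl N j η) ((hM.er hc hη).mono (Finset.erase_subset w M))
          ((tM.er hη).mono (Finset.erase_subset w M)) (apj.mono (Finset.erase_subset w M) (fun _ h => h)) (by
            intro x hx
            have := e3 x hx
            rw [sm_erase wM, val_eqT hw] at this
            linarith) (by rw [Finset.card_erase_of_mem wM]; omega)
        have c7 := Finset.card_erase_of_mem wM
        rw [this, M5] at c7; simp at c7
      · have := K5 hc (X := fl N j η ∪ {v}) (hM.er hc hη) (tM.er hη) (by
            intro e he f hf hh
            rcases Finset.mem_union.1 hf with hf | hf
            · exact apj e he f hf hh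
            · simp at hf; subst hf; exact hw ⟨e, he, hh⟩) (by
            intro x hx
            rw [sm_union (by simp [fl_mem, h1]), sm_single, e3 x hx]) (by omega)
        rw [this] at M5; simp at M5
  · have hd : dif c (v j) η := ⟨h1, h2⟩
    have ok := ok2 hc (a := c η) (b := c (v j)) (fun hh => ((hd.cl hc).1 (by rw [hh, hc.inv])))
    have ok' := ok2 hc (a := c η) (b := v j) (by rw [hc.inv]; exact h1)
    have hN : ∀ e ∈ N, e j = η ∨ e j = v j := by
      have hu := mk_HU hc ok
      have a := idu _ hu _ hfp_HP
      rw [mk_zero hc ok (by simp), mk_zero hc ok (by simp)] at a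
      intro e he
      have := mk_eq_zero (allz hj hu (by rw [← a]; ring) e he)
      simp at this
      exact this.imp hc.inj hc.inj
    obtain ⟨n, hn, he⟩ := one_eq hc (T := T.erase j) (e := v) (N := fl N j (v j)) (by
      intro x hx
      have a := idu _ (mk_HU hc ok') x hx
      rw [mk_zero hc ok' (by simp), mk_one (by simp), zero_mul, one_mul, zero_add] at a
      rw [a, sm_upd hj]
      simp only [sm, fl, Finset.sum_filter]
      apply Finset.sum_congr rfl
      intro e he
      by_cases h5 : e j = v j
      · rw [if_pos h5, h5, mk_one (by simp)]; ring
      · rw [if_neg h5, (hN e he).resolve_right h5, mk_zero hc ok' (by simp)]; ring)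
    have : n ∈ fl N j (v j) := by rw [hn]; simp
    have := fl_mem.1 this
    exact vN' n this.1 this.2.symm he

theorem Gl.half (hc : CI c) (h : Gl c V W) (hj : j ∈ univ.erase i) {G : Finset (ι → S)}
    (hG : G ⊆ fl W i (c q)) (G5 : 5 ≤ G.card) (hη : ∀ e ∈ G, e j = η) (n6 : nn c V W i q = 6) :
    ∃ v, fl V i q = {v} ∧ v j = η ∧ ∀ e ∈ fl W i q, e j = η := by
  have L := h.loc hc i q
  have id := sl2 hc (mem_univ i) h.eq q
  have g1 := Finset.card_le_card hG
  have dj : Disjoint (fl W i q) (fl V i (c q)) := fl_disj (hc.nf q).symm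
  have ap : Apart (univ.erase i) (fl W i (c q)) (fl W i q ∪ fl V i (c q)) := by
    intro e he f hf
    rcases Finset.mem_union.1 hf with hf | hf
    · exact L.CD.symm e he f hf
    · exact L.BD.symm e he f hf
  unfold nn at n6
  by_cases h0 : (fl V i q).card = 0
  · have h1 := Finset.card_eq_zero.1 h0
    have := K6 hc L.cD L.tD ap (by
      intro x hx; rw [sm_union dj, ← id x hx, h1]; simp) (by omega)
    rw [this, Finset.card_empty] at g1; omega
  · obtain ⟨v, hv⟩ := Finset.card_eq_one.1 (show (fl V i q).card = 1 by omega)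
    have vm : v ∈ fl V i q := by rw [hv]; simp
    have hGe := Finset.eq_of_subset_of_card_le hG (by omega)
    have := B1 hc hj L.cD L.tD (by omega) (by rw [← hGe]; exact hη) ap (by
      intro f hf
      rcases Finset.mem_union.1 hf with hf | hf
      · exact L.AC v vm f hf
      · exact L.AB v vm f hf) (v := v) (by
      intro x hx; rw [sm_union dj, ← id x hx, hv, sm_single]; ring)
    exact ⟨v, hv, this.1, fun e he => this.2 e (Finset.mem_union_left _ he)⟩

def A6 (c : S → S) (V W : Finset (ι → S)) (i : ι) (p q r : S) : Prop :=
  ∀ e ∈ V ∪ W, (e i = p ∨ e i = c p) ∨ (e i = q ∨ e i = c q) ∨ (e i = r ∨ e i = c r)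

theorem A6.fq (hc : CI c) (h : A6 c V W i p q r) : A6 c V W i p (c q) r := by
  intro e he; have := h e he; rw [hc.inv]; tauto
theorem A6.fr (hc : CI c) (h : A6 c V W i p q r) : A6 c V W i p q (c r) := by
  intro e he; have := h e he; rw [hc.inv]; tauto
theorem A6.symm (h : A6 c V W i p q r) : A6 c W V i p q r := by
  intro e he; rw [Finset.union_comm] at he; exact h e he

theorem occ.symm (h : occ c V W i p) : occ c W V i p := by
  obtain ⟨e, he, hh⟩ := h; exact ⟨e, by rw [Finset.union_comm]; exact he, hh⟩

theorem Gl.a6 (hc : CI c) (h : Gl c V W) (hpq : dif c p q) (hpr : dif c p r) (hqr : dif c q r)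
    (op : occ c V W i p) (or : occ c V W i r) (nq : 6 ≤ nn c V W i q) : A6 c V W i p q r := by
  intro e he
  by_contra hh
  push Not at hh
  have := h.sum4 hc hpq hpr hqr (dif.symm hc hh.1) (dif.symm hc hh.2.1) (dif.symm hc hh.2.2) (i := i)
  have h1 := h.n46 hc op
  have h2 := h.n46 hc or
  have h3 := h.n46 hc (i := i) (s := e i) ⟨e, he, Or.inl rfl⟩
  omega

theorem ok3 (hc : CI c) (hpq : dif c p q) (hpr : dif c p r) (hqr : dif c q r) : ∀ s ∈ [p, q, r], c s ∉ [p, q, r] := by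
  have a1 := hpq.cl hc
  have a2 := hpr.cl hc
  have a3 := hqr.cl hc
  have b1 := (hpq.symm hc).cl hc
  have b2 := (hpr.symm hc).cl hc
  have b3 := (hqr.symm hc).cl hc
  intro s hs
  simp at hs ⊢
  rcases hs with rfl | rfl | rfl
  · exact ⟨hc.nf _, a1.1, a2.1⟩
  · exact ⟨b1.1, hc.nf _, a3.1⟩
  · exact ⟨b2.1, b3.1, hc.nf _⟩

theorem ev3 (hc : CI c) (hpq : dif c p q) (hpr : dif c p r) (hqr : dif c q r)
    (h : ∀ e ∈ E, (e i = p ∨ e i = c p) ∨ (e i = q ∨ e i = c q) ∨ (e i = r ∨ e i = c r)) :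
    sm univ E (update x i (mk c [p, q, r])) = sm (univ.erase i) (fl E i p) x + sm (univ.erase i) (fl E i q) x
      + sm (univ.erase i) (fl E i r) x := by
  have ok := ok3 hc hpq hpr hqr
  rw [sm_upd (mem_univ i)]
  simp only [sm, fl, Finset.sum_filter]
  rw [← Finset.sum_add_distrib, ← Finset.sum_add_distrib]
  apply Finset.sum_congr rfl
  intro e he
  have z : ∀ s ∈ [p, q, r], e i = c s → mk c [p, q, r] (e i) = 0 ∧ e i ≠ p ∧ e i ≠ q ∧ e i ≠ r := by
    intro s hs h1
    have := ok s hs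
    rw [← h1] at this
    simp at this
    exact ⟨mk_zero hc ok (by rw [h1, hc.inv]; exact hs), this⟩
  have w : ∀ s ∈ [p, q, r], e i = s → mk c [p, q, r] (e i) = 1 := by
    intro s hs h1; rw [h1]; exact mk_one hs
  rcases h e he with (h1 | h1) | (h1 | h1) | (h1 | h1)
  · rw [w p (by simp) h1, h1]; simp [hpq.1, hpr.1]
  · obtain ⟨a, b, d, f⟩ := z p (by simp) h1
    rw [a]; simp [b, d, f]
  · rw [w q (by simp) h1, h1]; simp [hpq.1.symm, hqr.1]
  · obtain ⟨a, b, d, f⟩ := z q (by simp) h1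
    rw [a]; simp [b, d, f]
  · rw [w r (by simp) h1, h1]; simp [hpr.1.symm, hqr.1.symm]
  · obtain ⟨a, b, d, f⟩ := z r (by simp) h1
    rw [a]; simp [b, d, f]

theorem St.id3 (hc : CI c) (h : St c V W i p j k o z) (hpq : dif c p q) (hpr : dif c p r) (hqr : dif c q r)
    (ha : A6 c V W i p q r) (x : ι → S → ℚ) (hx : HP c x) :
    sm (univ.erase i) (fl V i q) x + sm (univ.erase i) (fl V i r) x + val (univ.erase i) o x =
    sm (univ.erase i) (fl W i q) x + sm (univ.erase i) (fl W i r) x + val (univ.erase i) z x := by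
  have h1 := h.gl.eq _ (HP_upd (j := i) hx (mk_HU hc (ok3 hc hpq hpr hqr)))
  rw [ev3 hc hpq hpr hqr (fun e he => ha e (Finset.mem_union_left _ he)),
    ev3 hc hpq hpr hqr (fun e he => ha e (Finset.mem_union_right _ he))] at h1
  have := h.id x hx
  linarith

theorem St.caseI (hc : CI c) (h : St c V W i p j k o z) (hpq : dif c p q) (hpr : dif c p r) (hqr : dif c q r)
    (ha : A6 c V W i p q r) (hω : ω ∈ fl W i q) (hωo : EqT (univ.erase i) ω o)
    (hv : fl V i q = {v}) (hvj : v j = o j) (hq : ∀ e ∈ fl W i q, e j = o j)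
    (h1 : ∀ e ∈ fl W i r, e j = z j) (h2 : ∀ e ∈ fl V i r, e j = z j) : False := by
  have ok := h.ok2' hc
  obtain ⟨n, hn, he⟩ := one_eq hc (T := (univ.erase i).erase j) (e := v) (N := (fl W i q).erase ω) (by
    intro x hx
    have a := h.id3 hc hpq hpr hqr ha _ (HP_upd (j := j) hx (mk_HU hc ok))
    rw [hv, sm_single, sm_updl h.hj hq, sm_updl h.hj h1, sm_updl h.hj h2, val_upd' h.hj, val_upd' h.hj,
      val_upd' h.hj, hvj, mk_one (by simp), mk_zero hc ok (by simp), sm_erase hω,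
      val_eqT (hωo.mono er_sub)] at a
    linarith)
  have hm : n ∈ (fl W i q).erase ω := by rw [hn]; simp
  have hm' := (Finset.mem_erase.1 hm).2
  have vm : v ∈ fl V i q := by rw [hv]; simp
  exact h.gl.ap.fl v vm n hm' (he.ext (by rw [hvj, hq n hm']))

theorem St.caseII (hc : CI c) (h : St c V W i p j k o z) (hpq : dif c p q) (hpr : dif c p r) (hqr : dif c q r)
    (ha : A6 c V W i p q r) (or : occ c V W i r) (nq : 6 ≤ nn c V W i q)
    (hω : ω ∈ fl W i q) (hωo : EqT (univ.erase i) ω o) (hζ : ζ ∈ fl V i q) (hζz : EqT (univ.erase i) ζ z)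
    {G H : Finset (ι → S)} (hG : G ⊆ fl W i (c q)) (G5 : 5 ≤ G.card) (Go : ∀ e ∈ G, e j = o j ∧ e k = o k)
    (hH : H ⊆ fl V i (c q)) (H5 : 5 ≤ H.card) (Hz : ∀ e ∈ H, e j = z j ∧ e k = z k) : False := by
  have cnt : ∀ r, dif c p r → dif c q r → A6 c V W i p q r →
      9 ≤ (fl V i (c q)).card + (fl V i r).card ∧ 9 ≤ (fl W i (c q)).card + (fl W i r).card := by
    intro r hpr hqr ha
    have hx : ∀ (E : Finset (ι → S)), Disjoint (fl E i (c q)) (fl E i r) := fun E => fl_disj (hqr.cl hc).1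
    have b := hpq.cr hc
    have d := hqr.cl hc
    have a1 := h.count hc 1 (M := fl V i (c q) ∪ fl V i r) (N := fl W i (c q) ∪ fl W i r) (by
      rw [sm_union (hx V), sm_union (hx W)]
      have := h.id3 hc b hpr d (ha.fq hc) (gp c o z j k) (h.xpHP hc hfp_HP)
      push_cast; linarith) (hH.trans Finset.subset_union_left) (fun e he => (Hz e he).1)
      (hG.trans Finset.subset_union_left) Go
    have a2 := (h.symm hc).count hc 1 (M := fl W i (c q) ∪ fl W i r) (N := fl V i (c q) ∪ fl V i r) (by
      rw [sm_union (hx V), sm_union (hx W)]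
      have := (h.symm hc).id3 hc b hpr d (ha.fq hc).symm (gp c z o j k) ((h.symm hc).xpHP hc hfp_HP)
      push_cast; linarith) (hG.trans Finset.subset_union_left) (fun e he => (Go e he).1)
      (hH.trans Finset.subset_union_left) Hz
    rw [Finset.card_union_of_disjoint (hx _)] at a1 a2
    omega
  have c1 := cnt r hpr hqr ha
  have c2 := cnt (c r) (hpr.cr hc) (hqr.cr hc) (ha.fr hc)
  have s3 := h.gl.sum3 hc hpq hpr hqr (i := i)
  have np : nn c V W i p = 4 := by unfold nn; rw [h.s1, h.s4]
  have e1 := h.gl.nneq hc q (i := i)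
  have e2 := h.gl.nneq hc r (i := i)
  have p1 := Finset.card_pos.2 ⟨ω, hω⟩
  have p2 := Finset.card_pos.2 ⟨ζ, hζ⟩
  have key : (fl V i q).card = 1 ∧ (fl W i q).card = 1 ∧ nn c V W i r ≤ 6 := by
    by_cases hr : nn c V W i r ≤ 5
    · obtain ⟨f1, f2, f3, f4, -⟩ := h.gl.F1 hc or hr
      unfold nn nn' at *; omega
    · unfold nn nn' at *; omega
  obtain ⟨k1, k2, k3⟩ := key
  have v1 : fl V i q = {ζ} := by
    obtain ⟨a, ha⟩ := Finset.card_eq_one.1 k1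
    rw [ha] at hζ ⊢; simp at hζ; rw [hζ]
  have w1 : fl W i q = {ω} := by
    obtain ⟨a, ha⟩ := Finset.card_eq_one.1 k2
    rw [ha] at hω ⊢; simp at hω; rw [hω]
  have fin : ∀ r, dif c p r → dif c q r → A6 c V W i p q r → (fl V i r).card ≤ 6 → fl V i r = ∅ ∧ fl W i r = ∅ := by
    intro r hpr hqr ha le
    have id : ∀ x, HP c x → sm (univ.erase i) (fl V i r) x = sm (univ.erase i) (fl W i r) x := by
      intro x hx
      have := h.id3 hc hpq hpr hqr ha x hx
      rw [v1, w1, sm_single, sm_single, val_eqT hωo, val_eqT hζz] at this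
      linarith
    have a := K6 hc (h.gl.cV.fl hc) h.gl.tV.fl h.gl.ap.fl id le
    have b := card_of2 id
    rw [a] at b
    exact ⟨a, Finset.card_eq_zero.1 b.symm⟩
  have f1 := fin r hpr hqr ha (by unfold nn at k3; omega)
  have f2 := fin (c r) (hpr.cr hc) (hqr.cr hc) (ha.fr hc) (by unfold nn at k3; unfold nn nn' at e2; omega)
  obtain ⟨e, he, hh⟩ := or
  rcases Finset.mem_union.1 he with he | he <;> rcases hh with hh | hh
  · have := fl_mem.2 ⟨he, hh⟩; rw [f1.1] at this; simp at this
  · have := fl_mem.2 ⟨he, hh⟩; rw [f2.1] at this; simp at this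
  · have := fl_mem.2 ⟨he, hh⟩; rw [f1.2] at this; simp at this
  · have := fl_mem.2 ⟨he, hh⟩; rw [f2.2] at this; simp at this

theorem St.fin (hc : CI c) (h : St c V W i p j k o z) (op : occ c V W i p) {q0 r0 : S} (oq : occ c V W i q0)
    (or : occ c V W i r0) (h1 : dif c p q0) (h2 : dif c p r0) (h3 : dif c q0 r0) : False := by
  obtain ⟨ω, ωW, ωp, ωo, G, hG, G5, Go⟩ := h.get hc
  obtain ⟨ζ, ζV, ζp, ζz, H, hH, H5, Hz⟩ := (h.symm hc).get hc
  have np : nn c V W i p = 4 := by unfold nn; rw [h.s1, h.s4]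
  have g1 := Finset.card_le_card hG
  have g2 := Finset.card_le_card hH
  have nq : 6 ≤ nn c V W i (ω i) := by
    rcases h.gl.n46 hc (i := i) (s := ω i) ⟨ω, Finset.mem_union_right _ ωW, Or.inl rfl⟩ with h4 | h4
    · unfold nn at h4; omega
    · exact h4
  have nr : 6 ≤ nn c V W i (ζ i) := by
    rcases h.gl.n46 hc (i := i) (s := ζ i) ⟨ζ, Finset.mem_union_left _ ζV, Or.inl rfl⟩ with h4 | h4
    · rw [h.gl.nneq hc] at h4; unfold nn' at h4; omega
    · exact h4
  have hpq := ωp.symm hc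
  have hpr := ζp.symm hc
  by_cases hd : dif c (ω i) (ζ i)
  · have s3 := h.gl.sum3 hc hpq hpr hd (i := i)
    obtain ⟨v, b1, b2, b3⟩ := h.gl.half hc h.hj hG G5 (fun e he => (Go e he).1) (by omega)
    obtain ⟨w, d1, d2, d3⟩ := h.gl.symm.half hc h.hj hH H5 (fun e he => (Hz e he).1) (by
      have := h.gl.nneq hc (i := i) (ζ i)
      unfold nn' at this; unfold nn at *; omega)
    refine h.caseI hc hpq hpr hd (h.gl.a6 hc hpq hpr hd op ⟨ζ, Finset.mem_union_left _ ζV, Or.inl rfl⟩ nq)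
      (fl_mem.2 ⟨ωW, rfl⟩) ωo b1 b2 b3 ?_ d3
    intro e he; rw [d1] at he; simp at he; rw [he, d2]
  · obtain ⟨r, or', r1, r2⟩ : ∃ r, occ c V W i r ∧ dif c p r ∧ dif c (ω i) r := by
      by_cases hh : dif c (ω i) r0
      · exact ⟨r0, or, h2, hh⟩
      · refine ⟨q0, oq, h1, ?_⟩
        by_contra hh'
        have a : ω i = r0 ∨ ω i = c r0 := by unfold dif at hh; tauto
        rcases a with a | a <;> rw [a] at hh'
        · exact hh' (h3.symm hc)
        · exact hh' ((h3.symm hc).cl hc)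
    have s3 := h.gl.sum3 hc hpq r1 r2 (i := i)
    have n3 := h.gl.n46 hc or'
    have a : ω i = ζ i ∨ ω i = c (ζ i) := by unfold dif at hd; tauto
    rcases a with a | a
    · exact h.caseII hc hpq r1 r2 (h.gl.a6 hc hpq r1 r2 op or' nq) or' nq (fl_mem.2 ⟨ωW, rfl⟩) ωo
        (fl_mem.2 ⟨ζV, a.symm⟩) ζz hG G5 Go (by rw [a]; exact hH) H5 Hz
    · rw [← a] at g2
      unfold nn at *; omega

theorem Gl.fin (hc : CI c) (h : Gl c V W) (op : occ c V W i p) (oq : occ c V W i q) (or : occ c V W i r)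
    (h1 : dif c p q) (h2 : dif c p r) (h3 : dif c q r) : False := by
  have s := h.sum3 hc h1 h2 h3 (i := i)
  by_cases a : nn c V W i p ≤ 5
  · obtain ⟨j, k, o, z, hs⟩ := h.st hc op a
    exact hs.fin hc op oq or h1 h2 h3
  · by_cases b : nn c V W i q ≤ 5
    · obtain ⟨j, k, o, z, hs⟩ := h.st hc oq b
      exact hs.fin hc oq op or (h1.symm hc) h3 h2
    · obtain ⟨j, k, o, z, hs⟩ := h.st hc or (by omega)
      exact hs.fin hc or op oq (h2.symm hc) (h3.symm hc) h1
end PB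


theorem PB.bridge_pt {S : Type*} [DecidableEq S] {c : S → S} {d : ℕ} {V : Finset (Fin d → S)}
    {x : Fin d → S → ℚ} (hx : PB.ZO c x) :
    (fun i => {s | x i s = 1}) ∈ CodeReal c V ↔ ∃ e ∈ V, PB.InB Finset.univ e x := by
  have hE : ∀ i, {s | x i s = 1} ∈ ESet c := by
    intro i s
    have h1 := (hx i s).1
    rcases (hx i s).2 with h | h
    · right; simp [h1, h]
    · left; simp [h1, h]
  simp only [CodeReal, Set.mem_iUnion, WordBox, Set.mem_setOf_eq, PB.InB]
  constructor
  · rintro ⟨e, he, h⟩; exact ⟨e, he, fun i _ => (h i).2⟩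
  · rintro ⟨e, he, h⟩; exact ⟨e, he, fun i => ⟨hE i, h i (Finset.mem_univ i)⟩⟩

theorem PB.bridge {S : Type*} [DecidableEq S] {c : S → S} (hc : PB.CI c) {d : ℕ} {V W : Finset (Fin d → S)}
    (hV : PB.Code c Finset.univ V) (hW : PB.Code c Finset.univ W) (h : CodeReal c V = CodeReal c W)
    {x : Fin d → S → ℚ} (hx : PB.HP c x) : PB.sm Finset.univ V x ≤ PB.sm Finset.univ W x := by
  have := PB.ext01 hc ((PB.MA_sm (T := Finset.univ) (E := W)).sub (PB.MA_sm (T := Finset.univ) (E := V))) hx (by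
    intro y hy _
    rcases PB.zo_code hV hy with h0 | ⟨h1, h2⟩
    · rw [h0, sub_zero]; exact PB.sm_nonneg hy.hp
    · rw [← PB.bridge_pt hy, h, PB.bridge_pt hy] at h2
      obtain ⟨f, hf, hb⟩ := h2
      rw [h1, PB.code_box hW hf hy.hp hb]; norm_num)
  linarith

/-- Let `d ∈ {5,6}` and let `V, W ⊆ S^d` be disjoint equivalent polybox codes
without twin pairs, `|V| ∈ {13,...,16}`, `V` not flat. Then `V` and `W` can be
written down in a four-letter alphabet: for every coordinate `i` there are letters
`l, s ∈ S` such that every letter occurring at position `i` in a word of `V ∪ W`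
belongs to `{l, l', s, s'}`. -/
theorem codes_in_four_letter_alphabet {S : Type*} [Fintype S] [DecidableEq S]
    (c : S → S) (hinv : ∀ s, c (c s) = s) (hnfix : ∀ s, c s ≠ s)
    (d : ℕ) (hd : d = 5 ∨ d = 6) (V W : Finset (Fin d → S))
    (hVcode : PolyboxCode c V) (hWcode : PolyboxCode c W)
    (hVtp : TwinPairFree c V) (hWtp : TwinPairFree c W)
    (hdisj : Disjoint V W) (hequiv : EquivalentCodes c V W)
    (hcard : 13 ≤ V.card ∧ V.card ≤ 16) (hflat : ¬ IsFlat c V) :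
    ∀ i : Fin d, ∃ l s : S, ∀ v : Fin d → S, v ∈ V ∪ W →
      v i = l ∨ v i = c l ∨ v i = s ∨ v i = c s := by
  have hc : PB.CI c := ⟨hinv, hnfix⟩
  have code : ∀ E : Finset (Fin d → S), PolyboxCode c E → PB.Code c Finset.univ E := by
    intro E hE u hu v hv huv
    obtain ⟨j, hj⟩ := hE u hu v hv huv
    exact ⟨j, Finset.mem_univ j, hj⟩
  have tf : ∀ E : Finset (Fin d → S), TwinPairFree c E → PB.TF c Finset.univ E := by
    intro E hE u hu v hv j _ hj hq
    exact hE u hu v hv ⟨j, hj, fun i hi => hq i (by simp [hi])⟩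
  have gl : PB.Gl c V W := ⟨code V hVcode, code W hWcode, tf V hVtp, tf W hWtp, hdisj,
    fun x hx => le_antisymm (PB.bridge hc (code V hVcode) (code W hWcode) hequiv hx)
      (PB.bridge hc (code W hWcode) (code V hVcode) hequiv.symm hx), hcard.2⟩
  intro i
  have hne : 0 < V.card := by omega
  obtain ⟨v0, hv0⟩ := Finset.card_pos.1 hne
  have o0 : PB.occ c V W i (v0 i) := ⟨v0, Finset.mem_union_left _ hv0, Or.inl rfl⟩
  by_cases h1 : ∃ v ∈ V ∪ W, PB.dif c (v i) (v0 i)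
  · obtain ⟨v1, m1, d1⟩ := h1
    refine ⟨v0 i, v1 i, ?_⟩
    intro v hv
    by_contra hh
    push Not at hh
    exact gl.fin hc (i := i) o0 ⟨v1, m1, Or.inl rfl⟩ ⟨v, hv, Or.inl rfl⟩ (d1.symm hc)
      (PB.dif.symm hc ⟨hh.1, hh.2.1⟩) (PB.dif.symm hc hh.2.2)
  · refine ⟨v0 i, v0 i, ?_⟩
    intro v hv
    by_contra hh
    push Not at hh
    exact h1 ⟨v, hv, hh.1, hh.2.1⟩
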